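/- Reverse Hölder inequality for supersolutions: Let 0 < r ≤ 1 with r < R. Let u be a weak supersolution of −div(A(x,∇u)) + Lu = f in Ω with u ≥ 0 in B_R(x₀) ⊂ Ω, where f ∈ L^{q/p}(B_R(x₀)) and q > n. Set v = u + d, where d > r^{p'} R^{−p'} Tail(u₋; x₀, R) + r^{(p−n)/(p−1)} R^{n(q−p)/(q(p−1))} ‖f‖_{L^{q/p}(B_R(x₀))}^{1/(p−1)}, with u₋ = max{−u, 0}. Let 0 < γ < 1 and set λ₀ = (p−1)κ. Then for every λ ∈ (0, λ₀) there exist constants C = C(n,p,q,s,C₁,C₂,Λ,λ,γ) > 0 and θ = θ(n,p,s) > 0 such that for all γ ≤ σ' < σ ≤ 1 and all 0 < μ < λ, ( ⨍_{B_{σ'r}(x₀)} v^{λ} dx )^{1/λ} ≤ ( C (σ − σ')^{−θ} )^{1/μ} ( ⨍_{B_{σr}(x₀)} v^{μ} dx )^{1/μ}. -/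

import Mathlib

open MeasureTheory Real Set Metric
open scoped RealInnerProductSpace ENNReal Topology NNReal

noncomputable section

abbrev En (n : ℕ) := EuclideanSpace ℝ (Fin n)

/-- Smooth test function compactly supported in `s`. -/
def TestFun {n : ℕ} (s : Set (En n)) (φ : En n → ℝ) : Prop :=
  ContDiff ℝ (⊤ : ℕ∞) φ ∧ HasCompactSupport φ ∧ tsupport φ ⊆ s

/-- `J_p(t) = |t|^{p-2} t`. -/
def Jp (p t : ℝ) : ℝ := |t| ^ (p - 2) * t

/-- `G` is a weak gradient of `u` on the open set `Ω`. -/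
def HasWeakGradOn {n : ℕ} (u : En n → ℝ) (G : En n → En n) (Ω : Set (En n)) : Prop :=
  ∀ φ : En n → ℝ, TestFun Ω φ → ∫ x, u x • gradient φ x = - ∫ x, φ x • G x

/-- `u ∈ W^{1,p}_loc(Ω)` with weak gradient `G`. -/
def MemW1pLoc {n : ℕ} (p : ℝ) (u : En n → ℝ) (G : En n → En n) (Ω : Set (En n)) : Prop :=
  HasWeakGradOn u G Ω ∧
    ∀ k : Set (En n), IsCompact k → k ⊆ Ω →
      IntegrableOn (fun x => |u x| ^ p) k ∧ IntegrableOn (fun x => ‖G x‖ ^ p) k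

/-- `u` belongs to the tail space `L^{p-1}_{ps}(ℝⁿ)`. -/
def MemTailSpace {n : ℕ} (p s : ℝ) (u : En n → ℝ) : Prop :=
  Integrable (fun y : En n => |u y| ^ (p - 1) * (1 + ‖y‖) ^ (-((n : ℝ) + p * s)))

/-- The structural setting for the mixed local-nonlocal operator
`-div(A(x,∇u)) + L u` on a bounded open set `Ω ⊆ ℝⁿ`. -/
structure Setting (n : ℕ) (p s C₁ C₂ Λ : ℝ) where
  Ω : Set (En n)
  A : En n → En n → En n
  K : En n → En n → ℝ
  hΩopen : IsOpen Ω
  hΩbdd : Bornology.IsBounded Ω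
  hC₁ : 0 < C₁
  hC₂ : 0 < C₂
  hΛ : 1 ≤ Λ
  hAmeas : ∀ ξ, Measurable fun x => A x ξ
  hAcont : ∀ x, Continuous (A x)
  hAgrowth : ∀ᵐ x ∂(volume : Measure (En n)), x ∈ Ω → ∀ ξ, ‖A x ξ‖ ≤ C₂ * ‖ξ‖ ^ (p - 1)
  hAcoerc : ∀ᵐ x ∂(volume : Measure (En n)), x ∈ Ω → ∀ ξ, C₁ * ‖ξ‖ ^ p ≤ ⟪A x ξ, ξ⟫
  hKmeas : Measurable (Function.uncurry K)
  hKnonneg : ∀ x y, 0 ≤ K x y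
  hKsymm : ∀ x y, K x y = K y x
  hKlower : ∀ᵐ z ∂(volume : Measure (En n × En n)),
    Λ⁻¹ * ‖z.1 - z.2‖ ^ (-((n : ℝ) + p * s)) ≤ K z.1 z.2
  hKupper : ∀ᵐ z ∂(volume : Measure (En n × En n)),
    K z.1 z.2 ≤ Λ * ‖z.1 - z.2‖ ^ (-((n : ℝ) + p * s))

variable {n : ℕ} {p s C₁ C₂ Λ : ℝ}

/-- The mixed local-nonlocal energy form tested against `φ`. -/
def Eform (S : Setting n p s C₁ C₂ Λ) (u : En n → ℝ) (G : En n → En n) (φ : En n → ℝ) : ℝ :=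
  (∫ x, ⟪S.A x (G x), gradient φ x⟫) +
    ∫ x, ∫ y, Jp p (u x - u y) * (φ x - φ y) * S.K x y

/-- Weak supersolution of `-div(A(x,∇u)) + L u = f` in `Ω`. -/
def IsSupersol (S : Setting n p s C₁ C₂ Λ) (f u : En n → ℝ) (G : En n → En n) : Prop :=
  MemW1pLoc p u G S.Ω ∧ MemTailSpace p s u ∧
    ∀ φ : En n → ℝ, TestFun S.Ω φ → (∀ x, 0 ≤ φ x) → (∫ x, f x * φ x) ≤ Eform S u G φ

/-- Weak subsolution of `-div(A(x,∇u)) + L u = f` in `Ω`. -/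
def IsSubsol (S : Setting n p s C₁ C₂ Λ) (f u : En n → ℝ) (G : En n → En n) : Prop :=
  MemW1pLoc p u G S.Ω ∧ MemTailSpace p s u ∧
    ∀ φ : En n → ℝ, TestFun S.Ω φ → (∀ x, 0 ≤ φ x) → Eform S u G φ ≤ ∫ x, f x * φ x

/-- Weak solution of `-div(A(x,∇u)) + L u = f` in `Ω`. -/
def IsSol (S : Setting n p s C₁ C₂ Λ) (f u : En n → ℝ) (G : En n → En n) : Prop :=
  MemW1pLoc p u G S.Ω ∧ MemTailSpace p s u ∧
    ∀ φ : En n → ℝ, TestFun S.Ω φ → Eform S u G φ = ∫ x, f x * φ x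

/-- The nonlocal tail `Tail(v; x₀, ρ)`. -/
def Tail (n : ℕ) (p s : ℝ) (v : En n → ℝ) (x₀ : En n) (ρ : ℝ) : ℝ :=
  (ρ ^ p * ∫ y in (ball x₀ ρ)ᶜ, |v y| ^ (p - 1) * ‖y - x₀‖ ^ (-((n : ℝ) + p * s))) ^ (1 / (p - 1))

/-- `L^m`-norm of `f` on a set `B`. -/
def normLp {n : ℕ} (m : ℝ) (f : En n → ℝ) (B : Set (En n)) : ℝ :=
  (∫ x in B, |f x| ^ m) ^ (1 / m)

/-- Negative part `u₋ = max (−u) 0`. -/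
def nneg {n : ℕ} (u : En n → ℝ) : En n → ℝ := fun x => max (-u x) 0

/-- Positive part `u₊ = max u 0`. -/
def npos {n : ℕ} (u : En n → ℝ) : En n → ℝ := fun x => max (u x) 0

/-- The threshold quantity
`r^{p'} R^{−p'} Tail(u₋; x₀, R) + r^{(p−n)/(p−1)} R^{n(q−p)/(q(p−1))} ‖f‖_{L^{q/p}(B_R(x₀))}^{1/(p−1)}`. -/
def dBound (n : ℕ) (p s q : ℝ) (u f : En n → ℝ) (x₀ : En n) (r R : ℝ) : ℝ :=
  r ^ (p / (p - 1)) * R ^ (-(p / (p - 1))) * Tail n p s (nneg u) x₀ R +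
    r ^ ((p - n) / (p - 1)) * R ^ (n * (q - p) / (q * (p - 1))) *
      (normLp (q / p) f (ball x₀ R)) ^ (1 / (p - 1))

lemma rpow_sub_mul_le_of_lt {p β a b x y : ℝ} (hp : 1 < p) (hβ : 0 < β) (hβp : β < p - 1)
    (hb : 0 < b) (hab : b < a) (hx : 0 ≤ x) (hy : 0 ≤ y) :
    (a - b) ^ (p - 1) * (x ^ p * a ^ (-β) - y ^ p * b ^ (-β)) ≤
      p * (p / β) ^ (p - 1) * |x - y| ^ p * (if 0 < x then a ^ (p - 1 - β) else 0) := by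
  have ha : 0 < a := hb.trans hab
  have hnn : 0 ≤ p * (p / β) ^ (p - 1) * |x - y| ^ p * (if 0 < x then a ^ (p - 1 - β) else 0) := by
    split_ifs <;> positivity
  rcases le_or_gt (x ^ p * a ^ (-β) - y ^ p * b ^ (-β)) 0 with hE | hE
  · exact (mul_nonpos_of_nonneg_of_nonpos (rpow_nonneg (by linarith) _) hE).trans hnn
  have hE' : y ^ p * b ^ (-β) < x ^ p * a ^ (-β) := by linarith
  have hx0 : 0 < x := by
    rcases hx.eq_or_lt with h | h
    · rw [← h, zero_rpow (by linarith), zero_mul] at hE'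
      have : 0 ≤ y ^ p * b ^ (-β) := by positivity
      linarith
    · exact h
  have hba : a ^ (-β) < b ^ (-β) := rpow_lt_rpow_of_neg hb hab (by linarith)
  have hyx : y < x := by
    by_contra! h
    have h1 : x ^ p ≤ y ^ p := rpow_le_rpow hx h (by linarith)
    have h2 : x ^ p * a ^ (-β) ≤ y ^ p * b ^ (-β) := by
      have := rpow_nonneg hy p
      have := rpow_pos_of_pos ha (-β)
      gcongr
    linarith
  rw [if_pos hx0, abs_of_pos (by linarith)]
  obtain ⟨z, rfl⟩ : ∃ z, y = x * z := ⟨y / x, by field_simp⟩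
  obtain ⟨ρ, rfl⟩ : ∃ ρ, b = a * ρ := ⟨b / a, by field_simp⟩
  have hz0 : 0 ≤ z := by by_contra! h; nlinarith
  have hz1 : z < 1 := by by_contra! h; nlinarith
  have hρ0 : 0 < ρ := by by_contra! h; nlinarith
  have hρ1 : ρ < 1 := by by_contra! h; nlinarith
  rw [mul_rpow hx hz0, mul_rpow ha.le hρ0.le] at hE' ⊢
  have hxa : 0 < x ^ p * a ^ (-β) := by positivity
  have hzr : z ^ p * ρ ^ (-β) < 1 := by
    by_contra! h
    nlinarith
  have hzr2 : z ^ p < ρ ^ β := by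
    rw [rpow_neg hρ0.le] at hzr
    have : 0 < ρ ^ β := by positivity
    field_simp at hzr
    exact hzr
  have hzr3 : z ^ (p / β) ≤ ρ := by
    have := rpow_le_rpow (z := 1 / β) (by positivity) hzr2.le (by positivity)
    rwa [← rpow_mul hz0, ← rpow_mul hρ0.le, mul_one_div, mul_one_div_cancel hβ.ne', rpow_one] at this
  have hB1 : 1 - ρ ≤ p / β * (1 - z) := by
    have := one_add_mul_self_le_rpow_one_add (s := z - 1) (p := p / β) (by linarith)
      (by rw [le_div_iff₀ hβ]; linarith)
    rw [add_sub_cancel] at this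
    linarith
  have hB2 : 1 - z ^ p ≤ p * (1 - z) := by
    have := one_add_mul_self_le_rpow_one_add (s := z - 1) (p := p) (by linarith) hp.le
    rw [add_sub_cancel] at this
    linarith
  have hρβ : 1 ≤ ρ ^ (-β) := one_le_rpow_of_pos_of_le_one_of_nonpos hρ0 hρ1.le (by linarith)
  have hB3 : 1 - z ^ p * ρ ^ (-β) ≤ p * (1 - z) := by
    have : 0 ≤ z ^ p := by positivity
    nlinarith
  have h1z : 0 ≤ 1 - z := by linarith
  calc (a - a * ρ) ^ (p - 1) * (x ^ p * a ^ (-β) - x ^ p * z ^ p * (a ^ (-β) * ρ ^ (-β)))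
      = a ^ (p - 1) * (1 - ρ) ^ (p - 1) * (x ^ p * a ^ (-β) * (1 - z ^ p * ρ ^ (-β))) := by
        rw [show a - a * ρ = a * (1 - ρ) by ring, mul_rpow ha.le (by linarith : 0 ≤ 1 - ρ)]
        ring
    _ ≤ a ^ (p - 1) * (p / β * (1 - z)) ^ (p - 1) * (x ^ p * a ^ (-β) * (p * (1 - z))) := by
        have : 0 ≤ 1 - z ^ p * ρ ^ (-β) := by linarith
        have : 0 ≤ 1 - ρ := by linarith
        gcongr
    _ = p * (p / β) ^ (p - 1) * (x ^ p * ((1 - z) ^ (p - 1) * (1 - z))) *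
          (a ^ (p - 1) * a ^ (-β)) := by
        rw [mul_rpow (by positivity) h1z]; ring
    _ = p * (p / β) ^ (p - 1) * (x - x * z) ^ p * a ^ (p - 1 - β) := by
        rw [← rpow_add ha, ← sub_eq_add_neg]
        have : (1 - z) ^ (p - 1) * (1 - z) = (1 - z) ^ p := by
          conv_lhs => rw [← rpow_one (1 - z), ← rpow_mul h1z, one_mul,
            ← rpow_add (by linarith)]
          ring_nf
        rw [this, ← mul_rpow hx h1z]
        ring_nf

/-- Pointwise inequality behind the Caccioppoli estimate for the nonlocal term. -/
lemma Jp_mul_sub_le {p β a b x y : ℝ} (hp : 1 < p) (hβ : 0 < β) (hβp : β < p - 1)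
    (ha : 0 < a) (hb : 0 < b) (hx : 0 ≤ x) (hy : 0 ≤ y) :
    Jp p (a - b) * (x ^ p * a ^ (-β) - y ^ p * b ^ (-β)) ≤
      p * (p / β) ^ (p - 1) * |x - y| ^ p *
        ((if 0 < x then a ^ (p - 1 - β) else 0) + (if 0 < y then b ^ (p - 1 - β) else 0)) := by
  have hJ : ∀ t : ℝ, 0 < t → Jp p t = t ^ (p - 1) := fun t ht => by
    rw [Jp, abs_of_pos ht]
    nth_rewrite 2 [← rpow_one t]
    rw [← rpow_add ht]
    ring_nf
  have hJneg : ∀ t : ℝ, Jp p (-t) = -Jp p t := fun t => by simp [Jp]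
  have h1 : 0 ≤ if 0 < x then a ^ (p - 1 - β) else 0 := by split_ifs <;> positivity
  have h2 : 0 ≤ if 0 < y then b ^ (p - 1 - β) else 0 := by split_ifs <;> positivity
  have hC : 0 ≤ p * (p / β) ^ (p - 1) * |x - y| ^ p := by positivity
  rcases lt_trichotomy b a with h | h | h
  · have := rpow_sub_mul_le_of_lt hp hβ hβp hb h hx hy
    rw [hJ _ (by linarith)]
    nlinarith
  · subst h
    simp only [sub_self, Jp, mul_zero, zero_mul]
    positivity
  · have := rpow_sub_mul_le_of_lt hp hβ hβp ha h hy hx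
    rw [← neg_sub b a, hJneg, hJ _ (by linarith)]
    rw [abs_sub_comm] at this
    nlinarith

/-- The measure of the unit sphere, as the constant in polar coordinates. -/
def sphereConst (n : ℕ) : ℝ := n * (volume : Measure (En n)).real (ball 0 1)

lemma sphereConst_nonneg (n : ℕ) : 0 ≤ sphereConst n := by
  unfold sphereConst; positivity

lemma lintegral_radial {n : ℕ} (hn : 0 < n) {f : ℝ → ℝ} (hf0 : ∀ t, 0 ≤ f t)
    (hf : IntegrableOn (fun y : ℝ => y ^ (n - 1) * f y) (Ioi 0)) :
    ∫⁻ x : En n, ENNReal.ofReal (f ‖x‖) =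
      ENNReal.ofReal (sphereConst n * ∫ y in Ioi 0, y ^ (n - 1) * f y) := by
  have : NeZero n := ⟨hn.ne'⟩
  have hd : Module.finrank ℝ (En n) = n := by simp
  have h1 : Integrable (fun x : En n => f ‖x‖) := by
    rw [integrable_fun_norm_addHaar volume (f := f), hd]
    exact hf
  rw [← ofReal_integral_eq_lintegral_ofReal h1 (ae_of_all _ fun x => hf0 _),
    integral_fun_norm_addHaar volume f, hd]
  simp [sphereConst, mul_assoc]

lemma lintegral_compl_ball_rpow {n : ℕ} (hn : 0 < n) {α r : ℝ} (hα : 0 < α) (hr : 0 < r)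
    (x₀ : En n) :
    ∫⁻ y in (ball x₀ r)ᶜ, ENNReal.ofReal (‖y - x₀‖ ^ (-((n : ℝ) + α))) =
      ENNReal.ofReal (sphereConst n / α * r ^ (-α)) := by
  set f : ℝ → ℝ := (Ici r).indicator fun t => t ^ (-((n : ℝ) + α)) with hf
  have hf0 : ∀ t, 0 ≤ f t := fun t => by
    refine indicator_nonneg (fun t ht => ?_) t
    exact rpow_nonneg (hr.le.trans ht) _
  have hn1 : ((n - 1 : ℕ) : ℝ) = n - 1 := by rw [Nat.cast_sub hn]; simp
  have hfe : (fun y : ℝ => y ^ (n - 1) * f y) = (Ici r).indicator fun t => t ^ (-1 - α) := by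
    ext t
    by_cases ht : t ∈ Ici r
    · rw [hf, indicator_of_mem ht, indicator_of_mem ht]
      have : 0 < t := hr.trans_le ht
      rw [← rpow_natCast, ← rpow_add this, hn1]
      ring_nf
    · rw [hf, indicator_of_notMem ht, indicator_of_notMem ht, mul_zero]
  have hint : IntegrableOn (fun t : ℝ => t ^ (-1 - α)) (Ici r) :=
    (integrableOn_Ici_iff_integrableOn_Ioi).2 (integrableOn_Ioi_rpow_of_lt (by linarith) hr)
  have key := lintegral_radial hn hf0 (by
    rw [hfe]
    exact ((integrable_indicator_iff measurableSet_Ici).2 hint).integrableOn)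
  have hval : ∫ y in Ioi 0, y ^ (n - 1) * f y = r ^ (-α) / α := by
    rw [hfe, setIntegral_indicator measurableSet_Ici,
      (inter_eq_right (s := Ioi (0 : ℝ)) (t := Ici r)).2 (fun t ht => hr.trans_le ht), integral_Ici_eq_integral_Ioi,
      integral_Ioi_rpow_of_lt (by linarith) hr]
    rw [show -1 - α + 1 = -α by ring, neg_div_neg_eq]
  rw [← lintegral_indicator measurableSet_ball.compl]
  rw [← lintegral_add_right_eq_self _ x₀]
  have : ∀ x : En n, ((ball x₀ r)ᶜ.indicator
      (fun y => ENNReal.ofReal (‖y - x₀‖ ^ (-((n : ℝ) + α)))) (x + x₀)) =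
      ENNReal.ofReal (f ‖x‖) := by
    intro x
    by_cases hx : r ≤ ‖x‖
    · rw [indicator_of_mem (by simpa using hx), hf, indicator_of_mem (mem_Ici.2 hx)]
      simp
    · rw [indicator_of_notMem (by simpa using hx), hf, indicator_of_notMem (by simpa using hx)]
      simp
  simp_rw [this]
  rw [key, hval]
  congr 1; ring

lemma lintegral_ball_rpow {n : ℕ} (hn : 0 < n) {α r : ℝ} (hα : 0 < α) (hr : 0 < r)
    (x₀ : En n) :
    ∫⁻ y in ball x₀ r, ENNReal.ofReal (‖y - x₀‖ ^ (α - n)) =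
      ENNReal.ofReal (sphereConst n / α * r ^ α) := by
  set f : ℝ → ℝ := (Ioo 0 r).indicator fun t => t ^ (α - n) with hf
  have hf0 : ∀ t, 0 ≤ f t := fun t => by
    refine indicator_nonneg (fun t ht => ?_) t
    exact rpow_nonneg ht.1.le _
  have hn1 : ((n - 1 : ℕ) : ℝ) = n - 1 := by rw [Nat.cast_sub hn]; simp
  have hfe : (fun y : ℝ => y ^ (n - 1) * f y) = (Ioo 0 r).indicator fun t => t ^ (α - 1) := by
    ext t
    by_cases ht : t ∈ Ioo 0 r
    · rw [hf, indicator_of_mem ht, indicator_of_mem ht]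
      rw [← rpow_natCast, ← rpow_add ht.1, hn1]
      ring_nf
    · rw [hf, indicator_of_notMem ht, indicator_of_notMem ht, mul_zero]
  have hint : IntegrableOn (fun t : ℝ => t ^ (α - 1)) (Ioo 0 r) :=
    (intervalIntegral.integrableOn_Ioo_rpow_iff hr).2 (by linarith)
  have key := lintegral_radial hn hf0 (by
    rw [hfe]
    exact ((integrable_indicator_iff measurableSet_Ioo).2 hint).integrableOn)
  have hval : ∫ y in Ioi 0, y ^ (n - 1) * f y = r ^ α / α := by
    rw [hfe, setIntegral_indicator measurableSet_Ioo,
      inter_eq_right.2 (fun t ht => ht.1), ← integral_Ioc_eq_integral_Ioo,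
      ← intervalIntegral.integral_of_le hr.le, integral_rpow (Or.inl (by linarith))]
    rw [sub_add_cancel, zero_rpow hα.ne', sub_zero]
  rw [← lintegral_indicator measurableSet_ball]
  rw [← lintegral_add_right_eq_self _ x₀]
  have : ∀ᵐ x : En n, ((ball x₀ r).indicator
      (fun y => ENNReal.ofReal (‖y - x₀‖ ^ (α - n))) (x + x₀)) =
      ENNReal.ofReal (f ‖x‖) := by
    have : NeZero n := ⟨hn.ne'⟩
    have h0 : ∀ᵐ x : En n, x ≠ 0 := by
      simp [ae_iff]
    filter_upwards [h0] with x hx0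
    by_cases hx : ‖x‖ < r
    · rw [indicator_of_mem (by simpa using hx), hf, indicator_of_mem (mem_Ioo.2 ⟨norm_pos_iff.2 hx0, hx⟩)]
      simp
    · rw [indicator_of_notMem (by simpa using hx), hf, indicator_of_notMem (fun h => hx h.2)]
      simp
  rw [lintegral_congr_ae this, key, hval]
  congr 1; ring

/-- Integral of the truncated kernel: a Lipschitz bounded function has finite fractional energy. -/
lemma lintegral_min_kernel_le {n : ℕ} (hn : 0 < n) {p s L : ℝ} (hp : 0 < p) (hs0 : 0 < s)
    (hs1 : s < 1) (hL : 0 < L) (x : En n) :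
    ∫⁻ y, ENNReal.ofReal (min ((L * ‖x - y‖) ^ p) 1 * ‖x - y‖ ^ (-((n : ℝ) + p * s))) ≤
      ENNReal.ofReal ((sphereConst n / (p * (1 - s)) + sphereConst n / (p * s)) * L ^ (p * s)) := by
  have h1s : 0 < p * (1 - s) := mul_pos hp (by linarith)
  have hps : 0 < p * s := mul_pos hp hs0
  have hc := sphereConst_nonneg n
  rw [← lintegral_add_compl _ (measurableSet_ball : MeasurableSet (ball x L⁻¹)), add_mul,
    ENNReal.ofReal_add (by positivity) (by positivity)]
  refine add_le_add ?_ ?_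
  · calc ∫⁻ y in ball x L⁻¹,
          ENNReal.ofReal (min ((L * ‖x - y‖) ^ p) 1 * ‖x - y‖ ^ (-((n : ℝ) + p * s)))
        ≤ ∫⁻ y in ball x L⁻¹,
          ENNReal.ofReal (L ^ p) * ENNReal.ofReal (‖y - x‖ ^ (p * (1 - s) - n)) := by
          refine lintegral_mono fun y => ?_
          rw [← ENNReal.ofReal_mul (by positivity)]
          refine ENNReal.ofReal_le_ofReal ?_
          rw [norm_sub_rev]
          rcases (norm_nonneg (y - x)).eq_or_lt with h | h
          · rw [← h, mul_zero, zero_rpow hp.ne', min_eq_left zero_le_one, zero_mul]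
            positivity
          calc min ((L * ‖y - x‖) ^ p) 1 * ‖y - x‖ ^ (-((n : ℝ) + p * s))
              ≤ (L * ‖y - x‖) ^ p * ‖y - x‖ ^ (-((n : ℝ) + p * s)) := by
                gcongr
                exact min_le_left _ _
            _ = L ^ p * ‖y - x‖ ^ (p * (1 - s) - n) := by
                rw [mul_rpow hL.le h.le, mul_assoc, ← rpow_add h]
                ring_nf
      _ = ENNReal.ofReal (sphereConst n / (p * (1 - s)) * L ^ (p * s)) := by
          rw [lintegral_const_mul' _ _ ENNReal.ofReal_ne_top,
            lintegral_ball_rpow hn h1s (by positivity), ← ENNReal.ofReal_mul (by positivity)]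
          congr 1
          rw [inv_rpow hL.le, ← rpow_neg hL.le, mul_left_comm, ← rpow_add hL]
          ring_nf
      _ ≤ _ := le_rfl
  · calc ∫⁻ y in (ball x L⁻¹)ᶜ,
          ENNReal.ofReal (min ((L * ‖x - y‖) ^ p) 1 * ‖x - y‖ ^ (-((n : ℝ) + p * s)))
        ≤ ∫⁻ y in (ball x L⁻¹)ᶜ, ENNReal.ofReal (‖y - x‖ ^ (-((n : ℝ) + p * s))) := by
          refine lintegral_mono fun y => ENNReal.ofReal_le_ofReal ?_
          rw [norm_sub_rev]
          exact mul_le_of_le_one_left (by positivity) (min_le_right _ _)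
      _ = ENNReal.ofReal (sphereConst n / (p * s) * L ^ (p * s)) := by
          rw [lintegral_compl_ball_rpow hn hps (by positivity), inv_rpow hL.le, rpow_neg hL.le,
            inv_inv]
      _ ≤ _ := le_rfl

section
open Filter

/-- Dominated convergence with a dominating function that is fixed up to an error vanishing in
mean. -/
lemma tendsto_lintegral_zero_of_le_add {α : Type*} [MeasurableSpace α] {μ : Measure α}
    {Y E : ℕ → α → ℝ≥0∞} {D : α → ℝ≥0∞} (hY : ∀ k, AEMeasurable (Y k) μ)
    (hE : ∀ k, AEMeasurable (E k) μ) (hD : AEMeasurable D μ)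
    (hle : ∀ k, ∀ᵐ a ∂μ, Y k a ≤ D a + E k a) (hDfin : ∫⁻ a, D a ∂μ ≠ ⊤)
    (hElim : Tendsto (fun k => ∫⁻ a, E k a ∂μ) atTop (𝓝 0))
    (hYlim : ∀ᵐ a ∂μ, Tendsto (fun k => Y k a) atTop (𝓝 0)) :
    Tendsto (fun k => ∫⁻ a, Y k a ∂μ) atTop (𝓝 0) := by
  have h1 : Tendsto (fun k => ∫⁻ a, min (Y k a) (D a) ∂μ) atTop (𝓝 (∫⁻ _, 0 ∂μ)) := by
    refine tendsto_lintegral_of_dominated_convergence' D (fun k => (hY k).min hD)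
      (fun k => ae_of_all _ fun a => min_le_right _ _) hDfin ?_
    filter_upwards [hYlim] with a ha
    exact tendsto_of_tendsto_of_tendsto_of_le_of_le tendsto_const_nhds ha (fun _ => zero_le)
      (fun _ => min_le_left _ _)
  rw [lintegral_zero] at h1
  have h2 := h1.add hElim
  rw [add_zero] at h2
  refine tendsto_of_tendsto_of_tendsto_of_le_of_le tendsto_const_nhds h2 (fun _ => zero_le)
    (fun k => ?_)
  calc ∫⁻ a, Y k a ∂μ ≤ ∫⁻ a, (min (Y k a) (D a) + E k a) ∂μ := by
        refine lintegral_mono_ae ?_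
        filter_upwards [hle k] with a ha
        rcases le_total (Y k a) (D a) with h | h
        · rw [min_eq_left h]; exact le_self_add
        · rwa [min_eq_right h]
    _ = _ := lintegral_add_right' _ (hE k)

lemma tendsto_lintegral_mul_zero {α : Type*} [MeasurableSpace α] {μ : Measure α} {p : ℝ}
    (hp : 1 < p) {H : α → ℝ≥0∞} {W : ℕ → α → ℝ≥0∞} (hH : AEMeasurable H μ)
    (hW : ∀ k, AEMeasurable (W k) μ) (hHfin : ∫⁻ a, H a ^ p ∂μ ≠ ⊤)
    (hWlim : Tendsto (fun k => ∫⁻ a, W k a ^ p ∂μ) atTop (𝓝 0)) :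
    Tendsto (fun k => ∫⁻ a, H a ^ (p - 1) * W k a ∂μ) atTop (𝓝 0) := by
  have hp0 : 0 < p := by linarith
  have hpq : (p / (p - 1)).HolderConjugate p := (Real.HolderConjugate.conjExponent hp).symm
  have h1 : Tendsto (fun k => (∫⁻ a, H a ^ p ∂μ) ^ (1 / (p / (p - 1))) *
      (∫⁻ a, W k a ^ p ∂μ) ^ (1 / p)) atTop (𝓝 0) := by
    have := (ENNReal.continuous_rpow_const (y := 1 / p)).tendsto 0 |>.comp hWlim
    have h0 : (0 : ℝ≥0∞) ^ (1 / p) = 0 := ENNReal.zero_rpow_of_pos (by positivity)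
    rw [h0] at this
    have h2 := ENNReal.Tendsto.const_mul (a := (∫⁻ a, H a ^ p ∂μ) ^ (1 / (p / (p - 1)))) this
      (Or.inr (ENNReal.rpow_ne_top_of_nonneg (by
        have : 0 < p - 1 := by linarith
        positivity) hHfin))
    simpa using h2
  refine tendsto_of_tendsto_of_tendsto_of_le_of_le tendsto_const_nhds h1 (fun _ => zero_le)
    (fun k => ?_)
  have := ENNReal.lintegral_mul_le_Lp_mul_Lq μ hpq (hH.pow_const (p - 1)) (hW k)
  refine this.trans (le_of_eq ?_)
  congr 3
  ext a
  rw [← ENNReal.rpow_mul]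
  congr 1
  have : p - 1 ≠ 0 := by linarith
  field_simp

lemma lintegral_rpow_add_le {α : Type*} [MeasurableSpace α] {μ : Measure α} {p : ℝ}
    (hp : 1 ≤ p) {f g : α → ℝ≥0∞} (hf : AEMeasurable f μ) :
    ∫⁻ a, (f a + g a) ^ p ∂μ ≤
      2 ^ (p - 1) * (∫⁻ a, f a ^ p ∂μ + ∫⁻ a, g a ^ p ∂μ) := by
  rw [← lintegral_add_left' (hf.pow_const p), ← lintegral_const_mul' _ _ (by
    exact ENNReal.rpow_ne_top_of_nonneg (by linarith) (by simp))]
  exact lintegral_mono fun a => ENNReal.rpow_add_le_mul_rpow_add_rpow _ _ hp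

/-- Three-exponent Hölder inequality used for the right-hand side. -/
lemma lintegral_mul_rpow_le {α : Type*} [MeasurableSpace α] {μ : Measure α}
    {f h : α → ℝ≥0∞} (hf : AEMeasurable f μ) (hh : AEMeasurable h μ)
    {m τ κ : ℝ} (hm : 0 < m) (hκ : 0 < κ) (hτ0 : 0 ≤ τ) (hτ1 : τ ≤ 1)
    (hsum : 1 / m + τ / κ + (1 - τ) = 1) :
    ∫⁻ a, f a * h a ∂μ ≤ (∫⁻ a, f a ^ m ∂μ) ^ (1 / m) *
      (((∫⁻ a, h a ^ κ ∂μ) ^ (1 / κ)) ^ τ * (∫⁻ a, h a ∂μ) ^ (1 - τ)) := by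
  have := ENNReal.lintegral_prod_norm_pow_le (μ := μ) (Finset.univ : Finset (Fin 3))
    (f := ![fun a => f a ^ m, fun a => h a ^ κ, h])
    (p := ![1 / m, τ / κ, 1 - τ])
    (by
      intro i _
      fin_cases i
      · exact hf.pow_const m
      · exact hh.pow_const κ
      · exact hh)
    (by simpa [Fin.sum_univ_three] using hsum)
    (by
      intro i _
      fin_cases i
      · simp; positivity
      · simp; positivity
      · simp; linarith)
  simp only [Fin.prod_univ_three, Matrix.cons_val_zero, Matrix.cons_val_one,
    Matrix.cons_val] at this
  refine le_trans (le_of_eq ?_) (this.trans (le_of_eq ?_))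
  · refine lintegral_congr fun a => ?_
    rw [← ENNReal.rpow_mul, ← ENNReal.rpow_mul, mul_one_div_cancel hm.ne', ENNReal.rpow_one,
      mul_assoc, ← ENNReal.rpow_add_of_nonneg _ _ (by positivity) (by linarith)]
    rw [show κ * (τ / κ) + (1 - τ) = 1 by field_simp; ring, ENNReal.rpow_one]
  · rw [mul_assoc, ← ENNReal.rpow_mul, one_div_mul_eq_div]

end

/-- A sequence of bump functions concentrating at the origin. -/
def mollBump (n k : ℕ) : ContDiffBump (0 : En n) where
  rIn := 1 / (2 * ((k : ℝ) + 1))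
  rOut := 1 / ((k : ℝ) + 1)
  rIn_pos := by positivity
  rIn_lt_rOut := by
    apply one_div_lt_one_div_of_lt <;> nlinarith [(Nat.cast_nonneg k : (0 : ℝ) ≤ k)]

/-- The mollifying kernels. -/
def mollKer (n k : ℕ) : En n → ℝ := (mollBump n k).normed volume

/-- Mollification. -/
def moll {n : ℕ} {E : Type*} [NormedAddCommGroup E] [NormedSpace ℝ E] (k : ℕ) (g : En n → E)
    (x : En n) : E := ∫ t, mollKer n k t • g (x - t)

section
open Filter

lemma mollKer_nonneg {n k : ℕ} (t : En n) : 0 ≤ mollKer n k t := (mollBump n k).nonneg_normed t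

lemma mollKer_contDiff {n k : ℕ} : ContDiff ℝ (⊤ : ℕ∞) (mollKer n k) :=
  (mollBump n k).contDiff_normed

lemma mollKer_eq_zero {n k : ℕ} {t : En n} (h : 1 / ((k : ℝ) + 1) ≤ ‖t‖) : mollKer n k t = 0 := by
  by_contra hne
  have : t ∈ Function.support (mollKer n k) := hne
  rw [mollKer, (mollBump n k).support_normed_eq] at this
  simp [mollBump] at this
  simp at h
  linarith

lemma mollKer_hasCompactSupport {n k : ℕ} : HasCompactSupport (mollKer n k) :=
  (mollBump n k).hasCompactSupport_normed

lemma mollKer_tsupport {n k : ℕ} : tsupport (mollKer n k) = closedBall 0 (1 / ((k : ℝ) + 1)) :=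
  (mollBump n k).tsupport_normed_eq

lemma integrable_mollKer {n k : ℕ} : Integrable (mollKer n k) := (mollBump n k).integrable_normed

lemma integral_mollKer {n k : ℕ} : ∫ t, mollKer n k t = 1 := (mollBump n k).integral_normed

lemma lintegral_mollKer {n k : ℕ} : ∫⁻ t, ENNReal.ofReal (mollKer n k t) = 1 := by
  rw [← ofReal_integral_eq_lintegral_ofReal integrable_mollKer (ae_of_all _ mollKer_nonneg),
    integral_mollKer, ENNReal.ofReal_one]

lemma integrable_moll {n k : ℕ} {E : Type*} [NormedAddCommGroup E] [NormedSpace ℝ E]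
    {g : En n → E} (hg : LocallyIntegrable g) (x : En n) :
    Integrable fun t => mollKer n k t • g (x - t) :=
  (mollKer_hasCompactSupport.convolutionExists_left (ContinuousLinearMap.lsmul ℝ ℝ)
    mollKer_contDiff.continuous hg x).integrable

lemma moll_eq_convolution {n k : ℕ} {E : Type*} [NormedAddCommGroup E] [NormedSpace ℝ E]
    (g : En n → E) : moll k g = convolution (mollKer n k) g (ContinuousLinearMap.lsmul ℝ ℝ) volume :=
  rfl

lemma enorm_moll_sub_rpow_le {n k : ℕ} {E : Type*} [NormedAddCommGroup E] [NormedSpace ℝ E]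
    [CompleteSpace E] {p : ℝ} (hp : 1 ≤ p) {g : En n → E} (hg : LocallyIntegrable g) (x : En n) :
    ‖moll k g x - g x‖ₑ ^ p ≤
      ∫⁻ t, ENNReal.ofReal (mollKer n k t) * ‖g (x - t) - g x‖ₑ ^ p := by
  have hp0 : 0 < p := by linarith
  have h1 : moll k g x - g x = ∫ t, mollKer n k t • (g (x - t) - g x) := by
    simp_rw [smul_sub]
    rw [integral_sub (integrable_moll hg x) (integrable_mollKer.smul_const _),
      integral_smul_const, integral_mollKer, one_smul, moll]
  have hm : AEMeasurable (fun t => ‖g (x - t) - g x‖ₑ) := by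
    have := (hg.aestronglyMeasurable.comp_quasiMeasurePreserving
      (quasiMeasurePreserving_sub_left volume x)).sub (aestronglyMeasurable_const (b := g x))
    exact this.enorm
  have hk : Measurable (fun t => ENNReal.ofReal (mollKer n k t)) :=
    (mollKer_contDiff.continuous.measurable).ennreal_ofReal
  have h2 : ‖moll k g x - g x‖ₑ ≤
      ∫⁻ t, ENNReal.ofReal (mollKer n k t) * ‖g (x - t) - g x‖ₑ := by
    rw [h1]
    refine (enorm_integral_le_lintegral_enorm _).trans (le_of_eq ?_)
    refine lintegral_congr fun t => ?_
    rw [enorm_smul, Real.enorm_eq_ofReal (mollKer_nonneg t)]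
  have h3 := ENNReal.lintegral_mul_norm_pow_le (μ := (volume : Measure (En n)))
    (f := fun t => ENNReal.ofReal (mollKer n k t) * ‖g (x - t) - g x‖ₑ ^ p)
    (g := fun t => ENNReal.ofReal (mollKer n k t)) (p := 1 / p) (q := 1 - 1 / p)
    (hk.aemeasurable.mul (hm.pow_const p)) hk.aemeasurable (by positivity)
    (by rw [sub_nonneg, div_le_one hp0]; exact hp) (by ring)
  rw [lintegral_mollKer, ENNReal.one_rpow, mul_one] at h3
  have h4 : ∫⁻ t, ENNReal.ofReal (mollKer n k t) * ‖g (x - t) - g x‖ₑ ≤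
      (∫⁻ t, ENNReal.ofReal (mollKer n k t) * ‖g (x - t) - g x‖ₑ ^ p) ^ (1 / p) := by
    refine le_trans (le_of_eq ?_) h3
    refine lintegral_congr fun t => ?_
    rw [ENNReal.mul_rpow_of_nonneg _ _ (by positivity), ← ENNReal.rpow_mul,
      mul_one_div_cancel hp0.ne', ENNReal.rpow_one, mul_right_comm,
      ← ENNReal.rpow_add_of_nonneg _ _ (by positivity) (by
        rw [sub_nonneg, div_le_one hp0]; exact hp)]
    simp
  calc ‖moll k g x - g x‖ₑ ^ p ≤ ((∫⁻ t, ENNReal.ofReal (mollKer n k t) *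
      ‖g (x - t) - g x‖ₑ ^ p) ^ (1 / p)) ^ p := by
        gcongr; exact h2.trans h4
    _ = _ := by rw [← ENNReal.rpow_mul, one_div_mul_cancel hp0.ne', ENNReal.rpow_one]

lemma tendsto_lintegral_translate {n : ℕ} {E : Type*} [NormedAddCommGroup E] {p : ℝ}
    (hp : 1 ≤ p) {g : En n → E} (hg : MemLp g (ENNReal.ofReal p)) :
    Tendsto (fun t : En n => ∫⁻ x, ‖g (x - t) - g x‖ₑ ^ p) (𝓝 0) (𝓝 0) := by
  have hp0 : 0 < p := by linarith
  have : Fact (1 ≤ ENNReal.ofReal p) := ⟨by simpa using hp⟩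
  let F : En n → C(En n, En n) := fun t => ⟨fun x => x - t, by fun_prop⟩
  have hF : Continuous F := by
    refine ContinuousMap.continuous_of_continuous_uncurry _ ?_
    simp only [F, Function.uncurry_def, ContinuousMap.coe_mk]
    fun_prop
  have hFm : ∀ t, MeasurePreserving (F t) volume volume := fun t => measurePreserving_sub_right _ t
  have hc := (Continuous.compMeasurePreservingLp (f := fun _ : En n => hg.toLp g) continuous_const
    hF hFm ENNReal.ofReal_ne_top).tendsto 0
  rw [tendsto_iff_edist_tendsto_0] at hc
  have h2 : Tendsto (fun t : En n => eLpNorm (fun x => g (x - t) - g x) (ENNReal.ofReal p) volume)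
      (𝓝 0) (𝓝 0) := by
    refine hc.congr fun t => ?_
    rw [Lp.toLp_compMeasurePreserving, Lp.toLp_compMeasurePreserving, Lp.edist_toLp_toLp]
    refine congrArg (fun h => eLpNorm h _ _) ?_
    ext x
    simp [F]
  have h3 := ((ENNReal.continuous_rpow_const (y := p)).tendsto 0).comp h2
  rw [ENNReal.zero_rpow_of_pos hp0] at h3
  refine h3.congr fun t => ?_
  simp only [Function.comp]
  rw [eLpNorm_eq_lintegral_rpow_enorm_toReal (by simpa using hp0) ENNReal.ofReal_ne_top,
    ENNReal.toReal_ofReal hp0.le, ← ENNReal.rpow_mul, one_div_mul_cancel hp0.ne', ENNReal.rpow_one]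

lemma tendsto_moll {n : ℕ} {E : Type*} [NormedAddCommGroup E] [NormedSpace ℝ E]
    [CompleteSpace E] {p : ℝ} (hp : 1 ≤ p) {g : En n → E} (hg : MemLp g (ENNReal.ofReal p)) :
    Tendsto (fun k => ∫⁻ x, ‖moll k g x - g x‖ₑ ^ p) atTop (𝓝 0) := by
  have hloc : LocallyIntegrable g := hg.locallyIntegrable (by simpa using hp)
  have hle : ∀ k, ∫⁻ x, ‖moll k g x - g x‖ₑ ^ p ≤
      ∫⁻ t, ENNReal.ofReal (mollKer n k t) * ∫⁻ x, ‖g (x - t) - g x‖ₑ ^ p := by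
    intro k
    have hk : Measurable (fun t => ENNReal.ofReal (mollKer n k t)) :=
      (mollKer_contDiff.continuous.measurable).ennreal_ofReal
    have hm : AEMeasurable (fun z : En n × En n => ‖g (z.1 - z.2) - g z.1‖ₑ ^ p)
        (volume.prod volume) := by
      have h1 := hg.1.comp_quasiMeasurePreserving
        (quasiMeasurePreserving_sub_of_right_invariant (volume : Measure (En n)) volume)
      have h2 := hg.1.comp_quasiMeasurePreserving
        (Measure.quasiMeasurePreserving_fst (μ := (volume : Measure (En n)))
          (ν := (volume : Measure (En n))))
      exact (h1.sub h2).enorm.pow_const p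
    calc _ ≤ ∫⁻ x, ∫⁻ t, ENNReal.ofReal (mollKer n k t) * ‖g (x - t) - g x‖ₑ ^ p :=
          lintegral_mono fun x => enorm_moll_sub_rpow_le hp hloc x
      _ = ∫⁻ t, ∫⁻ x, ENNReal.ofReal (mollKer n k t) * ‖g (x - t) - g x‖ₑ ^ p := by
          refine lintegral_lintegral_swap ?_
          exact (hk.comp measurable_snd).aemeasurable.mul hm
      _ = _ := by
          refine lintegral_congr fun t => ?_
          exact lintegral_const_mul' _ _ ENNReal.ofReal_ne_top
  rw [ENNReal.tendsto_nhds_zero]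
  intro ε hε
  have h := tendsto_lintegral_translate hp hg
  rw [ENNReal.tendsto_nhds_zero] at h
  obtain ⟨δ, hδ, hb⟩ := Metric.eventually_nhds_iff_ball.1 (h ε hε)
  have hk := tendsto_one_div_add_atTop_nhds_zero_nat (𝕜 := ℝ)
  filter_upwards [hk.eventually (gt_mem_nhds hδ)] with k hkδ
  refine (hle k).trans ?_
  calc _ ≤ ∫⁻ t, ENNReal.ofReal (mollKer n k t) * ε := by
        refine lintegral_mono fun t => ?_
        rcases lt_or_ge ‖t‖ δ with h1 | h1
        · exact mul_le_mul_right (hb t (by simpa using h1)) _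
        · rw [mollKer_eq_zero (hkδ.le.trans h1)]; simp
    _ = ε := by
        rw [lintegral_mul_const _ (mollKer_contDiff.continuous.measurable).ennreal_ofReal,
          lintegral_mollKer, one_mul]
end

section
open Filter

lemma inner_gradient_eq_fderiv {n : ℕ} {f : En n → ℝ} (x v : En n) :
    ⟪v, gradient f x⟫ = fderiv ℝ f x v := by
  rw [real_inner_comm, gradient, InnerProductSpace.toDual_symm_apply]

lemma norm_gradient_eq {n : ℕ} {f : En n → ℝ} (x : En n) : ‖gradient f x‖ = ‖fderiv ℝ f x‖ := by
  rw [gradient, LinearIsometryEquiv.norm_map]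

lemma continuous_gradient {n : ℕ} {f : En n → ℝ} (hf : ContDiff ℝ 1 f) :
    Continuous (gradient f) :=
  (LinearIsometryEquiv.continuous _).comp (hf.continuous_fderiv one_ne_zero)

lemma gradient_eq_zero_of_notMem_tsupport {n : ℕ} {f : En n → ℝ} {x : En n}
    (hx : x ∉ tsupport f) : gradient f x = 0 := by
  rw [gradient, fderiv_of_notMem_tsupport (𝕜 := ℝ) hx, map_zero]

lemma moll_contDiff {n k : ℕ} {u : En n → ℝ} (hu : LocallyIntegrable u) :
    ContDiff ℝ (⊤ : ℕ∞) (moll k u) :=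
  mollKer_hasCompactSupport.contDiff_convolution_left (ContinuousLinearMap.lsmul ℝ ℝ)
    mollKer_contDiff hu

lemma moll_nonneg {n k : ℕ} {u : En n → ℝ} (hu : ∀ x, 0 ≤ u x) (x : En n) : 0 ≤ moll k u x :=
  integral_nonneg fun t => mul_nonneg (mollKer_nonneg t) (hu _)

lemma inner_gradient_moll {n k : ℕ} {u : En n → ℝ} (hu : LocallyIntegrable u) (x v : En n) :
    ⟪v, gradient (moll k u) x⟫ = ⟪v, ∫ y, u y • gradient (mollKer n k) (x - y)⟫ := by
  have hc1 : ContDiff ℝ 1 (mollKer n k) := mollKer_contDiff.of_le (by exact_mod_cast le_top)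
  have hcs := mollKer_hasCompactSupport (n := n) (k := k)
  have h := hcs.hasFDerivAt_convolution_left (ContinuousLinearMap.lsmul ℝ ℝ) hc1 hu x
  rw [inner_gradient_eq_fderiv, moll_eq_convolution, h.fderiv, convolution_eq_swap]
  have hi : Integrable (fun t => ((ContinuousLinearMap.lsmul ℝ ℝ).precompL (En n))
      (fderiv ℝ (mollKer n k) (x - t)) (u t)) := by
    have := (HasCompactSupport.convolutionExists_left
      ((ContinuousLinearMap.lsmul ℝ ℝ).precompL (En n) :
        (En n →L[ℝ] ℝ) →L[ℝ] ℝ →L[ℝ] (En n →L[ℝ] ℝ)) (hcs.fderiv ℝ)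
      (hc1.continuous_fderiv one_ne_zero) hu x).integrable_swap
    exact this
  have hi2 : Integrable (fun y => u y • gradient (mollKer n k) (x - y)) := by
    refine hi.congr' ?_ (ae_of_all _ fun t => ?_)
    · refine hu.aestronglyMeasurable.smul ?_
      exact ((continuous_gradient hc1).comp (continuous_const.sub continuous_id)).aestronglyMeasurable
    · have : ((ContinuousLinearMap.lsmul ℝ ℝ).precompL (En n))
          (fderiv ℝ (mollKer n k) (x - t)) (u t) = u t • fderiv ℝ (mollKer n k) (x - t) := by
        ext w; simp [mul_comm]
      rw [this, norm_smul, norm_smul, norm_gradient_eq]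
  rw [ContinuousLinearMap.integral_apply hi, ← integral_inner hi2]
  refine integral_congr_ae (ae_of_all _ fun t => ?_)
  simp [inner_smul_right, mul_comm]

lemma gradient_moll {n k : ℕ} {u : En n → ℝ} {G : En n → En n} {U : Set (En n)}
    (hu : LocallyIntegrable (U.indicator u)) (hG : HasWeakGradOn u G U) {x : En n}
    (hx : closedBall x (1 / ((k : ℝ) + 1)) ⊆ U) :
    gradient (moll k (U.indicator u)) x = moll k (U.indicator G) x := by
  have hmem : ∀ y, x - y ∈ tsupport (mollKer n k) → y ∈ U := by
    intro y hy
    rw [mollKer_tsupport, mem_closedBall_zero_iff] at hy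
    exact hx (by rw [mem_closedBall, dist_comm, dist_eq_norm]; exact hy)
  have hc : ContDiff ℝ (⊤ : ℕ∞) (fun y => mollKer n k (x - y)) :=
    mollKer_contDiff.comp (contDiff_const.sub contDiff_id)
  have hts : tsupport (fun y => mollKer n k (x - y)) ⊆ {y | x - y ∈ tsupport (mollKer n k)} := by
    refine closure_minimal ?_ ((isClosed_tsupport _).preimage (continuous_const.sub continuous_id))
    intro y hy
    exact subset_tsupport _ hy
  have htest : TestFun U (fun y => mollKer n k (x - y)) := by
    refine ⟨hc, ?_, fun y hy => hmem y (hts hy)⟩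
    refine HasCompactSupport.of_support_subset_isCompact (isCompact_closedBall x (1 / ((k : ℝ) + 1))) ?_
    intro y hy
    have := subset_tsupport _ (show x - y ∈ Function.support (mollKer n k) from hy)
    rw [mollKer_tsupport, mem_closedBall_zero_iff] at this
    rw [mem_closedBall, dist_comm, dist_eq_norm]; exact this
  have h := hG _ htest
  have hgrad : ∀ y, gradient (fun y => mollKer n k (x - y)) y = - gradient (mollKer n k) (x - y) := by
    intro y
    have hd : HasFDerivAt (fun y => mollKer n k (x - y))
        ((fderiv ℝ (mollKer n k) (x - y)).comp (-(ContinuousLinearMap.id ℝ (En n)))) y := by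
      have h1 : HasFDerivAt (mollKer n k) (fderiv ℝ (mollKer n k) (x - y)) (x - y) :=
        (mollKer_contDiff.differentiable (by simp) _).hasFDerivAt
      have h2 : HasFDerivAt (fun y : En n => x - y) (-(ContinuousLinearMap.id ℝ (En n))) y :=
        (hasFDerivAt_id y).const_sub x
      exact h1.comp y h2
    refine ext_inner_left ℝ fun v => ?_
    rw [inner_gradient_eq_fderiv, hd.fderiv, inner_neg_right, inner_gradient_eq_fderiv]
    simp
  simp_rw [hgrad, smul_neg] at h
  rw [integral_neg, neg_inj] at h
  refine ext_inner_left ℝ fun v => ?_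
  rw [inner_gradient_moll hu]
  congr 1
  have e1 : ∫ y, U.indicator u y • gradient (mollKer n k) (x - y) =
      ∫ y, u y • gradient (mollKer n k) (x - y) := by
    refine integral_congr_ae (ae_of_all _ fun y => ?_)
    by_cases hy : y ∈ U
    · simp [hy]
    · have : x - y ∉ tsupport (mollKer n k) := fun h => hy (hmem y h)
      simp [gradient_eq_zero_of_notMem_tsupport this]
  rw [e1, h, moll_eq_convolution, convolution_eq_swap]
  refine integral_congr_ae (ae_of_all _ fun y => ?_)
  by_cases hy : y ∈ U
  · simp [hy]
  · have : x - y ∉ tsupport (mollKer n k) := fun h => hy (hmem y h)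
    simp [image_eq_zero_of_notMem_tsupport this]

lemma exists_smooth_approx {n : ℕ} {p : ℝ} (hp : 1 ≤ p) {u : En n → ℝ} {G : En n → En n}
    {x₀ : En n} {r ρ : ℝ} (hrρ : r < ρ)
    (hu : MemLp u (ENNReal.ofReal p) (volume.restrict (ball x₀ ρ)))
    (hGp : MemLp G (ENNReal.ofReal p) (volume.restrict (ball x₀ ρ)))
    (hG : HasWeakGradOn u G (ball x₀ ρ)) (hu0 : ∀ x ∈ ball x₀ ρ, 0 ≤ u x) :
    ∃ w : ℕ → En n → ℝ, (∀ k, ContDiff ℝ (⊤ : ℕ∞) (w k)) ∧ (∀ k x, 0 ≤ w k x) ∧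
      Tendsto (fun k => ∫⁻ x in ball x₀ r, ‖w k x - u x‖ₑ ^ p) atTop (𝓝 0) ∧
      Tendsto (fun k => ∫⁻ x in ball x₀ r, ‖gradient (w k) x - G x‖ₑ ^ p) atTop (𝓝 0) ∧
      ∀ᵐ x ∂(volume.restrict (ball x₀ r)), Tendsto (fun k => w k x) atTop (𝓝 (u x)) := by
  have hp0 : 0 < p := by linarith
  set U := ball x₀ ρ with hU
  have hUm : MeasurableSet U := measurableSet_ball
  have hu' : MemLp (U.indicator u) (ENNReal.ofReal p) := (memLp_indicator_iff_restrict hUm).2 hu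
  have hG' : MemLp (U.indicator G) (ENNReal.ofReal p) := (memLp_indicator_iff_restrict hUm).2 hGp
  have hloc : LocallyIntegrable (U.indicator u) := hu'.locallyIntegrable (by simpa using hp)
  have hsub : ball x₀ r ⊆ U := ball_subset_ball hrρ.le
  have hbm : MeasurableSet (ball x₀ r) := measurableSet_ball
  obtain ⟨k₀, hk₀⟩ := exists_nat_one_div_lt (sub_pos.2 hrρ)
  have hkk : ∀ k : ℕ, ∀ x ∈ ball x₀ r, closedBall x (1 / (((k + k₀ : ℕ) : ℝ) + 1)) ⊆ U := by
    intro k x hx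
    have h1 : 1 / (((k + k₀ : ℕ) : ℝ) + 1) < ρ - r := by
      refine lt_of_le_of_lt ?_ hk₀
      apply one_div_le_one_div_of_le (by positivity)
      push_cast; linarith [(Nat.cast_nonneg k : (0 : ℝ) ≤ k)]
    intro y hy
    rw [mem_closedBall] at hy
    rw [mem_ball] at hx
    rw [hU, mem_ball]
    linarith [dist_triangle y x x₀]
  have t1 : Tendsto (fun k => ∫⁻ x in ball x₀ r, ‖moll (k + k₀) (U.indicator u) x - u x‖ₑ ^ p)
      atTop (𝓝 0) := by
    refine tendsto_of_tendsto_of_tendsto_of_le_of_le tendsto_const_nhds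
      ((tendsto_moll hp hu').comp (tendsto_add_atTop_nat k₀)) (fun _ => zero_le) fun k => ?_
    refine le_trans (le_of_eq ?_) (setLIntegral_le_lintegral (ball x₀ r) _)
    exact setLIntegral_congr_fun hbm fun x hx => by simp [indicator_of_mem (hsub hx)]
  have t2 : Tendsto (fun k => ∫⁻ x in ball x₀ r,
      ‖gradient (moll (k + k₀) (U.indicator u)) x - G x‖ₑ ^ p) atTop (𝓝 0) := by
    refine tendsto_of_tendsto_of_tendsto_of_le_of_le tendsto_const_nhds
      ((tendsto_moll hp hG').comp (tendsto_add_atTop_nat k₀)) (fun _ => zero_le) fun k => ?_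
    refine le_trans (le_of_eq ?_) (setLIntegral_le_lintegral (ball x₀ r) _)
    exact setLIntegral_congr_fun hbm fun x hx => by
      rw [gradient_moll hloc hG (hkk k x hx), indicator_of_mem (hsub hx) G]
  have hmeas : TendstoInMeasure (volume.restrict (ball x₀ r))
      (fun k => moll (k + k₀) (U.indicator u)) atTop u := by
    refine tendstoInMeasure_of_tendsto_eLpNorm (p := ENNReal.ofReal p) (by simpa using hp0)
      (fun k => (moll_contDiff hloc).continuous.aestronglyMeasurable)
      (hu.1.mono_measure (Measure.restrict_mono hsub le_rfl)) ?_
    have := ((ENNReal.continuous_rpow_const (y := 1 / p)).tendsto 0).comp t1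
    rw [ENNReal.zero_rpow_of_pos (by positivity)] at this
    refine this.congr fun k => ?_
    rw [eLpNorm_eq_lintegral_rpow_enorm_toReal (by simpa using hp0) ENNReal.ofReal_ne_top,
      ENNReal.toReal_ofReal hp0.le]
    rfl
  obtain ⟨ns, hns, hae⟩ := hmeas.exists_seq_tendsto_ae
  refine ⟨fun k => moll (ns k + k₀) (U.indicator u), fun k => moll_contDiff hloc,
    fun k => moll_nonneg fun x => ?_, t1.comp hns.tendsto_atTop, t2.comp hns.tendsto_atTop, hae⟩
  exact indicator_nonneg hu0 x
end

lemma rpow_lintegral_le_of_prob {α : Type*} [MeasurableSpace α] {μ : Measure α}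
    [IsProbabilityMeasure μ] {p : ℝ} (hp : 1 ≤ p) {f : α → ℝ≥0∞} (hf : AEMeasurable f μ) :
    (∫⁻ a, f a ∂μ) ^ p ≤ ∫⁻ a, f a ^ p ∂μ := by
  have hp0 : 0 < p := by linarith
  have h := ENNReal.lintegral_mul_norm_pow_le (μ := μ) (f := fun a => f a ^ p) (g := fun _ => 1)
    (p := 1 / p) (q := 1 - 1 / p) (hf.pow_const p) aemeasurable_const (by positivity)
    (by rw [sub_nonneg, div_le_one hp0]; exact hp) (by ring)
  simp only [← ENNReal.rpow_mul, mul_one_div_cancel hp0.ne', ENNReal.rpow_one, ENNReal.one_rpow,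
    mul_one, lintegral_one, measure_univ] at h
  calc _ ≤ ((∫⁻ a, f a ^ p ∂μ) ^ (1 / p)) ^ p := by gcongr
    _ = _ := by rw [← ENNReal.rpow_mul, one_div_mul_cancel hp0.ne', ENNReal.rpow_one]

lemma enorm_sub_rpow_le_lintegral_gradient {n : ℕ} {p : ℝ} (hp : 1 ≤ p) {w : En n → ℝ}
    (hw : ContDiff ℝ 1 w) (x h : En n) :
    ‖w (x + h) - w x‖ₑ ^ p ≤
      ‖h‖ₑ ^ p * ∫⁻ t in Ioc (0 : ℝ) 1, ‖gradient w (x + t • h)‖ₑ ^ p := by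
  have hp0 : 0 < p := by linarith
  have hd : ∀ t ∈ uIcc (0 : ℝ) 1, HasDerivAt (fun t : ℝ => w (x + t • h))
      (⟪gradient w (x + t • h), h⟫) t := by
    intro t _
    have h1 : HasFDerivAt w (fderiv ℝ w (x + t • h)) (x + t • h) :=
      (hw.differentiable one_ne_zero _).hasFDerivAt
    have h2 : HasDerivAt (fun t : ℝ => x + t • h) h t := by
      simpa using ((hasDerivAt_id t).smul_const h).const_add x
    rw [inner_gradient_left]
    exact h1.comp_hasDerivAt t h2
  have hc : Continuous fun t : ℝ => gradient w (x + t • h) :=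
    (continuous_gradient hw).comp (by fun_prop)
  have hint : IntervalIntegrable (fun t : ℝ => ⟪gradient w (x + t • h), h⟫) volume 0 1 :=
    (hc.inner continuous_const).intervalIntegrable _ _
  have heq := intervalIntegral.integral_eq_sub_of_hasDerivAt hd hint
  simp only [one_smul, zero_smul, add_zero] at heq
  rw [← heq, intervalIntegral.integral_of_le zero_le_one]
  have hprob : IsProbabilityMeasure (volume.restrict (Ioc (0 : ℝ) 1)) := ⟨by simp⟩
  calc _ ≤ (∫⁻ t in Ioc (0 : ℝ) 1, ‖h‖ₑ * ‖gradient w (x + t • h)‖ₑ) ^ p := by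
        gcongr
        refine (enorm_integral_le_lintegral_enorm _).trans (lintegral_mono fun t => ?_)
        rw [mul_comm, ← ofReal_norm, ← ofReal_norm, ← ofReal_norm,
          ← ENNReal.ofReal_mul (norm_nonneg _)]
        exact ENNReal.ofReal_le_ofReal (norm_inner_le_norm _ _)
    _ = ‖h‖ₑ ^ p * (∫⁻ t in Ioc (0 : ℝ) 1, ‖gradient w (x + t • h)‖ₑ) ^ p := by
        rw [lintegral_const_mul' _ _ enorm_ne_top, ENNReal.mul_rpow_of_nonneg _ _ hp0.le]
    _ ≤ _ := by
        gcongr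
        exact rpow_lintegral_le_of_prob hp hc.enorm.aemeasurable

/-- `W^{1,p}` controls the fractional seminorm on balls. -/
lemma lintegral_fractional_le {n : ℕ} (hn : 0 < n) {p s : ℝ} (hp : 1 ≤ p) (hs1 : s < 1)
    {x₀ : En n} {r : ℝ} (hr : 0 < r) {w : En n → ℝ} (hw : ContDiff ℝ 1 w) :
    ∫⁻ x in ball x₀ r, ∫⁻ y in ball x₀ r,
        ‖w x - w y‖ₑ ^ p * ENNReal.ofReal (‖x - y‖ ^ (-((n : ℝ) + p * s))) ≤
      ENNReal.ofReal (sphereConst n / (p * (1 - s)) * (2 * r) ^ (p * (1 - s))) *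
        ∫⁻ x in ball x₀ r, ‖gradient w x‖ₑ ^ p := by
  have hp0 : 0 < p := by linarith
  have hα : 0 < p * (1 - s) := mul_pos hp0 (by linarith)
  set B := ball x₀ r with hB
  have hBm : MeasurableSet B := measurableSet_ball
  set g : En n → ℝ≥0∞ := B.indicator fun z => ‖gradient w z‖ₑ ^ p with hg
  have hgm : Measurable g :=
    ((continuous_gradient hw).enorm.measurable.pow_const p).indicator hBm
  set κ : En n → ℝ≥0∞ := fun h => ENNReal.ofReal (‖h‖ ^ (p * (1 - s) - n)) with hκ
  have hκm : Measurable κ := (measurable_norm.pow_const _).ennreal_ofReal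
  have key : ∀ x ∈ B, ∀ y ∈ B,
      ‖w x - w y‖ₑ ^ p * ENNReal.ofReal (‖x - y‖ ^ (-((n : ℝ) + p * s))) ≤
      κ (y - x) * ∫⁻ t in Ioc (0 : ℝ) 1, g (x + t • (y - x)) := by
    intro x hx y hy
    rcases eq_or_ne x y with rfl | hne
    · simp [ENNReal.zero_rpow_of_pos hp0]
    have h1 := enorm_sub_rpow_le_lintegral_gradient hp hw x (y - x)
    rw [add_sub_cancel, enorm_sub_rev] at h1
    have h2 : ∫⁻ t in Ioc (0 : ℝ) 1, ‖gradient w (x + t • (y - x))‖ₑ ^ p =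
        ∫⁻ t in Ioc (0 : ℝ) 1, g (x + t • (y - x)) := by
      refine setLIntegral_congr_fun measurableSet_Ioc fun t ht => ?_
      have : x + t • (y - x) ∈ B :=
        (convex_ball x₀ r).add_smul_sub_mem hx hy ⟨ht.1.le, ht.2⟩
      simp [hg, this]
    have hpos : 0 < ‖y - x‖ := norm_pos_iff.2 (sub_ne_zero.2 hne.symm)
    calc _ ≤ (‖y - x‖ₑ ^ p * ∫⁻ t in Ioc (0 : ℝ) 1, g (x + t • (y - x))) *
        ENNReal.ofReal (‖x - y‖ ^ (-((n : ℝ) + p * s))) := by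
          rw [← h2]; gcongr
      _ = κ (y - x) * ∫⁻ t in Ioc (0 : ℝ) 1, g (x + t • (y - x)) := by
          rw [mul_right_comm]
          congr 1
          rw [← ofReal_norm, ENNReal.ofReal_rpow_of_pos hpos, norm_sub_rev x y,
            ← ENNReal.ofReal_mul (by positivity), ← Real.rpow_add hpos, hκ]
          congr 2
          ring
  calc _ ≤ ∫⁻ x in B, ∫⁻ y in B, κ (y - x) * ∫⁻ t in Ioc (0 : ℝ) 1, g (x + t • (y - x)) := by
        refine setLIntegral_mono' hBm fun x hx => ?_
        exact setLIntegral_mono' hBm fun y hy => key x hx y hy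
    _ ≤ ∫⁻ x, ∫⁻ h in ball 0 (2 * r), κ h * ∫⁻ t in Ioc (0 : ℝ) 1, g (x + t • h) := by
        refine le_trans ?_ (setLIntegral_le_lintegral B _)
        refine setLIntegral_mono' hBm fun x hx => ?_
        rw [← lintegral_indicator hBm, ← lintegral_indicator measurableSet_ball,
          ← lintegral_add_left_eq_self _ x]
        refine lintegral_mono fun h => ?_
        by_cases hh : x + h ∈ B
        · have hb : h ∈ ball (0 : En n) (2 * r) := by
            rw [hB, mem_ball, dist_eq_norm] at hx hh
            rw [mem_ball_zero_iff]
            calc ‖h‖ = ‖(x + h - x₀) - (x - x₀)‖ := by congr 1; abel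
              _ ≤ ‖x + h - x₀‖ + ‖x - x₀‖ := norm_sub_le _ _
              _ < 2 * r := by linarith
          rw [indicator_of_mem hh, indicator_of_mem hb, add_sub_cancel_left]
        · rw [indicator_of_notMem hh]; exact zero_le
    _ = ∫⁻ h in ball 0 (2 * r), ∫⁻ x, κ h * ∫⁻ t in Ioc (0 : ℝ) 1, g (x + t • h) := by
        refine lintegral_lintegral_swap ?_
        refine Measurable.aemeasurable ?_
        refine (hκm.comp measurable_snd).mul ?_
        have : Measurable (fun q : (En n × En n) × ℝ => g (q.1.1 + q.2 • q.1.2)) :=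
          hgm.comp (by fun_prop)
        exact this.lintegral_prod_right'
    _ = ∫⁻ h in ball 0 (2 * r), κ h * ∫⁻ x, g x := by
        refine lintegral_congr fun h => ?_
        rw [lintegral_const_mul' _ _ ENNReal.ofReal_ne_top]
        congr 1
        rw [lintegral_lintegral_swap (by
          refine Measurable.aemeasurable ?_
          exact hgm.comp (by fun_prop))]
        calc _ = ∫⁻ _ in Ioc (0 : ℝ) 1, ∫⁻ x, g x := by
              refine lintegral_congr fun t => ?_
              exact lintegral_add_right_eq_self g (t • h)
          _ = _ := by simp
    _ = _ := by
        rw [lintegral_mul_const _ hκm, hg, lintegral_indicator hBm]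
        congr 1
        have := lintegral_ball_rpow hn hα (r := 2 * r) (by positivity) (0 : En n)
        simpa [hκ] using this

/-- The measure `|x-y|^{-(n+ps)} dx dy` on `B × B`. -/
def fracMeas (n : ℕ) (p s : ℝ) (B : Set (En n)) : Measure (En n × En n) :=
  ((volume.restrict B).prod (volume.restrict B)).withDensity
    fun z => ENNReal.ofReal (‖z.1 - z.2‖ ^ (-((n : ℝ) + p * s)))

section
open Filter

lemma measurable_kernel {n : ℕ} {a : ℝ} :
    Measurable fun z : En n × En n => ENNReal.ofReal (‖z.1 - z.2‖ ^ a) :=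
  ((measurable_fst.sub measurable_snd).norm.pow_const _).ennreal_ofReal

lemma lintegral_fracMeas {n : ℕ} {p s : ℝ} {B : Set (En n)} (f : En n × En n → ℝ≥0∞) :
    ∫⁻ z, f z ∂(fracMeas n p s B) = ∫⁻ z, f z * ENNReal.ofReal (‖z.1 - z.2‖ ^ (-((n : ℝ) + p * s)))
      ∂((volume.restrict B).prod (volume.restrict B)) := by
  rw [fracMeas, lintegral_withDensity_eq_lintegral_mul_non_measurable _ measurable_kernel
    (ae_of_all _ fun z => ENNReal.ofReal_lt_top)]
  exact lintegral_congr fun z => mul_comm _ _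

lemma fracMeas_absolutelyContinuous {n : ℕ} {p s : ℝ} {B : Set (En n)} :
    fracMeas n p s B ≪ (volume.restrict B).prod (volume.restrict B) :=
  withDensity_absolutelyContinuous _ _

lemma ae_fracMeas_fst {n : ℕ} {p s : ℝ} {B : Set (En n)} {P : En n → Prop}
    (h : ∀ᵐ x ∂(volume.restrict B), P x) : ∀ᵐ z ∂(fracMeas n p s B), P z.1 :=
  fracMeas_absolutelyContinuous.ae_le (Measure.quasiMeasurePreserving_fst.ae h)

lemma ae_fracMeas_snd {n : ℕ} {p s : ℝ} {B : Set (En n)} {P : En n → Prop}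
    (h : ∀ᵐ x ∂(volume.restrict B), P x) : ∀ᵐ z ∂(fracMeas n p s B), P z.2 :=
  fracMeas_absolutelyContinuous.ae_le (Measure.quasiMeasurePreserving_snd.ae h)

lemma AEMeasurable.fracMeas_fst {n : ℕ} {p s : ℝ} {B : Set (En n)} {β : Type*}
    [MeasurableSpace β] {f : En n → β} (h : AEMeasurable f (volume.restrict B)) :
    AEMeasurable (fun z => f z.1) (fracMeas n p s B) :=
  (h.comp_quasiMeasurePreserving Measure.quasiMeasurePreserving_fst).mono_ac
    fracMeas_absolutelyContinuous

lemma AEMeasurable.fracMeas_snd {n : ℕ} {p s : ℝ} {B : Set (En n)} {β : Type*}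
    [MeasurableSpace β] {f : En n → β} (h : AEMeasurable f (volume.restrict B)) :
    AEMeasurable (fun z => f z.2) (fracMeas n p s B) :=
  (h.comp_quasiMeasurePreserving Measure.quasiMeasurePreserving_snd).mono_ac
    fracMeas_absolutelyContinuous

lemma lintegral_fracMeas_smooth_le {n : ℕ} (hn : 0 < n) {p s : ℝ} (hp : 1 ≤ p) (hs1 : s < 1)
    {x₀ : En n} {r : ℝ} (hr : 0 < r) {w : En n → ℝ} (hw : ContDiff ℝ 1 w) :
    ∫⁻ z, ‖w z.1 - w z.2‖ₑ ^ p ∂(fracMeas n p s (ball x₀ r)) ≤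
      ENNReal.ofReal (sphereConst n / (p * (1 - s)) * (2 * r) ^ (p * (1 - s))) *
        ∫⁻ x in ball x₀ r, ‖gradient w x‖ₑ ^ p := by
  rw [lintegral_fracMeas, lintegral_prod]
  · exact lintegral_fractional_le hn hp hs1 hr hw
  · refine Measurable.aemeasurable (Measurable.mul ?_ measurable_kernel)
    exact (((hw.continuous.measurable.comp measurable_fst).sub
      (hw.continuous.measurable.comp measurable_snd)).enorm).pow_const p

lemma enorm_add_rpow_le {E : Type*} [NormedAddCommGroup E] {p : ℝ} (hp : 1 ≤ p) (a b : E) :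
    ‖a + b‖ₑ ^ p ≤ 2 ^ (p - 1) * (‖a‖ₑ ^ p + ‖b‖ₑ ^ p) := by
  calc _ ≤ (‖a‖ₑ + ‖b‖ₑ) ^ p := by gcongr; exact enorm_add_le a b
    _ ≤ _ := ENNReal.rpow_add_le_mul_rpow_add_rpow _ _ hp

lemma tendsto_fracMeas {n : ℕ} (hn : 0 < n) {p s : ℝ} (hp : 1 ≤ p) (hs1 : s < 1)
    {x₀ : En n} {r : ℝ} (hr : 0 < r) {w : ℕ → En n → ℝ} {u : En n → ℝ} {G : En n → En n}
    (hw : ∀ k, ContDiff ℝ 1 (w k))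
    (hG : AEStronglyMeasurable G (volume.restrict (ball x₀ r)))
    (hgrad : Tendsto (fun k => ∫⁻ x in ball x₀ r, ‖gradient (w k) x - G x‖ₑ ^ p) atTop (𝓝 0))
    (hae : ∀ᵐ x ∂(volume.restrict (ball x₀ r)), Tendsto (fun k => w k x) atTop (𝓝 (u x))) :
    Tendsto (fun k => ∫⁻ z, ‖(w k z.1 - w k z.2) - (u z.1 - u z.2)‖ₑ ^ p
      ∂(fracMeas n p s (ball x₀ r))) atTop (𝓝 0) := by
  have hp0 : 0 < p := by linarith
  set C := ENNReal.ofReal (sphereConst n / (p * (1 - s)) * (2 * r) ^ (p * (1 - s))) with hC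
  set e : ℕ → ℝ≥0∞ := fun k => ∫⁻ x in ball x₀ r, ‖gradient (w k) x - G x‖ₑ ^ p with he
  have h2top : (2 : ℝ≥0∞) ^ (p - 1) ≠ ⊤ :=
    ENNReal.rpow_ne_top_of_nonneg (by linarith) (by simp)
  have hkl : ∀ k l, ∫⁻ z, ‖(w k z.1 - w k z.2) - (w l z.1 - w l z.2)‖ₑ ^ p
      ∂(fracMeas n p s (ball x₀ r)) ≤ C * (2 ^ (p - 1) * (e k + e l)) := by
    intro k l
    have h1 := lintegral_fracMeas_smooth_le hn hp hs1 (x₀ := x₀) hr ((hw k).sub (hw l))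
    calc _ = ∫⁻ z, ‖(w k - w l) z.1 - (w k - w l) z.2‖ₑ ^ p
          ∂(fracMeas n p s (ball x₀ r)) := by
          refine lintegral_congr fun z => ?_
          congr 2
          simp only [Pi.sub_apply]; ring
      _ ≤ C * ∫⁻ x in ball x₀ r, ‖gradient (w k - w l) x‖ₑ ^ p := h1
      _ ≤ _ := by
          gcongr
          have hm : ∀ k, AEMeasurable (fun x => ‖gradient (w k) x - G x‖ₑ ^ p)
              (volume.restrict (ball x₀ r)) := fun k =>
            (((continuous_gradient (hw k)).aestronglyMeasurable.sub hG).enorm).pow_const p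
          rw [he]
          simp only
          rw [← lintegral_add_left' (hm k), ← lintegral_const_mul' _ _ h2top]
          refine lintegral_mono fun x => ?_
          have hg : gradient (w k - w l) x =
              (gradient (w k) x - G x) + -(gradient (w l) x - G x) := by
            have : gradient (w k - w l) x = gradient (w k) x - gradient (w l) x := by
              rw [gradient, fderiv_sub ((hw k).differentiable one_ne_zero _)
                ((hw l).differentiable one_ne_zero _), map_sub]; rfl
            rw [this]; abel
          rw [hg, ← enorm_neg (gradient (w l) x - G x)]
          exact enorm_add_rpow_le hp _ _
  have hlim : ∀ k, ∫⁻ z, ‖(w k z.1 - w k z.2) - (u z.1 - u z.2)‖ₑ ^ p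
      ∂(fracMeas n p s (ball x₀ r)) ≤ C * (2 ^ (p - 1) * e k) := by
    intro k
    have h1 : ∫⁻ z, ‖(w k z.1 - w k z.2) - (u z.1 - u z.2)‖ₑ ^ p
        ∂(fracMeas n p s (ball x₀ r)) ≤ ∫⁻ z, liminf (fun l =>
          ‖(w k z.1 - w k z.2) - (w l z.1 - w l z.2)‖ₑ ^ p) atTop
          ∂(fracMeas n p s (ball x₀ r)) := by
      refine lintegral_mono_ae ?_
      filter_upwards [ae_fracMeas_fst hae, ae_fracMeas_snd hae] with z h1 h2
      have : Tendsto (fun l => ‖(w k z.1 - w k z.2) - (w l z.1 - w l z.2)‖ₑ ^ p) atTop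
          (𝓝 (‖(w k z.1 - w k z.2) - (u z.1 - u z.2)‖ₑ ^ p)) :=
        ((ENNReal.continuous_rpow_const (y := p)).tendsto _).comp
          ((tendsto_const_nhds.sub (h1.sub h2)).enorm)
      rw [this.liminf_eq]
    refine h1.trans ((lintegral_liminf_le' fun l => ?_).trans ?_)
    · refine Measurable.aemeasurable ?_
      have hm : ∀ k, Measurable (w k) := fun k => (hw k).continuous.measurable
      exact ((((hm k).comp measurable_fst).sub ((hm k).comp measurable_snd)).sub
        (((hm l).comp measurable_fst).sub ((hm l).comp measurable_snd))).enorm.pow_const p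
    · have h3 : Tendsto (fun l => C * (2 ^ (p - 1) * (e k + e l))) atTop
          (𝓝 (C * (2 ^ (p - 1) * (e k + 0)))) := by
        refine ENNReal.Tendsto.const_mul ?_ (Or.inr ENNReal.ofReal_ne_top)
        exact ENNReal.Tendsto.const_mul (tendsto_const_nhds.add hgrad) (Or.inr h2top)
      rw [add_zero] at h3
      rw [← h3.liminf_eq]
      exact liminf_le_liminf (Eventually.of_forall fun l => hkl k l)
  have h4 : Tendsto (fun k => C * (2 ^ (p - 1) * e k)) atTop (𝓝 0) := by
    have := ENNReal.Tendsto.const_mul (a := C) (ENNReal.Tendsto.const_mul (a := 2 ^ (p - 1)) hgrad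
      (Or.inr h2top)) (Or.inr ENNReal.ofReal_ne_top)
    simpa using this
  exact tendsto_of_tendsto_of_tendsto_of_le_of_le tendsto_const_nhds h4 (fun _ => zero_le) hlim

lemma exists_lt_top_of_tendsto_zero {e : ℕ → ℝ≥0∞} (h : Tendsto e atTop (𝓝 0)) :
    ∃ k, e k < ⊤ :=
  (h.eventually (gt_mem_nhds ENNReal.zero_lt_top)).exists

lemma lintegral_fracMeas_lt_top {n : ℕ} (hn : 0 < n) {p s : ℝ} (hp : 1 ≤ p) (hs1 : s < 1)
    {x₀ : En n} {r : ℝ} (hr : 0 < r) {w : ℕ → En n → ℝ} {u : En n → ℝ} {G : En n → En n}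
    (hw : ∀ k, ContDiff ℝ 1 (w k))
    (hG : AEStronglyMeasurable G (volume.restrict (ball x₀ r)))
    (hGfin : ∫⁻ x in ball x₀ r, ‖G x‖ₑ ^ p ≠ ⊤)
    (hgrad : Tendsto (fun k => ∫⁻ x in ball x₀ r, ‖gradient (w k) x - G x‖ₑ ^ p) atTop (𝓝 0))
    (hae : ∀ᵐ x ∂(volume.restrict (ball x₀ r)), Tendsto (fun k => w k x) atTop (𝓝 (u x))) :
    ∫⁻ z, ‖u z.1 - u z.2‖ₑ ^ p ∂(fracMeas n p s (ball x₀ r)) ≠ ⊤ := by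
  have hp0 : 0 < p := by linarith
  have h2top : (2 : ℝ≥0∞) ^ (p - 1) ≠ ⊤ :=
    ENNReal.rpow_ne_top_of_nonneg (by linarith) (by simp)
  obtain ⟨k, hk⟩ := exists_lt_top_of_tendsto_zero (hgrad.add
    (tendsto_fracMeas hn hp hs1 hr hw hG hgrad hae) |>.congr' (EventuallyEq.refl _ _)
    |> fun h => by simpa using h)
  rw [ENNReal.add_lt_top] at hk
  have h1 : ∫⁻ x in ball x₀ r, ‖gradient (w k) x‖ₑ ^ p < ⊤ := by
    have hm : AEMeasurable (fun x => ‖gradient (w k) x - G x‖ₑ ^ p)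
        (volume.restrict (ball x₀ r)) :=
      (((continuous_gradient (hw k)).aestronglyMeasurable.sub hG).enorm).pow_const p
    calc _ ≤ ∫⁻ x in ball x₀ r, 2 ^ (p - 1) * (‖gradient (w k) x - G x‖ₑ ^ p + ‖G x‖ₑ ^ p) := by
          refine lintegral_mono fun x => ?_
          have := enorm_add_rpow_le hp (gradient (w k) x - G x) (G x)
          rwa [sub_add_cancel] at this
      _ = 2 ^ (p - 1) * ((∫⁻ x in ball x₀ r, ‖gradient (w k) x - G x‖ₑ ^ p) +
            ∫⁻ x in ball x₀ r, ‖G x‖ₑ ^ p) := by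
          rw [lintegral_const_mul' _ _ h2top, lintegral_add_left' hm]
      _ < ⊤ := ENNReal.mul_lt_top h2top.lt_top (ENNReal.add_lt_top.2 ⟨hk.1, hGfin.lt_top⟩)
  have hm : AEMeasurable (fun z : En n × En n => ‖w k z.1 - w k z.2‖ₑ ^ p)
      (fracMeas n p s (ball x₀ r)) := by
    have hm := (hw k).continuous.measurable
    exact (((hm.comp measurable_fst).sub (hm.comp measurable_snd)).enorm.pow_const p).aemeasurable
  refine ne_of_lt ?_
  calc _ ≤ ∫⁻ z, 2 ^ (p - 1) * (‖w k z.1 - w k z.2‖ₑ ^ p +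
        ‖(w k z.1 - w k z.2) - (u z.1 - u z.2)‖ₑ ^ p) ∂(fracMeas n p s (ball x₀ r)) := by
        refine lintegral_mono fun z => ?_
        have := enorm_add_rpow_le hp (w k z.1 - w k z.2)
          (-((w k z.1 - w k z.2) - (u z.1 - u z.2)))
        rw [enorm_neg] at this
        refine le_trans (le_of_eq ?_) this
        congr 2
        ring
    _ = 2 ^ (p - 1) * (∫⁻ z, ‖w k z.1 - w k z.2‖ₑ ^ p ∂(fracMeas n p s (ball x₀ r)) +
        ∫⁻ z, ‖(w k z.1 - w k z.2) - (u z.1 - u z.2)‖ₑ ^ p ∂(fracMeas n p s (ball x₀ r))) := by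
        rw [lintegral_const_mul' _ _ h2top, lintegral_add_left' hm]
    _ < ⊤ := by
        refine ENNReal.mul_lt_top h2top.lt_top (ENNReal.add_lt_top.2 ⟨?_, hk.2⟩)
        exact (lintegral_fracMeas_smooth_le hn hp hs1 hr (hw k)).trans_lt
          (ENNReal.mul_lt_top ENNReal.ofReal_lt_top h1)
end

lemma ofReal_integral_le {α : Type*} [MeasurableSpace α] {μ : Measure α} (g : α → ℝ) :
    ENNReal.ofReal (∫ a, g a ∂μ) ≤ ∫⁻ a, ENNReal.ofReal (g a) ∂μ := by
  by_cases hg : Integrable g μ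
  · rw [integral_eq_lintegral_pos_part_sub_lintegral_neg_part hg]
    calc _ ≤ ENNReal.ofReal (∫⁻ a, ENNReal.ofReal (g a) ∂μ).toReal :=
          ENNReal.ofReal_le_ofReal (sub_le_self _ ENNReal.toReal_nonneg)
      _ ≤ _ := ENNReal.ofReal_toReal_le
  · simp [integral_undef hg]

lemma Jp_of_nonneg {p t : ℝ} (hp : 1 < p) (ht : 0 ≤ t) : Jp p t = t ^ (p - 1) := by
  rcases ht.eq_or_lt with rfl | ht
  · rw [Real.zero_rpow (by linarith)]; simp [Jp]
  · rw [Jp, abs_of_pos ht, ← Real.rpow_add_one ht.ne']; congr 1; ring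

lemma Jp_neg (p t : ℝ) : Jp p (-t) = - Jp p t := by simp [Jp]

lemma abs_Jp {p t : ℝ} (hp : 1 < p) : |Jp p t| = |t| ^ (p - 1) := by
  rcases le_total 0 t with h | h
  · rw [Jp_of_nonneg hp h, abs_of_nonneg h, abs_of_nonneg (by positivity)]
  · have : Jp p t = - Jp p (-t) := by rw [Jp_neg, neg_neg]
    rw [this, Jp_of_nonneg hp (by linarith), abs_neg, abs_of_nonpos h, abs_of_nonneg]
    exact Real.rpow_nonneg (by linarith) _

lemma Jp_strictMono {p : ℝ} (hp : 1 < p) : StrictMono (Jp p) := by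
  have hpos : ∀ {a b : ℝ}, 0 ≤ a → a < b → Jp p a < Jp p b := fun ha hab => by
    rw [Jp_of_nonneg hp ha, Jp_of_nonneg hp (by linarith)]
    exact Real.rpow_lt_rpow ha hab (by linarith)
  have h0 : Jp p 0 = 0 := by simp [Jp]
  intro a b hab
  rcases le_or_gt 0 a with ha | ha
  · exact hpos ha hab
  · have h1 : Jp p a < 0 := by
      have := hpos le_rfl (neg_pos.2 ha)
      rw [Jp_neg, h0] at this; linarith
    rcases le_or_gt 0 b with hb | hb
    · rcases hb.eq_or_lt with rfl | hb
      · rwa [h0]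
      · have := hpos le_rfl hb
        rw [h0] at this; linarith
    · have := hpos (neg_pos.2 hb).le (neg_lt_neg hab)
      rw [Jp_neg, Jp_neg] at this; linarith

lemma measurable_Jp (p : ℝ) : Measurable (Jp p) :=
  (measurable_id.abs.pow_const _).mul measurable_id

lemma Jp_sub_le {p a b : ℝ} (hp : 1 < p) (ha : 0 ≤ a) :
    Jp p (a - b) ≤ 2 ^ (p - 1) * (a ^ (p - 1) + (max (-b) 0) ^ (p - 1)) := by
  have hp1 : 0 < p - 1 := by linarith
  set c := max (-b) 0 with hc
  have hc0 : 0 ≤ c := le_max_right _ _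
  have h1 : Jp p (a - b) ≤ Jp p (a + c) :=
    (Jp_strictMono hp).monotone (by linarith [le_max_left (-b) 0])
  rw [Jp_of_nonneg hp (show 0 ≤ a + c by linarith)] at h1
  refine h1.trans ?_
  have h2 : (a + c) ^ (p - 1) ≤ (2 * max a c) ^ (p - 1) :=
    Real.rpow_le_rpow (by linarith) (by linarith [le_max_left a c, le_max_right a c]) hp1.le
  rw [Real.mul_rpow (by norm_num) (le_max_of_le_left ha)] at h2
  refine h2.trans ?_
  gcongr
  rcases max_cases a c with ⟨h, _⟩ | ⟨h, _⟩ <;> rw [h]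
  · exact le_add_of_nonneg_right (by positivity)
  · exact le_add_of_nonneg_left (by positivity)

lemma rpow_sub_one_le_one_add {p t : ℝ} (hp : 1 < p) (ht : 0 ≤ t) : t ^ (p - 1) ≤ 1 + t ^ p := by
  rcases le_total t 1 with h | h
  · have := Real.rpow_le_one ht h (show 0 ≤ p - 1 by linarith)
    have := Real.rpow_nonneg ht p
    linarith
  · have := Real.rpow_le_rpow_of_exponent_le h (show p - 1 ≤ p by linarith)
    linarith

lemma TestFun.mono {n : ℕ} {U V : Set (En n)} {φ : En n → ℝ} (h : TestFun U φ) (hUV : U ⊆ V) :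
    TestFun V φ := ⟨h.1, h.2.1, h.2.2.trans hUV⟩

lemma TestFun.add {n : ℕ} {U : Set (En n)} {φ ψ : En n → ℝ} (h : TestFun U φ) (h' : TestFun U ψ) :
    TestFun U (φ + ψ) :=
  ⟨h.1.add h'.1, h.2.1.add h'.2.1,
    (tsupport_add φ ψ).trans (union_subset h.2.2 h'.2.2)⟩

/-- If the weak gradient fails to be measurable, then the function has zero weak gradient. -/
lemma HasWeakGradOn.aestronglyMeasurable_or_zero {n : ℕ} {u : En n → ℝ} {G : En n → En n}
    {x₀ : En n} {ρ R : ℝ} (hρ0 : 0 < ρ) (hρ : ρ < R) (hG : HasWeakGradOn u G (ball x₀ R))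
    (hint : ∀ φ : En n → ℝ, TestFun (ball x₀ R) φ → Integrable fun x => u x • gradient φ x) :
    AEStronglyMeasurable G (volume.restrict (ball x₀ ρ)) ∨ HasWeakGradOn u 0 (ball x₀ R) := by
  let b : ContDiffBump x₀ := ⟨ρ, (ρ + R) / 2, hρ0, by linarith⟩
  have hbt : TestFun (ball x₀ R) b := by
    refine ⟨b.contDiff, b.hasCompactSupport, ?_⟩
    rw [b.tsupport_eq]
    exact closedBall_subset_ball (show (ρ + R) / 2 < R by linarith)
  by_cases hm : AEStronglyMeasurable (fun x => b x • G x) volume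
  · left
    refine (hm.mono_measure Measure.restrict_le_self).congr ?_
    filter_upwards [ae_restrict_mem measurableSet_ball] with x hx
    rw [b.one_of_mem_closedBall (ball_subset_closedBall hx), one_smul]
  · right
    have h0 : ∫ x, u x • gradient b x = 0 := by
      rw [hG _ hbt, integral_undef fun h => hm h.1, neg_zero]
    intro φ hφ
    simp only [Pi.zero_apply, smul_zero, integral_zero, neg_zero]
    by_cases hi : Integrable fun x => φ x • G x
    · have h1 := hG _ (hφ.add hbt)
      have h2 : ∫ x, (φ + ⇑b) x • G x = 0 := by
        refine integral_undef fun h => hm ?_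
        refine (h.sub hi).1.congr (ae_of_all _ fun x => ?_)
        simp [add_smul]
      rw [h2, neg_zero] at h1
      have hgr : ∀ x, gradient (φ + ⇑b) x = gradient φ x + gradient (⇑b) x := by
        intro x
        rw [gradient, fderiv_add (hφ.1.differentiable (by simp) x)
          (b.contDiff.differentiable (n := 1) (by simp) x), map_add]
        rfl
      simp_rw [hgr, smul_add] at h1
      rwa [integral_add (hint φ hφ) (hint b hbt), h0, add_zero] at h1
    · rw [hG _ hφ, integral_undef hi, neg_zero]

section
open Filter

/-- A function with zero weak gradient on a ball is constant on smaller balls. -/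
lemma ae_eq_const_of_hasWeakGradOn_zero {n : ℕ} (hn : 0 < n) {p : ℝ} (hp : 1 ≤ p)
    {u : En n → ℝ} {x₀ : En n} {r ρ : ℝ} (hr : 0 < r) (hrρ : r < ρ)
    (hu : MemLp u (ENNReal.ofReal p) (volume.restrict (ball x₀ ρ)))
    (hG : HasWeakGradOn u 0 (ball x₀ ρ)) (hu0 : ∀ x ∈ ball x₀ ρ, 0 ≤ u x) :
    ∃ c : ℝ, 0 ≤ c ∧ ∀ᵐ x ∂(volume.restrict (ball x₀ r)), u x = c := by
  have hp0 : 0 < p := by linarith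
  obtain ⟨w, hw, -, -, hgrad, hae⟩ := exists_smooth_approx hp hrρ hu MemLp.zero hG hu0
  have hw1 : ∀ k, ContDiff ℝ 1 (w k) := fun k => (hw k).of_le (by exact_mod_cast le_top)
  set ν := fracMeas n p 0 (ball x₀ r) with hν
  have hlim : Tendsto (fun k => ∫⁻ z, ‖w k z.1 - w k z.2‖ₑ ^ p ∂ν) atTop (𝓝 0) := by
    have h1 : Tendsto (fun k => ENNReal.ofReal (sphereConst n / (p * (1 - 0)) *
        (2 * r) ^ (p * (1 - (0 : ℝ)))) * ∫⁻ x in ball x₀ r, ‖gradient (w k) x‖ₑ ^ p) atTop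
        (𝓝 0) := by
      have := ENNReal.Tendsto.const_mul (a := ENNReal.ofReal (sphereConst n / (p * (1 - 0)) *
        (2 * r) ^ (p * (1 - (0 : ℝ))))) hgrad (Or.inr ENNReal.ofReal_ne_top)
      simpa using this
    exact tendsto_of_tendsto_of_tendsto_of_le_of_le tendsto_const_nhds h1 (fun _ => zero_le)
      fun k => lintegral_fracMeas_smooth_le hn hp zero_lt_one hr (hw1 k)
  have hzero : ∫⁻ z, ‖u z.1 - u z.2‖ₑ ^ p ∂ν = 0 := by
    refine le_antisymm ?_ zero_le
    calc ∫⁻ z, ‖u z.1 - u z.2‖ₑ ^ p ∂ν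
        = ∫⁻ z, liminf (fun k => ‖w k z.1 - w k z.2‖ₑ ^ p) atTop ∂ν := by
          refine lintegral_congr_ae ?_
          filter_upwards [ae_fracMeas_fst hae, ae_fracMeas_snd hae] with z h1 h2
          exact (Tendsto.liminf_eq (((ENNReal.continuous_rpow_const (y := p)).tendsto _).comp
            (h1.sub h2).enorm)).symm
      _ ≤ liminf (fun k => ∫⁻ z, ‖w k z.1 - w k z.2‖ₑ ^ p ∂ν) atTop :=
          lintegral_liminf_le fun k => ((((hw1 k).continuous.measurable.comp measurable_fst).sub
            ((hw1 k).continuous.measurable.comp measurable_snd)).enorm).pow_const p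
      _ = 0 := hlim.liminf_eq
  have hum : AEMeasurable u (volume.restrict (ball x₀ r)) :=
    hu.1.aemeasurable.mono_measure (Measure.restrict_mono (ball_subset_ball hrρ.le) le_rfl)
  have hUm : AEMeasurable (fun z : En n × En n => ‖u z.1 - u z.2‖ₑ ^ p) ν :=
    ((hum.fracMeas_fst.sub hum.fracMeas_snd).enorm.pow_const p)
  rw [lintegral_eq_zero_iff' hUm] at hzero
  have h2 : ∀ᵐ z ∂((volume.restrict (ball x₀ r)).prod (volume.restrict (ball x₀ r))),
      u z.1 = u z.2 := by
    have := (ae_withDensity_iff measurable_kernel).1 hzero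
    filter_upwards [this] with z hz
    by_cases h : z.1 = z.2
    · rw [h]
    · have h3 := hz (by
        have : 0 < ‖z.1 - z.2‖ := norm_pos_iff.2 (sub_ne_zero.2 h)
        simp only [ne_eq, ENNReal.ofReal_eq_zero, not_le]
        positivity)
      simpa [hp0, hp0.not_gt, sub_eq_zero] using h3
  have h3 := Measure.ae_ae_of_ae_prod h2
  have hne : (ae (volume.restrict (ball x₀ r))).NeBot := by
    rw [ae_neBot, ne_eq, Measure.restrict_eq_zero]
    exact (measure_ball_pos volume x₀ hr).ne'
  obtain ⟨x, hx, hxm⟩ := (h3.and (ae_restrict_mem measurableSet_ball)).exists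
  exact ⟨u x, hu0 x (ball_subset_ball hrρ.le hxm), hx.mono fun y hy => hy.symm⟩

end

lemma HasCompactSupport.exists_pos_bound {n : ℕ} {φ : En n → ℝ} (h : HasCompactSupport φ)
    (hc : Continuous φ) : ∃ M : ℝ, 0 < M ∧ ∀ x, |φ x| ≤ M := by
  obtain ⟨M, hM⟩ := hc.bounded_above_of_compact_support h
  exact ⟨max M 1, by positivity, fun x => (hM x).trans (le_max_left _ _)⟩

lemma add_rpow_le_mul_add {p a b : ℝ} (hp : 1 ≤ p) (ha : 0 ≤ a) (hb : 0 ≤ b) :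
    (a + b) ^ p ≤ 2 ^ (p - 1) * (a ^ p + b ^ p) := by
  lift a to ℝ≥0 using ha
  lift b to ℝ≥0 using hb
  exact_mod_cast NNReal.rpow_add_le_mul_rpow_add_rpow a b hp

lemma abs_sub_rpow_le {p : ℝ} (hp : 1 ≤ p) (a b : ℝ) :
    |a - b| ^ p ≤ 2 ^ (p - 1) * (|a| ^ p + |b| ^ p) := by
  have h1 : |a - b| ^ p ≤ (|a| + |b|) ^ p :=
    Real.rpow_le_rpow (abs_nonneg _) (abs_sub a b) (by linarith)
  exact h1.trans (add_rpow_le_mul_add hp (abs_nonneg _) (abs_nonneg _))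

/-- If the inner nonlocal integral is measurable, the function is measurable off the ball. -/
lemma Setting.aemeasurable_compl_ball {n : ℕ} {p s C₁ C₂ Λ : ℝ} (S : Setting n p s C₁ C₂ Λ)
    (hp : 1 < p) (hs0 : 0 < s) {u φ : En n → ℝ} {x₀ : En n} {ρ R : ℝ} (hρ : ρ < R)
    (hum : AEMeasurable u (volume.restrict (ball x₀ R)))
    (hφ : TestFun (ball x₀ R) φ) (hφ0 : ∀ x, 0 ≤ φ x) (hφne : ∃ x, φ x ≠ 0)
    (hsupp : tsupport φ ⊆ closedBall x₀ ρ)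
    (hint : IntegrableOn (fun x => |u x| ^ p) (tsupport φ))
    (hm : AEStronglyMeasurable
      (fun x => ∫ y, Jp p (u x - u y) * (φ x - φ y) * S.K x y) volume) :
    AEMeasurable u (volume.restrict (ball x₀ R)ᶜ) := by
  have hp1 : 0 < p - 1 := by linarith
  have hΛ := S.hΛ
  set ut := hum.mk u with hut
  have hutm : Measurable ut := hum.measurable_mk
  have hute : ∀ᵐ y ∂volume, y ∈ ball x₀ R → u y = ut y :=
    (ae_restrict_iff' measurableSet_ball).1 hum.ae_eq_mk
  have hφm : Measurable φ := hφ.1.continuous.measurable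
  have hφz : ∀ x, x ∉ tsupport φ → φ x = 0 := fun x hx => image_eq_zero_of_notMem_tsupport hx
  have hφz' : ∀ x, x ∉ ball x₀ R → φ x = 0 := fun x hx => hφz x fun h => hx (hφ.2.2 h)
  have hT : IsCompact (tsupport φ) := hφ.2.1
  obtain ⟨M, hM0, hM⟩ := hφ.2.1.exists_pos_bound hφ.1.continuous
  set I : ℝ → En n → En n → ℝ := fun t x y => Jp p (t - ut y) * φ y * S.K x y with hI
  set H : ℝ → En n → ℝ := fun t x => ∫ y, I t x y with hH
  have hIm : ∀ t, Measurable (Function.uncurry (I t)) := fun t =>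
    (((measurable_Jp p).comp (measurable_const.sub (hutm.comp measurable_snd))).mul
      (hφm.comp measurable_snd)).mul S.hKmeas
  have hHm : ∀ t, Measurable (H t) := fun t =>
    ((hIm t).stronglyMeasurable.integral_prod_right).measurable
  have hg : ∀ x, x ∉ ball x₀ R →
      ∫ y, Jp p (u x - u y) * (φ x - φ y) * S.K x y = - H (u x) x := by
    intro x hx
    rw [hH, ← integral_neg]
    refine integral_congr_ae ?_
    filter_upwards [hute] with y hy
    by_cases hyB : y ∈ ball x₀ R
    · simp only [hI]; rw [hφz' x hx, hy hyB]; ring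
    · simp only [hI]; rw [hφz' x hx, hφz' y hyB]; ring
  have hmono : ∀ᵐ x ∂volume, x ∉ ball x₀ R → StrictMono fun t => H t x := by
    have h1 := Measure.ae_ae_of_ae_prod (μ := (volume : Measure (En n)))
      (ν := (volume : Measure (En n))) (Measure.volume_eq_prod (En n) (En n) ▸ S.hKlower)
    have h2 := Measure.ae_ae_of_ae_prod (μ := (volume : Measure (En n)))
      (ν := (volume : Measure (En n))) (Measure.volume_eq_prod (En n) (En n) ▸ S.hKupper)
    filter_upwards [h1, h2] with x hx1 hx2 hxB
    have hd : ∀ y ∈ tsupport φ, R - ρ ≤ ‖x - y‖ := by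
      intro y hy
      have h3 : ‖y - x₀‖ ≤ ρ := by simpa [dist_eq_norm] using hsupp hy
      have h4 : R ≤ ‖x - x₀‖ := by simpa [dist_eq_norm] using hxB
      have h5 : ‖x - x₀‖ ≤ ‖x - y‖ + ‖y - x₀‖ := norm_sub_le_norm_sub_add_norm_sub x y x₀
      linarith
    have ha : -((n : ℝ) + p * s) ≤ 0 := by
      have : 0 < p * s := by positivity
      have : (0 : ℝ) ≤ n := by positivity
      linarith
    have hsub : ∀ t, Function.support (I t x) ⊆ tsupport φ := by
      intro t y hy
      by_contra h
      exact hy (by simp [hI, hφz y h])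
    have hii : ∀ t, Integrable (I t x) := by
      intro t
      rw [← integrableOn_iff_integrable_of_support_subset (hsub t)]
      set c := M * (Λ * (R - ρ) ^ (-((n : ℝ) + p * s))) with hc
      have hb : IntegrableOn (fun y => c * (1 + 2 ^ (p - 1) * (|t| ^ p + |u y| ^ p)))
          (tsupport φ) := by
        have hfin : volume (tsupport φ) ≠ ⊤ := hT.measure_lt_top.ne
        exact (((integrableOn_const hfin).add
          (((integrableOn_const hfin).add hint).const_mul _)).const_mul _)
      refine hb.mono' ((hIm t).comp measurable_prodMk_left).aestronglyMeasurable ?_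
      rw [ae_restrict_iff' hT.measurableSet]
      filter_upwards [hute, hx2] with y hy1 hy2 hyT
      have hK : S.K x y ≤ Λ * (R - ρ) ^ (-((n : ℝ) + p * s)) := by
        refine hy2.trans ?_
        gcongr ?_ * ?_
        exact Real.rpow_le_rpow_of_nonpos (by linarith) (hd y hyT) ha
      have hK0 := S.hKnonneg x y
      have hJ : |Jp p (t - ut y)| ≤ 1 + 2 ^ (p - 1) * (|t| ^ p + |u y| ^ p) := by
        rw [abs_Jp hp, ← hy1 (hφ.2.2 hyT)]
        exact (rpow_sub_one_le_one_add hp (abs_nonneg _)).trans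
          (by gcongr; exact abs_sub_rpow_le hp.le _ _)
      simp only [hI, norm_mul, Real.norm_eq_abs, abs_of_nonneg hK0]
      calc _ ≤ (1 + 2 ^ (p - 1) * (|t| ^ p + |u y| ^ p)) * M *
            (Λ * (R - ρ) ^ (-((n : ℝ) + p * s))) := by
            gcongr
            exact hM y
        _ = _ := by rw [hc]; ring
    intro t t' htt
    have hle : ∀ y, I t x y ≤ I t' x y := fun y =>
      mul_le_mul_of_nonneg_right (mul_le_mul_of_nonneg_right
        ((Jp_strictMono hp).monotone (by linarith)) (hφ0 y)) (S.hKnonneg x y)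
    have hpos : 0 < ∫ y, (I t' x y - I t x y) := by
      rw [integral_pos_iff_support_of_nonneg_ae (ae_of_all _ fun y => sub_nonneg.2 (hle y))
        ((hii t').sub (hii t))]
      have hopen : IsOpen {y | φ y ≠ 0} := isOpen_ne_fun hφ.1.continuous continuous_const
      refine (hopen.measure_pos volume hφne).trans_le (measure_mono_ae ?_)
      filter_upwards [hx1] with y hy1 hyφ
      have hyφ : φ y ≠ 0 := hyφ
      have hyT : y ∈ tsupport φ := subset_tsupport _ hyφ
      have hK : 0 < S.K x y := by
        have h0 : 0 < ‖x - y‖ := lt_of_lt_of_le (by linarith) (hd y hyT)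
        exact lt_of_lt_of_le (by positivity) hy1
      have hφp : 0 < φ y := lt_of_le_of_ne (hφ0 y) hyφ.symm
      have hJ := Jp_strictMono hp (show t - ut y < t' - ut y by linarith)
      have : I t x y < I t' x y :=
        mul_lt_mul_of_pos_right (mul_lt_mul_of_pos_right hJ hφp) hK
      exact (sub_pos.2 this).ne'
    rw [integral_sub (hii t') (hii t)] at hpos
    exact sub_pos.1 hpos
  set μ' := volume.restrict (ball x₀ R)ᶜ with hμ'
  have hnm : NullMeasurable u μ' := by
    have : @Measurable (NullMeasurableSpace (En n) μ') ℝ _ _ u := by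
      refine measurable_of_Iio fun t => ?_
      have h1 : NullMeasurableSet {x | -H t x <
          ∫ y, Jp p (u x - u y) * (φ x - φ y) * S.K x y} μ' :=
        nullMeasurableSet_lt (hHm t).neg.aemeasurable
          (hm.aemeasurable.mono_measure Measure.restrict_le_self)
      refine h1.congr ?_
      have h2 : ∀ᵐ x ∂μ', x ∈ (ball x₀ R)ᶜ := ae_restrict_mem measurableSet_ball.compl
      filter_upwards [h2, ae_restrict_of_ae hmono] with x hx hmx
      refine propext ?_
      change (-H t x < ∫ y, Jp p (u x - u y) * (φ x - φ y) * S.K x y) ↔ u x < t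
      rw [hg x hx, neg_lt_neg_iff]
      exact (hmx hx).lt_iff_lt
    exact fun s hs => this hs
  exact hnm.aemeasurable

lemma normLp_nonneg {n : ℕ} (m : ℝ) (f : En n → ℝ) (B : Set (En n)) : 0 ≤ normLp m f B :=
  Real.rpow_nonneg (integral_nonneg fun _ => Real.rpow_nonneg (abs_nonneg _) _) _

lemma Tail_nonneg {n : ℕ} {p s : ℝ} (v : En n → ℝ) (x₀ : En n) {ρ : ℝ} (hρ : 0 ≤ ρ) :
    0 ≤ Tail n p s v x₀ ρ :=
  Real.rpow_nonneg (mul_nonneg (Real.rpow_nonneg hρ _)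
    (integral_nonneg fun _ => mul_nonneg (Real.rpow_nonneg (abs_nonneg _) _)
      (Real.rpow_nonneg (norm_nonneg _) _))) _

lemma dBound_nonneg {n : ℕ} {p s q : ℝ} (u f : En n → ℝ) (x₀ : En n) {r R : ℝ} (hr : 0 < r)
    (hR : 0 < R) : 0 ≤ dBound n p s q u f x₀ r R :=
  add_nonneg (mul_nonneg (mul_nonneg (Real.rpow_nonneg hr.le _) (Real.rpow_nonneg hR.le _))
    (Tail_nonneg _ _ hR.le)) (mul_nonneg (mul_nonneg (Real.rpow_nonneg hr.le _)
      (Real.rpow_nonneg hR.le _)) (Real.rpow_nonneg (normLp_nonneg _ _ _) _))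

lemma normLp_le_of_dBound {n : ℕ} {p s q : ℝ} (hp : 1 < p) (hq : 0 < q) {u f : En n → ℝ}
    {x₀ : En n} {r R d : ℝ} (hr : 0 < r) (hR : 0 < R) (hd : dBound n p s q u f x₀ r R < d) :
    r ^ (p - n) * R ^ (n * (q - p) / q) * normLp (q / p) f (ball x₀ R) ≤ d ^ (p - 1) := by
  have hp1 : 0 < p - 1 := by linarith
  have hN := normLp_nonneg (q / p) f (ball x₀ R)
  have h1 : r ^ ((p - n) / (p - 1)) * R ^ (n * (q - p) / (q * (p - 1))) *
      (normLp (q / p) f (ball x₀ R)) ^ (1 / (p - 1)) ≤ d := by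
    refine le_trans (le_add_of_nonneg_left ?_) hd.le
    exact mul_nonneg (mul_nonneg (Real.rpow_nonneg hr.le _) (Real.rpow_nonneg hR.le _))
      (Tail_nonneg _ _ hR.le)
  have h2 := Real.rpow_le_rpow (by positivity) h1 hp1.le
  refine le_trans (le_of_eq ?_) h2
  rw [Real.mul_rpow (by positivity) (by positivity), Real.mul_rpow (by positivity) (by positivity),
    ← Real.rpow_mul hr.le, ← Real.rpow_mul hR.le, ← Real.rpow_mul hN]
  congr 1
  · congr 2 <;> field_simp
  · rw [one_div, inv_mul_cancel₀ hp1.ne', Real.rpow_one]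

lemma lintegral_tail_le {n : ℕ} {p s q : ℝ} (hp : 1 < p) (hs0 : 0 < s) {u f : En n → ℝ}
    {x₀ : En n} {r R d : ℝ} (hr : 0 < r) (hR : 0 < R) (hut : MemTailSpace p s u)
    (hum : AEMeasurable u) (hd : dBound n p s q u f x₀ r R < d) :
    ∫⁻ y in (ball x₀ R)ᶜ, ENNReal.ofReal ((max (-u y) 0) ^ (p - 1) *
      ‖y - x₀‖ ^ (-((n : ℝ) + p * s))) ≤ ENNReal.ofReal (d ^ (p - 1) * r ^ (-p)) := by
  have hp1 : 0 < p - 1 := by linarith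
  have ha : 0 < (n : ℝ) + p * s := by positivity
  set a := (n : ℝ) + p * s with hadef
  set g : En n → ℝ := fun y => |nneg u y| ^ (p - 1) * ‖y - x₀‖ ^ (-a) with hg
  have hg0 : ∀ y, 0 ≤ g y := fun y => by simp only [hg]; positivity
  have hgm : AEMeasurable g := by
    have h1 : AEMeasurable (nneg u) := hum.neg.max aemeasurable_const
    have h2 : Measurable fun y : En n => ‖y - x₀‖ ^ (-a) :=
      ((measurable_id.sub_const x₀).norm).pow_const (-a)
    exact ((h1.norm).pow_const (p - 1)).mul h2.aemeasurable
  set c := (1 + ‖x₀‖) / R + 1 with hc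
  have hc0 : 0 < c := by positivity
  have hgi : IntegrableOn g (ball x₀ R)ᶜ := by
    have h1 := (hut.const_mul (c ^ a)).integrableOn (s := (ball x₀ R)ᶜ)
    refine h1.mono' hgm.restrict.aestronglyMeasurable ?_
    filter_upwards [ae_restrict_mem measurableSet_ball.compl] with y hy
    have hyR : R ≤ ‖y - x₀‖ := by simpa [dist_eq_norm] using hy
    have hy0 : 0 < ‖y - x₀‖ := by linarith
    rw [Real.norm_of_nonneg (hg0 y)]
    have h2 : |nneg u y| ≤ |u y| := by
      rw [nneg, abs_of_nonneg (le_max_right _ _)]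
      exact max_le (neg_le_abs _) (abs_nonneg _)
    have h3 : 1 + ‖y‖ ≤ c * ‖y - x₀‖ := by
      have h4 : ‖y‖ ≤ ‖y - x₀‖ + ‖x₀‖ := by simpa using norm_add_le (y - x₀) x₀
      have h5 : 1 + ‖x₀‖ ≤ (1 + ‖x₀‖) / R * ‖y - x₀‖ := by
        rw [div_mul_eq_mul_div, le_div_iff₀ hR]; gcongr
      rw [hc]; linarith
    have h6 : ‖y - x₀‖ ^ (-a) ≤ c ^ a * (1 + ‖y‖) ^ (-a) := by
      have h7 : (c * ‖y - x₀‖) ^ (-a) ≤ (1 + ‖y‖) ^ (-a) :=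
        Real.rpow_le_rpow_of_nonpos (by positivity) h3 (by linarith)
      rw [Real.mul_rpow hc0.le hy0.le] at h7
      calc ‖y - x₀‖ ^ (-a) = c ^ a * (c ^ (-a) * ‖y - x₀‖ ^ (-a)) := by
            rw [← mul_assoc, ← Real.rpow_add hc0, add_neg_cancel, Real.rpow_zero, one_mul]
        _ ≤ _ := by gcongr
    calc g y ≤ |u y| ^ (p - 1) * (c ^ a * (1 + ‖y‖) ^ (-a)) := by
          simp only [hg]; gcongr
      _ = _ := by ring
  have hI0 : 0 ≤ ∫ y in (ball x₀ R)ᶜ, g y := integral_nonneg hg0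
  have heq : ∫⁻ y in (ball x₀ R)ᶜ, ENNReal.ofReal ((max (-u y) 0) ^ (p - 1) * ‖y - x₀‖ ^ (-a)) =
      ENNReal.ofReal (∫ y in (ball x₀ R)ᶜ, g y) := by
    rw [ofReal_integral_eq_lintegral_ofReal hgi (ae_of_all _ hg0)]
    refine lintegral_congr fun y => ?_
    simp only [hg, nneg, abs_of_nonneg (le_max_right (-u y) 0)]
  rw [heq]
  refine ENNReal.ofReal_le_ofReal ?_
  set J := ∫ y in (ball x₀ R)ᶜ, g y with hJ
  have h1 : r ^ (p / (p - 1)) * R ^ (-(p / (p - 1))) * (R ^ p * J) ^ (1 / (p - 1)) ≤ d := by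
    refine le_trans (le_add_of_nonneg_right ?_) hd.le
    exact mul_nonneg (mul_nonneg (Real.rpow_nonneg hr.le _) (Real.rpow_nonneg hR.le _))
      (Real.rpow_nonneg (normLp_nonneg _ _ _) _)
  have h2 := Real.rpow_le_rpow (by positivity) h1 hp1.le
  rw [Real.mul_rpow (by positivity) (by positivity), Real.mul_rpow (by positivity) (by positivity),
    ← Real.rpow_mul hr.le, ← Real.rpow_mul hR.le, ← Real.rpow_mul (by positivity), one_div,
    inv_mul_cancel₀ hp1.ne', Real.rpow_one, neg_mul, div_mul_cancel₀ _ hp1.ne', mul_assoc,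
    ← mul_assoc (R ^ (-p)), ← Real.rpow_add hR, neg_add_cancel, Real.rpow_zero, one_mul] at h2
  calc J = (r ^ p * J) * r ^ (-p) := by
        rw [mul_right_comm, ← Real.rpow_add hr, add_neg_cancel, Real.rpow_zero, one_mul]
    _ ≤ _ := by gcongr

lemma Setting.nonlocal_le {n : ℕ} {p s C₁ C₂ Λ : ℝ} (S : Setting n p s C₁ C₂ Λ) (hn : 0 < n)
    (hp : 1 < p) (hs0 : 0 < s) (hs1 : s < 1) {q : ℝ} {u f φ : En n → ℝ} {x₀ : En n} {ρ r R d : ℝ}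
    (hr : 0 < r) (hr1 : r ≤ 1) (hrR : r < R) (hρ : ρ < r) (hum : AEMeasurable u)
    (hut : MemTailSpace p s u) (hu0 : ∀ x ∈ ball x₀ R, 0 ≤ u x)
    (hd : dBound n p s q u f x₀ r R < d)
    (hφ : Continuous φ) (hφ0 : ∀ x, 0 ≤ φ x) (hsupp : tsupport φ ⊆ closedBall x₀ ρ) :
    ∫⁻ x, ∫⁻ y, ENNReal.ofReal (Jp p (u x - u y) * (φ x - φ y) * S.K x y) ≤
      ENNReal.ofReal Λ * ∫⁻ z, ENNReal.ofReal (Jp p (u z.1 - u z.2) * (φ z.1 - φ z.2))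
        ∂(fracMeas n p s (ball x₀ r)) +
      ENNReal.ofReal (2 ^ p * Λ * (1 - ρ / r) ^ (-((n : ℝ) + p * s)) *
        (sphereConst n / (p * s) + 1) * r ^ (-p)) *
        ∫⁻ x in ball x₀ r, ENNReal.ofReal (φ x * (u x + d) ^ (p - 1)) := by
  have hp1 : 0 < p - 1 := by linarith
  have hΛ := S.hΛ
  have hΛ0 : 0 < Λ := by linarith
  have hR : 0 < R := hr.trans hrR
  have hps : 0 < p * s := by positivity
  have hd0 : 0 < d := (dBound_nonneg u f x₀ hr hR).trans_lt hd
  set B := ball x₀ r with hB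
  have hBm : MeasurableSet B := measurableSet_ball
  set a := (n : ℝ) + p * s with hadef
  have ha : 0 < a := by positivity
  have hδ : 0 < 1 - ρ / r := by rw [sub_pos, div_lt_one hr]; exact hρ
  set δ := 1 - ρ / r with hδdef
  have hφz : ∀ x, φ x ≠ 0 → ‖x - x₀‖ ≤ ρ := fun x hx => by
    simpa [dist_eq_norm] using hsupp (subset_tsupport _ hx)
  have hφB : ∀ x, x ∉ B → φ x = 0 := fun x hx => by
    by_contra h
    exact hx (by rw [hB, mem_ball, dist_eq_norm]; exact (hφz x h).trans_lt hρ)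
  set m : En n → ℝ := fun y => (max (-u y) 0) ^ (p - 1) with hm
  have hm0 : ∀ y, 0 ≤ m y := fun y => by simp only [hm]; positivity
  have hmm : AEMeasurable m := (hum.neg.max aemeasurable_const).pow_const _
  set F : En n × En n → ℝ≥0∞ := fun z =>
    ENNReal.ofReal (Jp p (u z.1 - u z.2) * (φ z.1 - φ z.2) * S.K z.1 z.2) with hF
  set c₁ := 2 ^ (p - 1) * Λ * δ ^ (-a) with hc₁
  have hc₁0 : 0 < c₁ := by positivity
  set g : En n × En n → ℝ≥0∞ := fun z => ENNReal.ofReal (c₁ * φ z.1) *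
    (ENNReal.ofReal (|u z.1| ^ (p - 1)) * ENNReal.ofReal (‖z.2 - x₀‖ ^ (-a)) +
      ENNReal.ofReal (m z.2 * ‖z.2 - x₀‖ ^ (-a))) with hg
  have hu1 : AEMeasurable (fun z : En n × En n => u z.1) (volume.prod volume) := hum.comp_fst
  have hu2 : AEMeasurable (fun z : En n × En n => u z.2) (volume.prod volume) := hum.comp_snd
  have hφ1 : Measurable (fun z : En n × En n => φ z.1) := hφ.measurable.comp measurable_fst
  have hφ2 : Measurable (fun z : En n × En n => φ z.2) := hφ.measurable.comp measurable_snd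
  have hJm : AEMeasurable (fun z : En n × En n => Jp p (u z.1 - u z.2) * (φ z.1 - φ z.2))
      (volume.prod volume) :=
    ((measurable_Jp p).comp_aemeasurable (hu1.sub hu2)).mul (hφ1.sub hφ2).aemeasurable
  have hFm : AEMeasurable F (volume.prod volume) :=
    (hJm.mul S.hKmeas.aemeasurable).ennreal_ofReal
  have hκm : Measurable fun y : En n => ‖y - x₀‖ ^ (-a) :=
    ((measurable_id.sub_const x₀).norm).pow_const (-a)
  have hgm : AEMeasurable g (volume.prod volume) := by
    refine (hφ1.const_mul c₁).ennreal_ofReal.aemeasurable.mul ?_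
    have h1 : AEMeasurable (fun z : En n × En n => ENNReal.ofReal (|u z.1| ^ (p - 1)) *
        ENNReal.ofReal (‖z.2 - x₀‖ ^ (-a))) (volume.prod volume) :=
      ((hu1.norm).pow_const (p - 1)).ennreal_ofReal.mul
        (hκm.comp measurable_snd).ennreal_ofReal.aemeasurable
    exact h1.add ((hmm.comp_snd).mul (hκm.comp measurable_snd).aemeasurable).ennreal_ofReal
  have hcross : ∀ x y, S.K x y ≤ Λ * ‖x - y‖ ^ (-a) → x ∈ B → y ∉ B → F (x, y) ≤ g (x, y) := by
    intro x y hK hx hy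
    simp only [hF, hg]
    rw [hφB y hy, sub_zero]
    by_cases hφx : φ x = 0
    · simp [hφx]
    have hux : 0 ≤ u x := hu0 x (ball_subset_ball hrR.le hx)
    have hyr : r ≤ ‖y - x₀‖ := by simpa [hB, dist_eq_norm] using hy
    have hxy : δ * ‖y - x₀‖ ≤ ‖x - y‖ := by
      have h1 : ‖y - x₀‖ ≤ ‖x - y‖ + ‖x - x₀‖ := by
        rw [norm_sub_rev x y]; exact norm_sub_le_norm_sub_add_norm_sub y x x₀
      have h2 := hφz x hφx
      have h3 : 0 ≤ ρ := (norm_nonneg _).trans h2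
      have h4 : ρ ≤ ρ / r * ‖y - x₀‖ := by
        rw [div_mul_eq_mul_div, le_div_iff₀ hr]; gcongr
      rw [hδdef]; linarith
    have hKb : S.K x y ≤ Λ * (δ ^ (-a) * ‖y - x₀‖ ^ (-a)) := by
      refine hK.trans ?_
      gcongr
      rw [← Real.mul_rpow hδ.le (norm_nonneg _)]
      exact Real.rpow_le_rpow_of_nonpos (mul_pos hδ (by linarith)) hxy (by linarith)
    have hJ := Jp_sub_le (b := u y) hp hux
    rw [← ENNReal.ofReal_mul (by positivity), ← ENNReal.ofReal_add (by positivity)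
      (mul_nonneg (hm0 y) (by positivity)), ← ENNReal.ofReal_mul (mul_nonneg hc₁0.le (hφ0 x))]
    refine ENNReal.ofReal_le_ofReal ?_
    have hK0 := S.hKnonneg x y
    have hφx0 := hφ0 x
    calc _ ≤ 2 ^ (p - 1) * (u x ^ (p - 1) + m y) * φ x * S.K x y := by gcongr
      _ ≤ 2 ^ (p - 1) * (u x ^ (p - 1) + m y) * φ x *
          (Λ * (δ ^ (-a) * ‖y - x₀‖ ^ (-a))) := by
          have := hm0 y
          gcongr
      _ = _ := by rw [hc₁, abs_of_nonneg hux]; ring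
  have hsymm : ∀ x y, F (x, y) = F (y, x) := by
    intro x y
    simp only [hF]
    rw [S.hKsymm x y, ← neg_sub (u y) (u x), Jp_neg]
    congr 1; ring
  have hpt : ∀ᵐ z ∂((volume : Measure (En n)).prod (volume : Measure (En n))), F z ≤
      (B ×ˢ B).indicator (fun z => ENNReal.ofReal Λ *
        (ENNReal.ofReal (Jp p (u z.1 - u z.2) * (φ z.1 - φ z.2)) *
          ENNReal.ofReal (‖z.1 - z.2‖ ^ (-a)))) z +
      ((B ×ˢ Bᶜ).indicator g z + (B ×ˢ Bᶜ).indicator g z.swap) := by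
    have hup := S.hKupper
    rw [Measure.volume_eq_prod] at hup
    filter_upwards [hup] with z hz
    obtain ⟨x, y⟩ := z
    simp only [Prod.swap_prod_mk] at hz ⊢
    by_cases hx : x ∈ B <;> by_cases hy : y ∈ B
    · simp only [indicator_of_mem (mk_mem_prod hx hy)]
      refine le_add_right ?_
      simp only [hF]
      rw [ENNReal.ofReal_mul' (S.hKnonneg x y), mul_left_comm, ← ENNReal.ofReal_mul hΛ0.le]
      gcongr
    · simp only [indicator_of_mem (mk_mem_prod hx (mem_compl hy))]
      exact le_add_left (le_add_right (hcross x y hz hx hy))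
    · simp only [indicator_of_mem (mk_mem_prod hy (mem_compl hx))]
      refine le_add_left (le_add_left ?_)
      rw [hsymm]
      exact hcross y x (by rwa [S.hKsymm, norm_sub_rev]) hy hx
    · simp [hF, hφB x hx, hφB y hy]
  have hgi : ∫⁻ z, (B ×ˢ Bᶜ).indicator g z ∂((volume : Measure (En n)).prod volume) ≤
      ENNReal.ofReal (c₁ * (sphereConst n / (p * s) + 1) * r ^ (-p)) *
        ∫⁻ x in B, ENNReal.ofReal (φ x * (u x + d) ^ (p - 1)) := by
    have hgm' : AEMeasurable g ((volume.restrict B).prod (volume.restrict Bᶜ)) := by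
      rw [Measure.prod_restrict]; exact hgm.restrict
    rw [lintegral_indicator (hBm.prod hBm.compl), ← Measure.prod_restrict,
      lintegral_prod _ hgm', ← lintegral_const_mul' _ _ ENNReal.ofReal_ne_top]
    have htail : ∫⁻ y in Bᶜ, ENNReal.ofReal (m y * ‖y - x₀‖ ^ (-a)) ≤
        ENNReal.ofReal (d ^ (p - 1) * r ^ (-p)) := by
      refine le_trans ?_ (lintegral_tail_le hp hs0 hr hR hut hum hd)
      refine (setLIntegral_le_lintegral _ _).trans ?_
      rw [← lintegral_indicator measurableSet_ball.compl]
      refine lintegral_mono fun y => ?_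
      by_cases hy : y ∈ ball x₀ R
      · have h1 : max (-u y) 0 = 0 := max_eq_right (by linarith [hu0 y hy])
        have h2 : m y = 0 := by simp only [hm]; rw [h1, Real.zero_rpow hp1.ne']
        simp [h2]
      · rw [indicator_of_mem (mem_compl hy)]
    refine setLIntegral_mono_ae' hBm (ae_of_all _ fun x hx => ?_)
    have hux : 0 ≤ u x := hu0 x (ball_subset_ball hrR.le hx)
    have hφx := hφ0 x
    have hSC := sphereConst_nonneg n
    have hrp : r ^ (-(p * s)) ≤ r ^ (-p) :=
      Real.rpow_le_rpow_of_exponent_ge hr hr1 (by nlinarith)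
    simp only [hg]
    rw [lintegral_const_mul' _ _ ENNReal.ofReal_ne_top,
      lintegral_add_left (hκm.ennreal_ofReal.const_mul _),
      lintegral_const_mul _ hκm.ennreal_ofReal, hadef, lintegral_compl_ball_rpow hn hps hr,
      ← hadef]
    calc _ ≤ ENNReal.ofReal (c₁ * φ x) * (ENNReal.ofReal (|u x| ^ (p - 1)) *
          ENNReal.ofReal (sphereConst n / (p * s) * r ^ (-(p * s))) +
          ENNReal.ofReal (d ^ (p - 1) * r ^ (-p))) := by gcongr
      _ = ENNReal.ofReal (c₁ * φ x * (|u x| ^ (p - 1) *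
          (sphereConst n / (p * s) * r ^ (-(p * s))) + d ^ (p - 1) * r ^ (-p))) := by
          rw [← ENNReal.ofReal_mul (by positivity), ← ENNReal.ofReal_add (by positivity)
            (by positivity), ← ENNReal.ofReal_mul (by positivity)]
      _ ≤ ENNReal.ofReal (c₁ * (sphereConst n / (p * s) + 1) * r ^ (-p) *
          (φ x * (u x + d) ^ (p - 1))) := by
          refine ENNReal.ofReal_le_ofReal ?_
          rw [abs_of_nonneg hux]
          calc _ ≤ c₁ * φ x * ((u x + d) ^ (p - 1) *
                (sphereConst n / (p * s) * r ^ (-p)) + (u x + d) ^ (p - 1) * r ^ (-p)) := by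
                gcongr
                · linarith
                · linarith
            _ = _ := by ring
      _ = _ := ENNReal.ofReal_mul (by positivity)
  calc ∫⁻ x, ∫⁻ y, ENNReal.ofReal (Jp p (u x - u y) * (φ x - φ y) * S.K x y)
      = ∫⁻ z, F z ∂((volume : Measure (En n)).prod volume) := (lintegral_prod _ hFm).symm
    _ ≤ _ := lintegral_mono_ae hpt
    _ = _ := by
      rw [lintegral_add_left', lintegral_add_left', lintegral_prod_swap,
        lintegral_indicator (hBm.prod hBm), lintegral_const_mul' _ _ ENNReal.ofReal_ne_top,
        ← Measure.prod_restrict, ← lintegral_fracMeas]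
      · exact hgm.indicator (hBm.prod hBm.compl)
      · refine AEMeasurable.indicator ?_ (hBm.prod hBm)
        exact (hJm.ennreal_ofReal.mul measurable_kernel.aemeasurable).const_mul _
    _ ≤ ENNReal.ofReal Λ * ∫⁻ z, ENNReal.ofReal (Jp p (u z.1 - u z.2) * (φ z.1 - φ z.2))
        ∂(fracMeas n p s B) + (ENNReal.ofReal (c₁ * (sphereConst n / (p * s) + 1) * r ^ (-p)) *
        (∫⁻ x in B, ENNReal.ofReal (φ x * (u x + d) ^ (p - 1))) +
        ENNReal.ofReal (c₁ * (sphereConst n / (p * s) + 1) * r ^ (-p)) *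
        ∫⁻ x in B, ENNReal.ofReal (φ x * (u x + d) ^ (p - 1))) := by gcongr
    _ = _ := by
      have hSC := sphereConst_nonneg n
      rw [← add_mul, ← ENNReal.ofReal_add (by positivity) (by positivity)]
      congr 3
      rw [hc₁, show p = (p - 1) + 1 by ring, Real.rpow_add_one (by norm_num)]
      ring_nf

lemma MemW1pLoc.aemeasurable_ball {n : ℕ} {p : ℝ} (hp : 0 < p) {u : En n → ℝ} {G : En n → En n}
    {Ω : Set (En n)} (h : MemW1pLoc p u G Ω) {x₀ : En n} {R : ℝ} (hR : ball x₀ R ⊆ Ω)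
    (hu0 : ∀ x ∈ ball x₀ R, 0 ≤ u x) : AEMeasurable u (volume.restrict (ball x₀ R)) := by
  have h1 : ball x₀ R = ⋃ k : ℕ, ball x₀ (R - 1 / ((k : ℝ) + 1)) := by
    ext x
    simp only [mem_ball, mem_iUnion]
    constructor
    · intro hx
      obtain ⟨k, hk⟩ := exists_nat_one_div_lt (sub_pos.2 hx)
      exact ⟨k, by linarith⟩
    · rintro ⟨k, hk⟩
      have : 0 < 1 / ((k : ℝ) + 1) := by positivity
      linarith
  rw [h1]
  refine aemeasurable_iUnion_iff.2 fun k => ?_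
  set ρ := R - 1 / ((k : ℝ) + 1) with hρ
  have hρR : ρ < R := by
    have : 0 < 1 / ((k : ℝ) + 1) := by positivity
    linarith
  have h2 := (h.2 (closedBall x₀ ρ) (isCompact_closedBall _ _)
    ((closedBall_subset_ball hρR).trans hR)).1.mono_set ball_subset_closedBall
  refine (h2.aestronglyMeasurable.aemeasurable.pow_const (1 / p)).congr ?_
  filter_upwards [ae_restrict_mem measurableSet_ball] with x hx
  have hx0 := hu0 x (ball_subset_ball hρR.le hx)
  rw [abs_of_nonneg hx0, ← Real.rpow_mul hx0, mul_one_div_cancel hp.ne', Real.rpow_one]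

lemma MemW1pLoc.memLp_ball {n : ℕ} {p : ℝ} (hp : 0 < p) {u : En n → ℝ} {G : En n → En n}
    {Ω : Set (En n)} (h : MemW1pLoc p u G Ω) {x₀ : En n} {ρ R : ℝ} (hρ : ρ < R)
    (hR : ball x₀ R ⊆ Ω) (hu0 : ∀ x ∈ ball x₀ R, 0 ≤ u x) :
    MemLp u (ENNReal.ofReal p) (volume.restrict (ball x₀ ρ)) := by
  have hm := (h.aemeasurable_ball hp hR hu0).mono_measure
    (Measure.restrict_mono (ball_subset_ball hρ.le) le_rfl)
  rw [← integrable_norm_rpow_iff hm.aestronglyMeasurable (by simpa using hp) (by simp),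
    ENNReal.toReal_ofReal hp.le]
  exact (h.2 (closedBall x₀ ρ) (isCompact_closedBall _ _)
    ((closedBall_subset_ball hρ).trans hR)).1.mono_set ball_subset_closedBall

lemma MemW1pLoc.integrable_smul_gradient {n : ℕ} {p : ℝ} (hp : 1 < p) {u : En n → ℝ}
    {G : En n → En n} {Ω : Set (En n)} (h : MemW1pLoc p u G Ω) {x₀ : En n} {R : ℝ}
    (hR : ball x₀ R ⊆ Ω) (hu0 : ∀ x ∈ ball x₀ R, 0 ≤ u x) {φ : En n → ℝ}
    (hφ : TestFun (ball x₀ R) φ) : Integrable fun x => u x • gradient φ x := by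
  have hT : IsCompact (tsupport φ) := hφ.2.1
  have hφ1 : ContDiff ℝ 1 φ := hφ.1.of_le (by exact_mod_cast le_top)
  have hgc := continuous_gradient hφ1
  have hsub : Function.support (fun x => u x • gradient φ x) ⊆ tsupport φ := by
    intro x hx
    by_contra hxT
    exact hx (by simp [gradient_eq_zero_of_notMem_tsupport hxT])
  rw [← integrableOn_iff_integrable_of_support_subset hsub]
  have hum : AEMeasurable u (volume.restrict (tsupport φ)) :=
    (h.aemeasurable_ball (by linarith) hR hu0).mono_measure (Measure.restrict_mono hφ.2.2 le_rfl)
  have hui : IntegrableOn u (tsupport φ) := by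
    have hb : IntegrableOn (fun x => 1 + |u x| ^ p) (tsupport φ) :=
      Integrable.add (integrableOn_const hT.measure_lt_top.ne)
        (h.2 _ hT (hφ.2.2.trans hR)).1
    refine hb.mono' hum.aestronglyMeasurable (ae_of_all _ fun x => ?_)
    rw [Real.norm_eq_abs]
    rcases le_total |u x| 1 with h1 | h1
    · have := Real.rpow_nonneg (abs_nonneg (u x)) p; linarith
    · have := Real.rpow_le_rpow_of_exponent_le h1 hp.le
      rw [Real.rpow_one] at this; linarith
  obtain ⟨M, hM⟩ := hT.exists_bound_of_continuousOn hgc.continuousOn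
  refine (hui.norm.mul_const M).mono' (hum.aestronglyMeasurable.smul hgc.aestronglyMeasurable) ?_
  filter_upwards [ae_restrict_mem hT.measurableSet] with x hx
  rw [norm_smul]
  exact mul_le_mul_of_nonneg_left (hM x hx) (norm_nonneg _)

/-- The supersolution inequality, with the nonlocal term localised to a ball. -/
lemma IsSupersol.energy_le {n : ℕ} {p s C₁ C₂ Λ : ℝ} {S : Setting n p s C₁ C₂ Λ} (hn : 0 < n)
    (hp : 1 < p) (hs0 : 0 < s) (hs1 : s < 1) {q : ℝ} {u f φ : En n → ℝ} {G : En n → En n}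
    {x₀ : En n} {ρ r R d : ℝ} (hsol : IsSupersol S f u G)
    (hr : 0 < r) (hr1 : r ≤ 1) (hrR : r < R) (hρ : ρ < r) (hR : ball x₀ R ⊆ S.Ω)
    (hu0 : ∀ x ∈ ball x₀ R, 0 ≤ u x) (hd : dBound n p s q u f x₀ r R < d)
    (hφ : ContDiff ℝ (⊤ : ℕ∞) φ) (hφ0 : ∀ x, 0 ≤ φ x) (hsupp : tsupport φ ⊆ closedBall x₀ ρ) :
    ENNReal.ofReal (- ∫ x, ⟪S.A x (G x), gradient φ x⟫) ≤
      (∫⁻ x in ball x₀ r, ENNReal.ofReal (|f x| * φ x)) +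
      (ENNReal.ofReal Λ * ∫⁻ z, ENNReal.ofReal (Jp p (u z.1 - u z.2) * (φ z.1 - φ z.2))
        ∂(fracMeas n p s (ball x₀ r)) +
      ENNReal.ofReal (2 ^ p * Λ * (1 - ρ / r) ^ (-((n : ℝ) + p * s)) *
        (sphereConst n / (p * s) + 1) * r ^ (-p)) *
        ∫⁻ x in ball x₀ r, ENNReal.ofReal (φ x * (u x + d) ^ (p - 1))) := by
  have hcs : HasCompactSupport φ :=
    (isCompact_closedBall x₀ ρ).of_isClosed_subset (isClosed_tsupport _) hsupp
  have hφR : TestFun (ball x₀ R) φ :=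
    ⟨hφ, hcs, hsupp.trans (closedBall_subset_ball (hρ.trans hrR))⟩
  have hφB : ∀ x, x ∉ ball x₀ r → φ x = 0 := fun x hx =>
    image_eq_zero_of_notMem_tsupport fun h => hx (closedBall_subset_ball hρ (hsupp h))
  have h1 := hsol.2.2 φ (hφR.mono hR) hφ0
  rw [Eform] at h1
  have h2 : - ∫ x, ⟪S.A x (G x), gradient φ x⟫ ≤ (∫ x, -(f x * φ x)) +
      ∫ x, ∫ y, Jp p (u x - u y) * (φ x - φ y) * S.K x y := by
    rw [integral_neg]; linarith
  refine (ENNReal.ofReal_le_ofReal h2).trans (ENNReal.ofReal_add_le.trans (add_le_add ?_ ?_))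
  · refine (ofReal_integral_le _).trans ?_
    rw [← lintegral_indicator measurableSet_ball]
    refine lintegral_mono fun x => ?_
    by_cases hx : x ∈ ball x₀ r
    · rw [indicator_of_mem hx]
      refine ENNReal.ofReal_le_ofReal ?_
      rw [← neg_mul]
      exact mul_le_mul_of_nonneg_right (neg_le_abs _) (hφ0 x)
    · simp [hφB x hx]
  · by_cases hm : AEStronglyMeasurable
      (fun x => ∫ y, Jp p (u x - u y) * (φ x - φ y) * S.K x y) volume
    · by_cases hne : ∃ x, φ x ≠ 0
      · have hu1 := hsol.1.aemeasurable_ball (by linarith) hR hu0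
        have hu2 := S.aemeasurable_compl_ball hp hs0 (hρ.trans hrR) hu1 hφR hφ0 hne hsupp
          (hsol.1.2 _ hcs (hφR.2.2.trans hR)).1 hm
        have hum : AEMeasurable u := by
          have := aemeasurable_union_iff.2 ⟨hu1, hu2⟩
          rwa [union_compl_self, Measure.restrict_univ] at this
        refine ((ofReal_integral_le _).trans (lintegral_mono fun x => ofReal_integral_le _)).trans ?_
        exact S.nonlocal_le hn hp hs0 hs1 hr hr1 hrR hρ hum hsol.2.1 hu0 hd hφ.continuous hφ0 hsupp
      · push Not at hne
        simp [hne]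
    · rw [integral_undef fun h => hm h.1, ENNReal.ofReal_zero]
      exact zero_le

section
open Filter

/-- `w` is a sequence of nonnegative smooth functions approximating `u` in `W^{1,p}` of a ball. -/
structure IsApprox {n : ℕ} (p : ℝ) (x₀ : En n) (r : ℝ) (u : En n → ℝ) (G : En n → En n)
    (w : ℕ → En n → ℝ) : Prop where
  aemeasurable : AEMeasurable u (volume.restrict (ball x₀ r))
  aestronglyMeasurable : AEStronglyMeasurable G (volume.restrict (ball x₀ r))
  nonneg : ∀ x ∈ ball x₀ r, 0 ≤ u x
  lintegral_ne_top : ∫⁻ x in ball x₀ r, ‖u x‖ₑ ^ p ≠ ⊤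
  lintegral_grad_ne_top : ∫⁻ x in ball x₀ r, ‖G x‖ₑ ^ p ≠ ⊤
  contDiff : ∀ k, ContDiff ℝ (⊤ : ℕ∞) (w k)
  nonneg_approx : ∀ k x, 0 ≤ w k x
  tendsto : Tendsto (fun k => ∫⁻ x in ball x₀ r, ‖w k x - u x‖ₑ ^ p) atTop (𝓝 0)
  tendsto_grad : Tendsto (fun k => ∫⁻ x in ball x₀ r, ‖gradient (w k) x - G x‖ₑ ^ p) atTop (𝓝 0)
  ae_tendsto : ∀ᵐ x ∂(volume.restrict (ball x₀ r)), Tendsto (fun k => w k x) atTop (𝓝 (u x))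

lemma IsApprox.contDiff_one {n : ℕ} {p : ℝ} {x₀ : En n} {r : ℝ} {u : En n → ℝ} {G : En n → En n}
    {w : ℕ → En n → ℝ} (h : IsApprox p x₀ r u G w) (k : ℕ) : ContDiff ℝ 1 (w k) :=
  (h.contDiff k).of_le (by exact_mod_cast le_top)

lemma abs_rpow_neg_sub_le {β d a b : ℝ} (hβ : 0 < β) (hd : 0 < d) (ha : d ≤ a) (hb : d ≤ b) :
    |a ^ (-β) - b ^ (-β)| ≤ β * d ^ (-β - 1) * |a - b| := by
  have hder : ∀ x ∈ Ici d, HasDerivWithinAt (fun x : ℝ => x ^ (-β)) (-β * x ^ (-β - 1)) (Ici d) x :=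
    fun x hx => (Real.hasDerivAt_rpow_const
      (Or.inl (hd.trans_le hx).ne')).hasDerivWithinAt
  have := Convex.norm_image_sub_le_of_norm_hasDerivWithin_le (C := β * d ^ (-β - 1)) hder
    (fun x hx => by
      have hx : d ≤ x := hx
      have hx0 : 0 < x := hd.trans_le hx
      rw [norm_mul, norm_neg, Real.norm_of_nonneg hβ.le,
        Real.norm_of_nonneg (Real.rpow_nonneg hx0.le _)]
      exact mul_le_mul_of_nonneg_left (Real.rpow_le_rpow_of_nonpos hd hx (by linarith)) hβ.le)
    (convex_Ici d) hb ha
  simpa using this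

lemma rpow_neg_le_of_le {β d a : ℝ} (hβ : 0 ≤ β) (hd : 0 < d) (ha : d ≤ a) :
    a ^ (-β) ≤ d ^ (-β) := Real.rpow_le_rpow_of_nonpos hd ha (by linarith)

lemma gradient_mul_rpow {n : ℕ} {ζ w : En n → ℝ} {d e : ℝ} (hζ : ContDiff ℝ 1 ζ)
    (hw : ContDiff ℝ 1 w) (hd : 0 < d) (hw0 : ∀ x, 0 ≤ w x) (x : En n) :
    gradient (fun y => ζ y * (w y + d) ^ e) x =
      (w x + d) ^ e • gradient ζ x + (e * ζ x * (w x + d) ^ (e - 1)) • gradient w x := by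
  have hpos : w x + d ≠ 0 := by have := hw0 x; positivity
  have h1 : HasFDerivAt (fun y => w y + d) (fderiv ℝ w x) x :=
    ((hw.differentiable (by simp)) x).hasFDerivAt.add_const d
  have h2 := h1.rpow_const (p := e) (Or.inl hpos)
  have h3 : HasFDerivAt (fun y => ζ y * (w y + d) ^ e) _ x :=
    ((hζ.differentiable (by simp)) x).hasFDerivAt.mul h2
  rw [gradient, h3.fderiv, map_add, map_smulₛₗ, map_smulₛₗ, map_smulₛₗ, add_comm, gradient,
    gradient, smul_smul]
  simp only [conj_trivial]
  congr 2
  ring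

lemma contDiff_mul_rpow {n : ℕ} {m : WithTop ℕ∞} {ζ w : En n → ℝ} {d e : ℝ} (hζ : ContDiff ℝ m ζ)
    (hw : ContDiff ℝ m w) (hd : 0 < d) (hw0 : ∀ x, 0 ≤ w x) :
    ContDiff ℝ m fun y => ζ y * (w y + d) ^ e :=
  hζ.mul ((hw.add contDiff_const).rpow_const_of_ne fun x => by have := hw0 x; positivity)

/-- Strong convergence of the nonlocal differences of the approximating test functions. -/
lemma IsApprox.tendsto_nonlocal {n : ℕ} (hn : 0 < n) {p s : ℝ} (hp : 1 < p) (hs1 : s < 1)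
    {x₀ : En n} {r : ℝ} (hr : 0 < r) {u : En n → ℝ} {G : En n → En n} {w : ℕ → En n → ℝ}
    (h : IsApprox p x₀ r u G w) {ζ : En n → ℝ} (hζ : ContDiff ℝ 1 ζ) {M : ℝ}
    (hM : ∀ x, |ζ x| ≤ M) (hζg : ∫⁻ x in ball x₀ r, ‖gradient ζ x‖ₑ ^ p ≠ ⊤)
    {d β : ℝ} (hd : 0 < d) (hβ : 0 < β) :
    Tendsto (fun k => ∫⁻ z, ‖u z.1 - u z.2‖ₑ ^ (p - 1) *
      ‖(ζ z.1 * (w k z.1 + d) ^ (-β) - ζ z.2 * (w k z.2 + d) ^ (-β)) -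
        (ζ z.1 * (u z.1 + d) ^ (-β) - ζ z.2 * (u z.2 + d) ^ (-β))‖ₑ
        ∂(fracMeas n p s (ball x₀ r))) atTop (𝓝 0) := by
  have hp0 : 0 < p := by linarith
  have hp1 : 0 < p - 1 := by linarith
  set ν := fracMeas n p s (ball x₀ r) with hν
  have hM0 : 0 ≤ M := (abs_nonneg _).trans (hM x₀)
  have hu1 : AEMeasurable (fun z : En n × En n => u z.1) ν := h.aemeasurable.fracMeas_fst
  have hu2 : AEMeasurable (fun z : En n × En n => u z.2) ν := h.aemeasurable.fracMeas_snd
  have hζ1 : Measurable (fun z : En n × En n => ζ z.1) := hζ.continuous.measurable.comp measurable_fst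
  have hζ2 : Measurable (fun z : En n × En n => ζ z.2) := hζ.continuous.measurable.comp measurable_snd
  have hw1 : ∀ k, Measurable (fun z : En n × En n => w k z.1) := fun k =>
    (h.contDiff k).continuous.measurable.comp measurable_fst
  have hw2 : ∀ k, Measurable (fun z : En n × En n => w k z.2) := fun k =>
    (h.contDiff k).continuous.measurable.comp measurable_snd
  set H : En n × En n → ℝ≥0∞ := fun z => ‖u z.1 - u z.2‖ₑ with hH
  have hHm : AEMeasurable H ν := (hu1.sub hu2).enorm
  have hHfin : ∫⁻ z, H z ^ p ∂ν ≠ ⊤ := lintegral_fracMeas_lt_top hn hp.le hs1 hr h.contDiff_one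
    h.aestronglyMeasurable h.lintegral_grad_ne_top h.tendsto_grad h.ae_tendsto
  set Z : En n × En n → ℝ≥0∞ := fun z => ‖ζ z.1 - ζ z.2‖ₑ with hZ
  have hZm : AEMeasurable Z ν := (hζ1.sub hζ2).enorm.aemeasurable
  have hZfin : ∫⁻ z, Z z ^ p ∂ν ≠ ⊤ :=
    ne_top_of_le_ne_top (ENNReal.mul_ne_top ENNReal.ofReal_ne_top hζg)
      (lintegral_fracMeas_smooth_le hn hp.le hs1 hr hζ)
  set c₁ := M * (β * d ^ (-β - 1)) with hc₁
  set c₂ := d ^ (-β) with hc₂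
  have hc₁0 : 0 ≤ c₁ := by positivity
  have hc₂0 : 0 ≤ c₂ := by positivity
  have hdiff : ∀ a b x y : ℝ, |x| ≤ M → d ≤ a → d ≤ b →
      |x * a ^ (-β) - y * b ^ (-β)| ≤ c₁ * |a - b| + c₂ * |x - y| := by
    intro a b x y hx ha hb
    have h1 : x * a ^ (-β) - y * b ^ (-β) =
        x * (a ^ (-β) - b ^ (-β)) + (x - y) * b ^ (-β) := by ring
    rw [h1]
    refine (abs_add_le _ _).trans ?_
    rw [abs_mul, abs_mul, abs_of_nonneg (Real.rpow_nonneg (hd.le.trans hb) _), hc₁, mul_assoc M,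
      mul_comm c₂]
    gcongr
    · exact abs_rpow_neg_sub_le hβ hd ha hb
    · exact rpow_neg_le_of_le hβ.le hd hb
  set D : En n × En n → ℝ≥0∞ := fun z => H z ^ (p - 1) *
    (ENNReal.ofReal (2 * c₁) * H z + ENNReal.ofReal (2 * c₂) * Z z) with hD
  set E : ℕ → En n × En n → ℝ≥0∞ := fun k z => ENNReal.ofReal c₁ * (H z ^ (p - 1) *
    ‖(w k z.1 - w k z.2) - (u z.1 - u z.2)‖ₑ) with hE
  have hWm : ∀ k, AEMeasurable (fun z : En n × En n =>
      ‖(w k z.1 - w k z.2) - (u z.1 - u z.2)‖ₑ) ν := fun k =>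
    (((hw1 k).sub (hw2 k)).aemeasurable.sub (hu1.sub hu2)).enorm
  have hu0 : ∀ᵐ z ∂ν, 0 ≤ u z.1 ∧ 0 ≤ u z.2 := by
    have h0 : ∀ᵐ x ∂(volume.restrict (ball x₀ r)), 0 ≤ u x := by
      filter_upwards [ae_restrict_mem measurableSet_ball] with x hx using h.nonneg x hx
    exact (ae_fracMeas_fst h0).and (ae_fracMeas_snd h0)
  refine tendsto_lintegral_zero_of_le_add (D := D) (E := E) (fun k => ?_) (fun k => ?_) ?_
    (fun k => ?_) ?_ ?_ ?_
  · refine (hHm.pow_const _).mul (AEMeasurable.enorm (AEMeasurable.sub ?_ ?_))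
    · exact ((hζ1.mul (((hw1 k).add_const d).pow_const _)).sub
        (hζ2.mul (((hw2 k).add_const d).pow_const _))).aemeasurable
    · exact (hζ1.aemeasurable.mul ((hu1.add_const d).pow_const _)).sub
        (hζ2.aemeasurable.mul ((hu2.add_const d).pow_const _))
  · exact ((hHm.pow_const _).mul (hWm k)).const_mul _
  · exact (hHm.pow_const _).mul ((hHm.const_mul _).add (hZm.const_mul _))
  · filter_upwards [hu0] with z hz
    have h1 := hdiff (w k z.1 + d) (w k z.2 + d) (ζ z.1) (ζ z.2) (hM _)
      (by linarith [h.nonneg_approx k z.1]) (by linarith [h.nonneg_approx k z.2])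
    have h2 := hdiff (u z.1 + d) (u z.2 + d) (ζ z.1) (ζ z.2) (hM _)
      (by linarith [hz.1]) (by linarith [hz.2])
    rw [add_sub_add_right_eq_sub] at h1 h2
    have h3 : |w k z.1 - w k z.2| ≤ |(w k z.1 - w k z.2) - (u z.1 - u z.2)| +
        |u z.1 - u z.2| := by
      have := abs_add_le ((w k z.1 - w k z.2) - (u z.1 - u z.2)) (u z.1 - u z.2)
      rwa [sub_add_cancel] at this
    have h4 : |(ζ z.1 * (w k z.1 + d) ^ (-β) - ζ z.2 * (w k z.2 + d) ^ (-β)) -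
        (ζ z.1 * (u z.1 + d) ^ (-β) - ζ z.2 * (u z.2 + d) ^ (-β))| ≤
        2 * c₁ * |u z.1 - u z.2| + 2 * c₂ * |ζ z.1 - ζ z.2| +
        c₁ * |(w k z.1 - w k z.2) - (u z.1 - u z.2)| := by
      have h5 := abs_sub (ζ z.1 * (w k z.1 + d) ^ (-β) - ζ z.2 * (w k z.2 + d) ^ (-β))
        (ζ z.1 * (u z.1 + d) ^ (-β) - ζ z.2 * (u z.2 + d) ^ (-β))
      have h6 := mul_le_mul_of_nonneg_left h3 hc₁0
      linarith
    have h7 := ENNReal.ofReal_le_ofReal h4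
    rw [ENNReal.ofReal_add (by positivity) (by positivity),
      ENNReal.ofReal_add (by positivity) (by positivity),
      ENNReal.ofReal_mul (by positivity), ENNReal.ofReal_mul (p := 2 * c₂) (by positivity),
      ENNReal.ofReal_mul (p := c₁) hc₁0] at h7
    simp only [hD, hE, hH, hZ]
    simp only [← Real.norm_eq_abs, ofReal_norm] at h7
    calc _ ≤ ‖u z.1 - u z.2‖ₑ ^ (p - 1) * (ENNReal.ofReal (2 * c₁) * ‖u z.1 - u z.2‖ₑ +
          ENNReal.ofReal (2 * c₂) * ‖ζ z.1 - ζ z.2‖ₑ +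
          ENNReal.ofReal c₁ * ‖(w k z.1 - w k z.2) - (u z.1 - u z.2)‖ₑ) := by gcongr
      _ = _ := by ring
  · refine ne_top_of_le_ne_top (b := ∫⁻ z, (ENNReal.ofReal (2 * c₁) * H z ^ p +
      ENNReal.ofReal (2 * c₂) * (H z ^ p + Z z ^ p)) ∂ν) ?_ (lintegral_mono fun z => ?_)
    · rw [lintegral_add_left' ((hHm.pow_const _).const_mul _),
        lintegral_const_mul' _ _ ENNReal.ofReal_ne_top,
        lintegral_const_mul' _ _ ENNReal.ofReal_ne_top, lintegral_add_left' (hHm.pow_const _)]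
      exact ENNReal.add_ne_top.2 ⟨ENNReal.mul_ne_top ENNReal.ofReal_ne_top hHfin,
        ENNReal.mul_ne_top ENNReal.ofReal_ne_top (ENNReal.add_ne_top.2 ⟨hHfin, hZfin⟩)⟩
    · have hmul : ∀ x : ℝ≥0∞, x ^ (p - 1) * x = x ^ p := fun x => by
        nth_rewrite 2 [← ENNReal.rpow_one x]
        rw [← ENNReal.rpow_add_of_nonneg _ _ hp1.le zero_le_one, sub_add_cancel]
      have h1 : H z ^ (p - 1) * Z z ≤ H z ^ p + Z z ^ p := by
        rcases le_total (H z) (Z z) with h1 | h1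
        · calc _ ≤ Z z ^ (p - 1) * Z z := by gcongr
            _ = Z z ^ p := hmul _
            _ ≤ _ := le_add_self
        · calc _ ≤ H z ^ (p - 1) * H z := by gcongr
            _ = H z ^ p := hmul _
            _ ≤ _ := le_self_add
      simp only [hD]
      calc _ = ENNReal.ofReal (2 * c₁) * (H z ^ (p - 1) * H z) +
            ENNReal.ofReal (2 * c₂) * (H z ^ (p - 1) * Z z) := by ring
        _ ≤ _ := by rw [hmul]; gcongr
  · have h1 := tendsto_lintegral_mul_zero hp hHm hWm hHfin
      (tendsto_fracMeas hn hp.le hs1 hr h.contDiff_one h.aestronglyMeasurable h.tendsto_grad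
        h.ae_tendsto)
    have h2 := ENNReal.Tendsto.const_mul (a := ENNReal.ofReal c₁) h1
      (Or.inr ENNReal.ofReal_ne_top)
    simp only [hE]
    simpa [lintegral_const_mul' _ _ (ENNReal.ofReal_ne_top (r := c₁))] using h2
  · filter_upwards [hu0, ae_fracMeas_fst h.ae_tendsto, ae_fracMeas_snd h.ae_tendsto] with z hz h1 h2
    have h3 : Tendsto (fun k => (ζ z.1 * (w k z.1 + d) ^ (-β) - ζ z.2 * (w k z.2 + d) ^ (-β)) -
        (ζ z.1 * (u z.1 + d) ^ (-β) - ζ z.2 * (u z.2 + d) ^ (-β))) atTop (𝓝 0) := by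
      have h4 := (h1.add_const d).rpow_const (p := -β) (Or.inl (by linarith [hz.1]))
      have h5 := (h2.add_const d).rpow_const (p := -β) (Or.inl (by linarith [hz.2]))
      have h6 := ((h4.const_mul (ζ z.1)).sub (h5.const_mul (ζ z.2))).sub_const
        (ζ z.1 * (u z.1 + d) ^ (-β) - ζ z.2 * (u z.2 + d) ^ (-β))
      rwa [sub_self] at h6
    have h7 := h3.enorm
    rw [enorm_zero] at h7
    have h8 := ENNReal.Tendsto.const_mul (a := ‖u z.1 - u z.2‖ₑ ^ (p - 1)) h7
      (Or.inr (ENNReal.rpow_ne_top_of_nonneg hp1.le enorm_ne_top))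
    rwa [mul_zero] at h8

end

section
open Filter

/-- Convergence of the local energy term for the approximating test functions. -/
lemma IsApprox.tendsto_integral_inner {n : ℕ} {p : ℝ} (hp : 1 < p)
    {x₀ : En n} {r : ℝ} {u : En n → ℝ} {G : En n → En n} {w : ℕ → En n → ℝ}
    (h : IsApprox p x₀ r u G w) {ζ : En n → ℝ} (hζ : ContDiff ℝ (⊤ : ℕ∞) ζ) {M L : ℝ}
    (hM : ∀ x, |ζ x| ≤ M) (hL : ∀ x, ‖gradient ζ x‖ ≤ L) (hsupp : tsupport ζ ⊆ ball x₀ r)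
    {d β c : ℝ} (hd : 0 < d) (hβ : 0 < β) {a : En n → En n} (hc : 0 ≤ c)
    (ha : AEStronglyMeasurable a (volume.restrict (ball x₀ r)))
    (haG : ∀ᵐ x ∂(volume.restrict (ball x₀ r)), ‖a x‖ ≤ c * ‖G x‖ ^ (p - 1)) :
    Tendsto (fun k => ∫ x, ⟪a x, gradient (fun y => ζ y * (w k y + d) ^ (-β)) x⟫) atTop
      (𝓝 (∫ x in ball x₀ r, ⟪a x, (u x + d) ^ (-β) • gradient ζ x +
        (-β * ζ x * (u x + d) ^ (-β - 1)) • G x⟫)) := by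
  have hp0 : 0 < p := by linarith
  have hp1 : 0 < p - 1 := by linarith
  have hM0 : 0 ≤ M := (abs_nonneg _).trans (hM x₀)
  have hL0 : 0 ≤ L := (norm_nonneg _).trans (hL x₀)
  have hζ1 : ContDiff ℝ 1 ζ := hζ.of_le (by exact_mod_cast le_top)
  set B := ball x₀ r with hB
  set c₁ := d ^ (-β) with hc₁
  set c₂ := d ^ (-β - 1) with hc₂
  have hc₁0 : 0 ≤ c₁ := by positivity
  have hc₂0 : 0 ≤ c₂ := by positivity
  have hu0 : ∀ᵐ x ∂(volume.restrict B), 0 ≤ u x := by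
    filter_upwards [ae_restrict_mem measurableSet_ball] with x hx using h.nonneg x hx
  have hgrad : ∀ k x, gradient (fun y => ζ y * (w k y + d) ^ (-β)) x =
      (w k x + d) ^ (-β) • gradient ζ x + (-β * ζ x * (w k x + d) ^ (-β - 1)) •
        gradient (w k) x := fun k x =>
    gradient_mul_rpow hζ1 (h.contDiff_one k) hd (h.nonneg_approx k) x
  have hgz : ∀ k x, x ∉ B → gradient (fun y => ζ y * (w k y + d) ^ (-β)) x = 0 := fun k x hx =>
    gradient_eq_zero_of_notMem_tsupport fun h' => hx (hsupp (tsupport_mul_subset_left h'))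
  have hset : ∀ k, ∫ x, ⟪a x, gradient (fun y => ζ y * (w k y + d) ^ (-β)) x⟫ =
      ∫ x in B, ⟪a x, gradient (fun y => ζ y * (w k y + d) ^ (-β)) x⟫ := fun k => by
    rw [setIntegral_eq_integral_of_forall_compl_eq_zero]
    intro x hx
    rw [hgz k x hx, inner_zero_right]
  simp only [hset]
  have hone : ∀ {x b : ℝ}, 0 ≤ x → 0 ≤ b → (x + d) ^ (-b) ≤ d ^ (-b) := fun hx hb =>
    rpow_neg_le_of_le hb hd (by linarith)
  have hone₂ : ∀ {x : ℝ}, 0 ≤ x → (x + d) ^ (-β - 1) ≤ c₂ := fun {x} hx => by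
    have := hone (b := β + 1) hx (by linarith)
    rwa [neg_add, ← sub_eq_add_neg] at this
  have hum := h.aemeasurable
  have hGm := h.aestronglyMeasurable
  have hgζm : Measurable (gradient ζ) := (continuous_gradient hζ1).measurable
  have hΦm : AEStronglyMeasurable (fun x => ⟪a x, (u x + d) ^ (-β) • gradient ζ x +
      (-β * ζ x * (u x + d) ^ (-β - 1)) • G x⟫) (volume.restrict B) := by
    refine ha.inner ((((hum.add_const d).pow_const _).aestronglyMeasurable.smul
      hgζm.aestronglyMeasurable).add ?_)
    refine AEStronglyMeasurable.smul (f := fun x => -β * ζ x * (u x + d) ^ (-β - 1)) ?_ hGm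
    exact ((hζ.continuous.measurable.aemeasurable.const_mul _).mul
      ((hum.add_const d).pow_const _)).aestronglyMeasurable
  have hHm : AEMeasurable (fun x => ‖G x‖ₑ) (volume.restrict B) := hGm.enorm
  have hmul : ∀ x : ℝ≥0∞, x ^ (p - 1) * x = x ^ p := fun x => by
    nth_rewrite 2 [← ENNReal.rpow_one x]
    rw [← ENNReal.rpow_add_of_nonneg _ _ hp1.le zero_le_one, sub_add_cancel]
  have hfinB : volume B ≠ ⊤ := measure_ball_lt_top.ne
  have hG1 : ∫⁻ x in B, ‖G x‖ₑ ^ (p - 1) ≠ ⊤ := by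
    refine ne_top_of_le_ne_top (b := ∫⁻ x in B, (1 + ‖G x‖ₑ ^ p)) ?_
      (lintegral_mono fun x => ?_)
    · rw [lintegral_add_left measurable_const, setLIntegral_const, one_mul]
      exact ENNReal.add_ne_top.2 ⟨hfinB, h.lintegral_grad_ne_top⟩
    · rcases le_total ‖G x‖ₑ 1 with h1 | h1
      · exact (ENNReal.rpow_le_one h1 hp1.le).trans le_self_add
      · exact (ENNReal.rpow_le_rpow_of_exponent_le h1 (by linarith)).trans le_add_self
  have haG' : ∀ᵐ x ∂(volume.restrict B), ‖a x‖ₑ ≤ ENNReal.ofReal c * ‖G x‖ₑ ^ (p - 1) := by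
    filter_upwards [haG] with x hx
    have := ENNReal.ofReal_le_ofReal hx
    rwa [ENNReal.ofReal_mul hc, ← ENNReal.ofReal_rpow_of_nonneg (norm_nonneg _) hp1.le,
      ofReal_norm, ofReal_norm] at this
  set P : ℕ → En n → ℝ≥0∞ := fun k x => ‖(w k x + d) ^ (-β) - (u x + d) ^ (-β)‖ₑ *
      ENNReal.ofReal L + ENNReal.ofReal (β * M) * (‖(w k x + d) ^ (-β - 1) -
      (u x + d) ^ (-β - 1)‖ₑ * ‖G x‖ₑ) with hP
  set Q : ℕ → En n → ℝ≥0∞ := fun k x => ‖gradient (w k) x - G x‖ₑ with hQ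
  have hwm : ∀ k, Measurable (w k) := fun k => (h.contDiff k).continuous.measurable
  have hPm : ∀ k, AEMeasurable (P k) (volume.restrict B) := fun k => by
    have h1 : ∀ e : ℝ, AEMeasurable (fun x => ‖(w k x + d) ^ e - (u x + d) ^ e‖ₑ)
        (volume.restrict B) := fun e =>
      (((hwm k).add_const d).pow_const _ |>.aemeasurable.sub
        ((hum.add_const d).pow_const _)).enorm
    exact ((h1 _).mul_const _).add (((h1 _).mul hHm).const_mul _)
  have hQm : ∀ k, AEMeasurable (Q k) (volume.restrict B) := fun k =>
    ((continuous_gradient (h.contDiff_one k)).aestronglyMeasurable.sub hGm).enorm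
  have hbd : ∀ k, ∀ᵐ x ∂(volume.restrict B),
      ‖⟪a x, gradient (fun y => ζ y * (w k y + d) ^ (-β)) x⟫ -
        ⟪a x, (u x + d) ^ (-β) • gradient ζ x + (-β * ζ x * (u x + d) ^ (-β - 1)) • G x⟫‖ₑ ≤
      ENNReal.ofReal c * (‖G x‖ₑ ^ (p - 1) * P k x) +
        ENNReal.ofReal (c * (β * M * c₂)) * (‖G x‖ₑ ^ (p - 1) * Q k x) := by
    intro k
    filter_upwards [haG', hu0] with x hx hux
    rw [← inner_sub_right, hgrad]
    have h1 : (w k x + d) ^ (-β) • gradient ζ x + (-β * ζ x * (w k x + d) ^ (-β - 1)) •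
        gradient (w k) x - ((u x + d) ^ (-β) • gradient ζ x +
        (-β * ζ x * (u x + d) ^ (-β - 1)) • G x) =
        ((w k x + d) ^ (-β) - (u x + d) ^ (-β)) • gradient ζ x +
        (-β * ζ x) • (((w k x + d) ^ (-β - 1) - (u x + d) ^ (-β - 1)) • G x) +
        (-β * ζ x * (w k x + d) ^ (-β - 1)) • (gradient (w k) x - G x) := by
      module
    have h2 : ‖-β * ζ x‖ₑ ≤ ENNReal.ofReal (β * M) := by
      rw [← ofReal_norm, norm_mul, norm_neg, Real.norm_of_nonneg hβ.le, Real.norm_eq_abs]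
      exact ENNReal.ofReal_le_ofReal (mul_le_mul_of_nonneg_left (hM x) hβ.le)
    have h3 : ‖-β * ζ x * (w k x + d) ^ (-β - 1)‖ₑ ≤ ENNReal.ofReal (β * M * c₂) := by
      have hw := h.nonneg_approx k x
      rw [← ofReal_norm, norm_mul, norm_mul, norm_neg, Real.norm_of_nonneg hβ.le,
        Real.norm_eq_abs, Real.norm_of_nonneg (Real.rpow_nonneg (by positivity) _)]
      exact ENNReal.ofReal_le_ofReal (mul_le_mul (mul_le_mul_of_nonneg_left (hM x) hβ.le)
        (hone₂ hw) (Real.rpow_nonneg (by positivity) _) (by positivity))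
    have h4 : ‖gradient ζ x‖ₑ ≤ ENNReal.ofReal L := by
      rw [← ofReal_norm]; exact ENNReal.ofReal_le_ofReal (hL x)
    have h5 : ∀ v₁ v₂ : En n, ‖⟪v₁, v₂⟫‖ₑ ≤ ‖v₁‖ₑ * ‖v₂‖ₑ := fun v₁ v₂ => by
      rw [← ofReal_norm, ← ofReal_norm, ← ofReal_norm, ← ENNReal.ofReal_mul (norm_nonneg _)]
      exact ENNReal.ofReal_le_ofReal (norm_inner_le_norm v₁ v₂)
    calc _ ≤ ‖a x‖ₑ * ‖((w k x + d) ^ (-β) - (u x + d) ^ (-β)) • gradient ζ x +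
        (-β * ζ x) • (((w k x + d) ^ (-β - 1) - (u x + d) ^ (-β - 1)) • G x) +
        (-β * ζ x * (w k x + d) ^ (-β - 1)) • (gradient (w k) x - G x)‖ₑ := by
          rw [h1]; exact h5 _ _
      _ ≤ (ENNReal.ofReal c * ‖G x‖ₑ ^ (p - 1)) * (P k x +
          ENNReal.ofReal (β * M * c₂) * Q k x) := by
          gcongr
          refine (enorm_add_le _ _).trans (add_le_add ((enorm_add_le _ _).trans
            (add_le_add ?_ ?_)) ?_)
          · rw [enorm_smul]; gcongr
          · rw [enorm_smul, enorm_smul]; gcongr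
          · rw [enorm_smul]; gcongr
      _ = _ := by rw [ENNReal.ofReal_mul hc]; ring
  have hai : Integrable a (volume.restrict B) := by
    refine ⟨ha, lt_top_iff_ne_top.2 (ne_top_of_le_ne_top ?_ (lintegral_mono_ae haG'))⟩
    rw [lintegral_const_mul' _ _ ENNReal.ofReal_ne_top]
    exact ENNReal.mul_ne_top ENNReal.ofReal_ne_top hG1
  have hFi : ∀ k, Integrable (fun x => ⟪a x, gradient (fun y => ζ y * (w k y + d) ^ (-β)) x⟫)
      (volume.restrict B) := by
    intro k
    have hcont := continuous_gradient (contDiff_mul_rpow (e := -β) hζ1 (h.contDiff_one k) hd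
      (h.nonneg_approx k))
    obtain ⟨b, hb⟩ := (isCompact_closedBall x₀ r).exists_bound_of_continuousOn hcont.continuousOn
    refine (hai.norm.mul_const b).mono (ha.inner hcont.aestronglyMeasurable) ?_
    filter_upwards [ae_restrict_mem measurableSet_ball] with x hx
    refine (norm_inner_le_norm _ _).trans (le_trans ?_ (le_abs_self _))
    exact mul_le_mul_of_nonneg_left (hb x (ball_subset_closedBall hx)) (norm_nonneg _)
  refine tendsto_integral_of_L1 _ hΦm (Eventually.of_forall hFi) ?_
  have hlimP : Tendsto (fun k => ∫⁻ x in B, ‖G x‖ₑ ^ (p - 1) * P k x) atTop (𝓝 0) := by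
    refine tendsto_lintegral_zero_of_le_add (E := fun _ _ => 0)
      (D := fun x => ENNReal.ofReal (c₁ + c₁) * ENNReal.ofReal L * ‖G x‖ₑ ^ (p - 1) +
        ENNReal.ofReal (β * M) * ENNReal.ofReal (c₂ + c₂) * ‖G x‖ₑ ^ p)
      (fun k => (hHm.pow_const _).mul (hPm k)) (fun _ => aemeasurable_const)
      (((hHm.pow_const _).const_mul _).add ((hHm.pow_const _).const_mul _)) (fun k => ?_) ?_
      (by simp) ?_
    · filter_upwards [hu0] with x hux
      have hw := h.nonneg_approx k x
      have habs : ∀ {b₁ b₂ C : ℝ}, 0 ≤ b₁ → 0 ≤ b₂ → b₁ ≤ C → b₂ ≤ C →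
          ‖b₁ - b₂‖ₑ ≤ ENNReal.ofReal (C + C) := fun h₁ h₂ h₃ h₄ => by
        rw [← ofReal_norm, Real.norm_eq_abs]
        exact ENNReal.ofReal_le_ofReal (abs_le.2 ⟨by linarith, by linarith⟩)
      have e1 := habs (Real.rpow_nonneg (by positivity) _) (Real.rpow_nonneg (by positivity) _)
        (hone hw hβ.le) (hone hux hβ.le)
      have e2 := habs (Real.rpow_nonneg (by positivity) _) (Real.rpow_nonneg (by positivity) _)
        (hone₂ hw) (hone₂ hux)
      rw [add_zero, ← hmul]
      calc _ ≤ ‖G x‖ₑ ^ (p - 1) * (ENNReal.ofReal (c₁ + c₁) * ENNReal.ofReal L +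
            ENNReal.ofReal (β * M) * (ENNReal.ofReal (c₂ + c₂) * ‖G x‖ₑ)) := by
            simp only [hP]; gcongr
        _ = _ := by ring
    · rw [lintegral_add_left' ((hHm.pow_const _).const_mul _),
        lintegral_const_mul' _ _ (by finiteness), lintegral_const_mul' _ _ (by finiteness)]
      exact ENNReal.add_ne_top.2 ⟨ENNReal.mul_ne_top (by finiteness) hG1,
        ENNReal.mul_ne_top (by finiteness) h.lintegral_grad_ne_top⟩
    · filter_upwards [hu0, h.ae_tendsto] with x hux hx
      have h1 : ∀ e : ℝ, Tendsto (fun k => ‖(w k x + d) ^ e - (u x + d) ^ e‖ₑ) atTop (𝓝 0) := by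
        intro e
        have h2 := (((hx.add_const d).rpow_const (p := e)
          (Or.inl (by linarith))).sub_const ((u x + d) ^ e)).enorm
        rwa [sub_self, enorm_zero] at h2
      have h2 := ENNReal.Tendsto.mul_const (b := ENNReal.ofReal L) (h1 (-β))
        (Or.inr ENNReal.ofReal_ne_top)
      have h3 := ENNReal.Tendsto.const_mul (a := ENNReal.ofReal (β * M))
        (ENNReal.Tendsto.mul_const (b := ‖G x‖ₑ) (h1 (-β - 1)) (Or.inr enorm_ne_top))
        (Or.inr ENNReal.ofReal_ne_top)
      have h4 := ENNReal.Tendsto.const_mul (a := ‖G x‖ₑ ^ (p - 1)) (h2.add h3)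
        (Or.inr (ENNReal.rpow_ne_top_of_nonneg hp1.le enorm_ne_top))
      simpa using h4
  have hlimQ : Tendsto (fun k => ∫⁻ x in B, ‖G x‖ₑ ^ (p - 1) * Q k x) atTop (𝓝 0) :=
    tendsto_lintegral_mul_zero hp hHm hQm h.lintegral_grad_ne_top h.tendsto_grad
  have hlim := (ENNReal.Tendsto.const_mul (a := ENNReal.ofReal c) hlimP
    (Or.inr ENNReal.ofReal_ne_top)).add (ENNReal.Tendsto.const_mul
    (a := ENNReal.ofReal (c * (β * M * c₂))) hlimQ (Or.inr ENNReal.ofReal_ne_top))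
  simp only [mul_zero, add_zero] at hlim
  refine tendsto_of_tendsto_of_tendsto_of_le_of_le tendsto_const_nhds hlim (fun _ => zero_le)
    (fun k => (lintegral_mono_ae (hbd k)).trans (le_of_eq ?_))
  have hm : AEMeasurable (fun x => ENNReal.ofReal c * (‖G x‖ₑ ^ (p - 1) * P k x))
      (volume.restrict B) := ((hHm.pow_const _).mul (hPm k)).const_mul _
  rw [lintegral_add_left' hm, lintegral_const_mul' _ _ ENNReal.ofReal_ne_top, lintegral_const_mul' _ _ ENNReal.ofReal_ne_top]

end

section
open Filter

lemma aemeasurable_abs_of_integrable_rpow {n : ℕ} {f : En n → ℝ} {μ : Measure (En n)} {m : ℝ}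
    (hm : 0 < m) (h : Integrable (fun x => |f x| ^ m) μ) : AEMeasurable (fun x => |f x|) μ := by
  have := h.aemeasurable.pow_const (1 / m)
  refine this.congr (ae_of_all _ fun x => ?_)
  simp only [one_div]
  exact Real.rpow_rpow_inv (abs_nonneg _) hm.ne'

lemma lintegral_abs_ne_top_of_integrable_rpow {n : ℕ} {f : En n → ℝ} {μ : Measure (En n)}
    [IsFiniteMeasure μ] {m : ℝ} (hm : 1 ≤ m) (h : Integrable (fun x => |f x| ^ m) μ) :
    ∫⁻ x, ENNReal.ofReal |f x| ∂μ ≠ ⊤ := by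
  refine ne_top_of_le_ne_top (((integrable_const (1 : ℝ)).add h).lintegral_lt_top).ne
    (lintegral_mono fun x => ENNReal.ofReal_le_ofReal ?_)
  simp only [Pi.add_apply]
  rcases le_total |f x| 1 with h1 | h1
  · have := Real.rpow_nonneg (abs_nonneg (f x)) m
    linarith
  · have := Real.rpow_le_rpow_of_exponent_le h1 hm
    rw [Real.rpow_one] at this
    linarith

/-- Passage to the limit in a zero-order term of the energy inequality. -/
lemma IsApprox.tendsto_lintegral_mul_rpow_neg {n : ℕ} {p : ℝ}
    {x₀ : En n} {r : ℝ} {u : En n → ℝ} {G : En n → En n} {w : ℕ → En n → ℝ}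
    (h : IsApprox p x₀ r u G w) {ζ g : En n → ℝ} (hζm : Measurable ζ) (hζ0 : ∀ x, 0 ≤ ζ x) {M : ℝ}
    (hM : ∀ x, ζ x ≤ M) {d β : ℝ} (hd : 0 < d) (hβ : 0 ≤ β)
    (hgm : AEMeasurable g (volume.restrict (ball x₀ r)))
    (hg0 : ∀ x ∈ ball x₀ r, 0 ≤ g x)
    (hg : ∫⁻ x in ball x₀ r, ENNReal.ofReal (g x) ≠ ⊤) :
    Tendsto (fun k => ∫⁻ x in ball x₀ r, ENNReal.ofReal (g x * (ζ x * (w k x + d) ^ (-β)))) atTop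
      (𝓝 (∫⁻ x in ball x₀ r, ENNReal.ofReal (g x * (ζ x * (u x + d) ^ (-β))))) := by
  have hM0 : 0 ≤ M := (hζ0 x₀).trans (hM x₀)
  refine tendsto_lintegral_of_dominated_convergence'
    (fun x => ENNReal.ofReal (M * d ^ (-β)) * ENNReal.ofReal (g x)) (fun k => ?_) (fun k => ?_) ?_ ?_
  · exact (hgm.mul (hζm.mul (((h.contDiff k).continuous.measurable.add_const d).pow_const
      _)).aemeasurable).ennreal_ofReal
  · filter_upwards [ae_restrict_mem measurableSet_ball] with x hx
    rw [← ENNReal.ofReal_mul (by positivity), mul_comm (g x)]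
    have hw := h.nonneg_approx k x
    refine ENNReal.ofReal_le_ofReal (mul_le_mul_of_nonneg_right (mul_le_mul (hM x)
      (rpow_neg_le_of_le hβ hd (by linarith)) (Real.rpow_nonneg (by positivity) _) hM0) (hg0 x hx))
  · rw [lintegral_const_mul' _ _ ENNReal.ofReal_ne_top]
    exact ENNReal.mul_ne_top ENNReal.ofReal_ne_top hg
  · filter_upwards [ae_restrict_mem measurableSet_ball, h.ae_tendsto] with x hx hlim
    have hux := h.nonneg x hx
    exact (ENNReal.continuous_ofReal.tendsto _).comp ((((hlim.add_const d).rpow_const (p := -β)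
      (Or.inl (by linarith))).const_mul (ζ x)).const_mul (g x))

lemma IsApprox.lintegral_add_rpow_ne_top {n : ℕ} {p : ℝ} (hp : 1 < p)
    {x₀ : En n} {r : ℝ} {u : En n → ℝ} {G : En n → En n} {w : ℕ → En n → ℝ}
    (h : IsApprox p x₀ r u G w) {d : ℝ} (hd : 0 ≤ d) :
    ∫⁻ x in ball x₀ r, ENNReal.ofReal ((u x + d) ^ p) ≠ ⊤ := by
  have h1 : ∫⁻ x in ball x₀ r, (‖u x‖ₑ + ENNReal.ofReal d) ^ p ≠ ⊤ := by
    refine ne_top_of_le_ne_top ?_ (lintegral_rpow_add_le hp.le h.aemeasurable.enorm)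
    rw [setLIntegral_const]
    exact ENNReal.mul_ne_top (ENNReal.rpow_ne_top_of_nonneg (by linarith) (by simp))
      (ENNReal.add_ne_top.2 ⟨h.lintegral_ne_top, ENNReal.mul_ne_top
        (ENNReal.rpow_ne_top_of_nonneg (by linarith) ENNReal.ofReal_ne_top)
        measure_ball_lt_top.ne⟩)
  refine ne_top_of_le_ne_top h1 (setLIntegral_mono' measurableSet_ball fun x hx => ?_)
  have hux := h.nonneg x hx
  rw [← ofReal_norm, Real.norm_of_nonneg hux, ← ENNReal.ofReal_add hux hd,
    ENNReal.ofReal_rpow_of_nonneg (by positivity) (by linarith)]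

/-- The energy inequality of a supersolution tested with `ζ (u + d) ^ (-β)`. -/
lemma IsSupersol.energy_le_rpow {n : ℕ} {p s C₁ C₂ Λ : ℝ} {S : Setting n p s C₁ C₂ Λ} (hn : 0 < n)
    (hp : 1 < p) (hs0 : 0 < s) (hs1 : s < 1) {q : ℝ} (hpq : p ≤ q) {u f ζ : En n → ℝ}
    {G : En n → En n} {w : ℕ → En n → ℝ}
    {x₀ : En n} {ρ r R d : ℝ} (hsol : IsSupersol S f u G)
    (hf : IntegrableOn (fun x => |f x| ^ (q / p)) (ball x₀ R))
    (hr : 0 < r) (hr1 : r ≤ 1) (hrR : r < R) (hρ : ρ < r) (hR : ball x₀ R ⊆ S.Ω)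
    (hu0 : ∀ x ∈ ball x₀ R, 0 ≤ u x) (hd : dBound n p s q u f x₀ r R < d)
    (h : IsApprox p x₀ r u G w)
    (hζ : ContDiff ℝ (⊤ : ℕ∞) ζ) (hζ0 : ∀ x, 0 ≤ ζ x) (hsupp : tsupport ζ ⊆ closedBall x₀ ρ)
    {β : ℝ} (hβ : 0 < β) :
    ENNReal.ofReal (- ∫ x in ball x₀ r, ⟪S.A x (G x), (u x + d) ^ (-β) • gradient ζ x +
        (-β * ζ x * (u x + d) ^ (-β - 1)) • G x⟫) ≤
      (∫⁻ x in ball x₀ r, ENNReal.ofReal (|f x| * (ζ x * (u x + d) ^ (-β)))) +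
      (ENNReal.ofReal Λ * ∫⁻ z, ENNReal.ofReal (Jp p (u z.1 - u z.2) *
        (ζ z.1 * (u z.1 + d) ^ (-β) - ζ z.2 * (u z.2 + d) ^ (-β))) ∂(fracMeas n p s (ball x₀ r)) +
      ENNReal.ofReal (2 ^ p * Λ * (1 - ρ / r) ^ (-((n : ℝ) + p * s)) *
        (sphereConst n / (p * s) + 1) * r ^ (-p)) *
        ∫⁻ x in ball x₀ r, ENNReal.ofReal ((u x + d) ^ (p - 1) * (ζ x * (u x + d) ^ (-β)))) := by
  have hp0 : 0 < p := by linarith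
  have hp1 : 0 < p - 1 := by linarith
  have hd0 : 0 < d := (dBound_nonneg u f x₀ hr (hr.trans hrR)).trans_lt hd
  have hζ1 : ContDiff ℝ 1 ζ := hζ.of_le (by exact_mod_cast le_top)
  have hcs : HasCompactSupport ζ :=
    (isCompact_closedBall x₀ ρ).of_isClosed_subset (isClosed_tsupport _) hsupp
  obtain ⟨M, -, hM⟩ := HasCompactSupport.exists_pos_bound hcs hζ.continuous
  have hgcs : HasCompactSupport (gradient ζ) := hcs.of_isClosed_subset (isClosed_tsupport _) <|
    closure_minimal (fun x hx => by
      by_contra h'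
      exact hx (gradient_eq_zero_of_notMem_tsupport h')) (isClosed_tsupport _)
  obtain ⟨L, hL⟩ := hgcs.exists_bound_of_continuous (continuous_gradient hζ1)
  have hBB : closedBall x₀ ρ ⊆ ball x₀ r := closedBall_subset_ball hρ
  have hBR : ball x₀ r ⊆ ball x₀ R := ball_subset_ball hrR.le
  have hfr : Integrable (fun x => |f x| ^ (q / p)) (volume.restrict (ball x₀ r)) :=
    hf.mono_set hBR
  have hAm : Measurable (Function.uncurry fun ξ x => S.A x ξ) :=
    measurable_uncurry_of_continuous_of_measurable S.hAcont S.hAmeas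
  have ha : AEStronglyMeasurable (fun x => S.A x (G x)) (volume.restrict (ball x₀ r)) :=
    (hAm.comp_aemeasurable (h.aestronglyMeasurable.aemeasurable.prodMk
      aemeasurable_id)).aestronglyMeasurable
  have haG : ∀ᵐ x ∂(volume.restrict (ball x₀ r)),
      ‖S.A x (G x)‖ ≤ C₂ * ‖G x‖ ^ (p - 1) := by
    filter_upwards [ae_restrict_of_ae S.hAgrowth, ae_restrict_mem measurableSet_ball] with x hx hxB
    exact hx (hR (hBR hxB)) _
  have l1 := (ENNReal.continuous_ofReal.tendsto _).comp (h.tendsto_integral_inner hp hζ hM hL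
    (hsupp.trans hBB) hd0 hβ S.hC₂.le ha haG).neg
  have l2 := h.tendsto_lintegral_mul_rpow_neg (g := fun x => |f x|) hζ.continuous.measurable hζ0
    (fun x => (le_abs_self _).trans (hM x)) hd0 hβ.le
    (aemeasurable_abs_of_integrable_rpow (div_pos (by linarith) hp0) hfr) (fun _ _ => abs_nonneg _)
    (by
      have : IsFiniteMeasure (volume.restrict (ball x₀ r)) := ⟨by simp [measure_ball_lt_top]⟩
      exact lintegral_abs_ne_top_of_integrable_rpow ((one_le_div hp0).2 hpq) hfr)
  have l3 := h.tendsto_lintegral_mul_rpow_neg (g := fun x => (u x + d) ^ (p - 1))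
    hζ.continuous.measurable hζ0
    (fun x => (le_abs_self _).trans (hM x)) hd0 hβ.le
    ((h.aemeasurable.add_const d).pow_const _)
    (fun x hx => Real.rpow_nonneg (add_nonneg (h.nonneg x hx) hd0.le) _) (by
      refine ne_top_of_le_ne_top (b := ∫⁻ x in ball x₀ r, (1 + ENNReal.ofReal ((u x + d) ^ p))) ?_
        (setLIntegral_mono' measurableSet_ball fun x hx => ?_)
      · rw [lintegral_add_left measurable_const, setLIntegral_const, one_mul]
        exact ENNReal.add_ne_top.2 ⟨measure_ball_lt_top.ne, h.lintegral_add_rpow_ne_top hp hd0.le⟩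
      · have hux := h.nonneg x hx
        rw [← ENNReal.ofReal_one, ← ENNReal.ofReal_add zero_le_one
          (Real.rpow_nonneg (by positivity) _)]
        exact ENNReal.ofReal_le_ofReal (rpow_sub_one_le_one_add hp (by positivity)))
  have l4 := h.tendsto_nonlocal hn hp hs1 hr hζ1 hM (by
    refine ne_top_of_le_ne_top (b := ∫⁻ x in ball x₀ r, ENNReal.ofReal L ^ p) ?_
      (lintegral_mono fun x => ?_)
    · rw [setLIntegral_const]
      exact ENNReal.mul_ne_top (ENNReal.rpow_ne_top_of_nonneg hp0.le ENNReal.ofReal_ne_top)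
        measure_ball_lt_top.ne
    · have : ‖gradient ζ x‖ₑ ≤ ENNReal.ofReal L := by
        rw [← ofReal_norm]; exact ENNReal.ofReal_le_ofReal (hL x)
      gcongr) hd0 hβ
  set ν := fracMeas n p s (ball x₀ r) with hν
  set N : ℝ≥0∞ := ∫⁻ z, ENNReal.ofReal (Jp p (u z.1 - u z.2) *
    (ζ z.1 * (u z.1 + d) ^ (-β) - ζ z.2 * (u z.2 + d) ^ (-β))) ∂ν with hN
  set T : ℝ≥0∞ := ENNReal.ofReal (2 ^ p * Λ * (1 - ρ / r) ^ (-((n : ℝ) + p * s)) *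
    (sphereConst n / (p * s) + 1) * r ^ (-p)) with hT
  have l5 := l2.add ((ENNReal.Tendsto.const_mul (a := ENNReal.ofReal Λ)
    (tendsto_const_nhds (x := N).add l4) (Or.inr ENNReal.ofReal_ne_top)).add
    (ENNReal.Tendsto.const_mul (a := T) l3 (Or.inr ENNReal.ofReal_ne_top)))
  rw [add_zero] at l5
  refine le_of_tendsto_of_tendsto' l1 l5 fun k => ?_
  have hφ0 : ∀ x, 0 ≤ ζ x * (w k x + d) ^ (-β) := fun x =>
    mul_nonneg (hζ0 x) (Real.rpow_nonneg (add_nonneg (h.nonneg_approx k x) hd0.le) _)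
  refine (hsol.energy_le hn hp hs0 hs1 hr hr1 hrR hρ hR hu0 hd
    (contDiff_mul_rpow (e := -β) hζ (h.contDiff k) hd0 (h.nonneg_approx k)) hφ0
    ((tsupport_mul_subset_left).trans hsupp)).trans ?_
  refine add_le_add le_rfl (add_le_add (mul_le_mul_right ?_ _) (mul_le_mul_right ?_ _))
  · have hu1 : AEMeasurable (fun z : En n × En n => u z.1) ν := h.aemeasurable.fracMeas_fst
    have hu2 : AEMeasurable (fun z : En n × En n => u z.2) ν := h.aemeasurable.fracMeas_snd
    have hζz1 : Measurable (fun z : En n × En n => ζ z.1) :=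
      hζ.continuous.measurable.comp measurable_fst
    have hζz2 : Measurable (fun z : En n × En n => ζ z.2) :=
      hζ.continuous.measurable.comp measurable_snd
    have hm : AEMeasurable (fun z : En n × En n => ENNReal.ofReal (Jp p (u z.1 - u z.2) *
        (ζ z.1 * (u z.1 + d) ^ (-β) - ζ z.2 * (u z.2 + d) ^ (-β)))) ν :=
      (((measurable_Jp p).comp_aemeasurable (hu1.sub hu2)).mul
        ((hζz1.aemeasurable.mul ((hu1.add_const d).pow_const _)).sub
        (hζz2.aemeasurable.mul ((hu2.add_const d).pow_const _)))).ennreal_ofReal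
    rw [hN, ← lintegral_add_left' hm]
    refine lintegral_mono fun z => ?_
    have h1 : ENNReal.ofReal (|u z.1 - u z.2| ^ (p - 1) *
        |(ζ z.1 * (w k z.1 + d) ^ (-β) - ζ z.2 * (w k z.2 + d) ^ (-β)) -
        (ζ z.1 * (u z.1 + d) ^ (-β) - ζ z.2 * (u z.2 + d) ^ (-β))|) =
        ‖u z.1 - u z.2‖ₑ ^ (p - 1) *
        ‖(ζ z.1 * (w k z.1 + d) ^ (-β) - ζ z.2 * (w k z.2 + d) ^ (-β)) -
        (ζ z.1 * (u z.1 + d) ^ (-β) - ζ z.2 * (u z.2 + d) ^ (-β))‖ₑ := by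
      rw [ENNReal.ofReal_mul (by positivity),
        ← ENNReal.ofReal_rpow_of_nonneg (abs_nonneg _) hp1.le]
      simp only [← Real.norm_eq_abs, ofReal_norm]
    rw [← h1]
    refine (ENNReal.ofReal_le_ofReal ?_).trans ENNReal.ofReal_add_le
    rw [← abs_Jp hp, ← abs_mul]
    have := le_abs_self (Jp p (u z.1 - u z.2) *
      ((ζ z.1 * (w k z.1 + d) ^ (-β) - ζ z.2 * (w k z.2 + d) ^ (-β)) -
        (ζ z.1 * (u z.1 + d) ^ (-β) - ζ z.2 * (u z.2 + d) ^ (-β))))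
    linarith
  · exact le_of_eq (by simp only [mul_comm])

end

section
open Filter

lemma abs_sub_le_of_norm_gradient_le {n : ℕ} {ψ : En n → ℝ} {L : ℝ} (hψ : ContDiff ℝ 1 ψ)
    (hL : ∀ x, ‖gradient ψ x‖ ≤ L) (x y : En n) : |ψ x - ψ y| ≤ L * ‖x - y‖ := by
  have := Convex.norm_image_sub_le_of_norm_fderiv_le (𝕜 := ℝ) (f := ψ) (C := L) (s := univ)
    (fun z _ => hψ.differentiable one_ne_zero z) (fun z _ => by rw [← norm_gradient_eq]; exact hL z)
    convex_univ (mem_univ y) (mem_univ x)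
  simpa using this

/-- The nonlocal term tested with negative powers is controlled by a zeroth-order term. -/
lemma lintegral_fracMeas_Jp_le {n : ℕ} (hn : 0 < n) {p s β d L ρ r : ℝ} (hp : 1 < p) (hs0 : 0 < s)
    (hs1 : s < 1) (hβ : 0 < β) (hβp : β < p - 1) (hd : 0 < d) (hL0 : 0 < L) {x₀ : En n}
    (hρ : ρ ≤ r) {u ψ : En n → ℝ} (hum : AEMeasurable u (volume.restrict (ball x₀ r)))
    (hu0 : ∀ x ∈ ball x₀ r, 0 ≤ u x) (hψ : ContDiff ℝ 1 ψ) (hψ0 : ∀ x, 0 ≤ ψ x)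
    (hψ1 : ∀ x, ψ x ≤ 1) (hL : ∀ x, ‖gradient ψ x‖ ≤ L) (hsupp : tsupport ψ ⊆ ball x₀ ρ) :
    ∫⁻ z, ENNReal.ofReal (Jp p (u z.1 - u z.2) * (ψ z.1 ^ p * (u z.1 + d) ^ (-β) -
        ψ z.2 ^ p * (u z.2 + d) ^ (-β))) ∂(fracMeas n p s (ball x₀ r)) ≤
      ENNReal.ofReal (2 * (p * (p / β) ^ (p - 1)) *
        ((sphereConst n / (p * (1 - s)) + sphereConst n / (p * s)) * L ^ (p * s))) *
        ∫⁻ x in ball x₀ ρ, ENNReal.ofReal ((u x + d) ^ (p - 1 - β)) := by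
  have hp0 : 0 < p := by linarith
  set B := ball x₀ r with hB
  have hρB : ball x₀ ρ ⊆ B := ball_subset_ball hρ
  set c := p * (p / β) ^ (p - 1) with hc
  have hc0 : 0 ≤ c := by positivity
  clear_value c
  set g : En n → ℝ≥0∞ := (ball x₀ ρ).indicator fun x => ENNReal.ofReal ((u x + d) ^ (p - 1 - β))
    with hg
  set M : En n × En n → ℝ≥0∞ := fun z => ENNReal.ofReal (min ((L * ‖z.1 - z.2‖) ^ p) 1) with hM
  set k : En n × En n → ℝ≥0∞ := fun z => ENNReal.ofReal (‖z.1 - z.2‖ ^ (-((n : ℝ) + p * s)))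
    with hk
  have hkm : Measurable k := measurable_kernel
  have hMm : Measurable M := (((((measurable_fst.sub measurable_snd).norm).const_mul L).pow_const
    p).min measurable_const).ennreal_ofReal
  have hgm : AEMeasurable g (volume.restrict B) :=
    (((hum.add_const d).pow_const _).ennreal_ofReal).indicator measurableSet_ball
  have hgV : ∫⁻ x in B, g x = ∫⁻ x in ball x₀ ρ, ENNReal.ofReal ((u x + d) ^ (p - 1 - β)) := by
    rw [hg, lintegral_indicator measurableSet_ball, Measure.restrict_restrict measurableSet_ball,
      inter_eq_left.2 hρB]
  have hpt : ∀ᵐ z ∂(fracMeas n p s B), ENNReal.ofReal (Jp p (u z.1 - u z.2) *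
      (ψ z.1 ^ p * (u z.1 + d) ^ (-β) - ψ z.2 ^ p * (u z.2 + d) ^ (-β))) ≤
      ENNReal.ofReal c * (g z.1 * M z + g z.2 * M z) := by
    filter_upwards [ae_fracMeas_fst (ae_restrict_mem measurableSet_ball),
      ae_fracMeas_snd (ae_restrict_mem measurableSet_ball)] with z h1 h2
    have hu1 := hu0 _ h1
    have hu2 := hu0 _ h2
    have ha : 0 < u z.1 + d := by positivity
    have hb : 0 < u z.2 + d := by positivity
    have key := Jp_mul_sub_le hp hβ hβp ha hb (hψ0 z.1) (hψ0 z.2)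
    rw [add_sub_add_right_eq_sub, ← hc] at key
    have hind : ∀ x, 0 < u x + d → ENNReal.ofReal (if 0 < ψ x then (u x + d) ^ (p - 1 - β) else 0)
        ≤ g x := by
      intro x hx
      split_ifs with h
      · rw [hg, indicator_of_mem (hsupp (subset_tsupport _ h.ne'))]
      · simp
    have hmin : |ψ z.1 - ψ z.2| ^ p ≤ min ((L * ‖z.1 - z.2‖) ^ p) 1 := by
      refine le_min (Real.rpow_le_rpow (abs_nonneg _)
        (abs_sub_le_of_norm_gradient_le hψ hL _ _) hp0.le)
        (Real.rpow_le_one (abs_nonneg _) ?_ hp0.le)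
      rw [abs_le]
      constructor <;> linarith [hψ0 z.1, hψ0 z.2, hψ1 z.1, hψ1 z.2]
    refine (ENNReal.ofReal_le_ofReal key).trans ?_
    have n1 : 0 ≤ if 0 < ψ z.1 then (u z.1 + d) ^ (p - 1 - β) else 0 := by
      split_ifs <;> positivity
    have n2 : 0 ≤ if 0 < ψ z.2 then (u z.2 + d) ^ (p - 1 - β) else 0 := by
      split_ifs <;> positivity
    rw [mul_assoc, ENNReal.ofReal_mul hc0, ENNReal.ofReal_mul (by positivity),
      ENNReal.ofReal_add n1 n2, ← add_mul, mul_comm (g z.1 + g z.2)]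
    gcongr
    · exact ENNReal.ofReal_le_ofReal hmin
    · exact hind _ ha
    · exact hind _ hb
  have hone : ∀ x, ∫⁻ y in B, M (x, y) * k (x, y) ≤ ENNReal.ofReal ((sphereConst n / (p * (1 - s)) +
      sphereConst n / (p * s)) * L ^ (p * s)) := by
    intro x
    refine (setLIntegral_le_lintegral _ _).trans ((lintegral_congr fun y => ?_).trans_le
      (lintegral_min_kernel_le hn hp0 hs0 hs1 hL0 x))
    simp only [hM, hk]
    rw [ENNReal.ofReal_mul (by positivity)]
  have hone' : ∀ y, ∫⁻ x in B, M (x, y) * k (x, y) ≤ ENNReal.ofReal ((sphereConst n / (p * (1 - s)) +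
      sphereConst n / (p * s)) * L ^ (p * s)) := by
    intro y
    refine le_trans (le_of_eq (lintegral_congr fun x => ?_)) (hone y)
    simp only [hM, hk, norm_sub_rev x y]
  have hm1 : AEMeasurable (fun z : En n × En n => g z.1 * (M z * k z))
      ((volume.restrict B).prod (volume.restrict B)) :=
    (hgm.comp_quasiMeasurePreserving Measure.quasiMeasurePreserving_fst).mul
      (hMm.mul hkm).aemeasurable
  have hm2 : AEMeasurable (fun z : En n × En n => g z.2 * (M z * k z))
      ((volume.restrict B).prod (volume.restrict B)) :=
    (hgm.comp_quasiMeasurePreserving Measure.quasiMeasurePreserving_snd).mul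
      (hMm.mul hkm).aemeasurable
  set E := ENNReal.ofReal ((sphereConst n / (p * (1 - s)) +
      sphereConst n / (p * s)) * L ^ (p * s)) with hE
  have hi1 : ∫⁻ z, g z.1 * (M z * k z) ∂((volume.restrict B).prod (volume.restrict B)) ≤
      E * ∫⁻ x in B, g x := by
    rw [lintegral_prod _ hm1, ← lintegral_const_mul' _ _ ENNReal.ofReal_ne_top]
    refine lintegral_mono fun x => ?_
    simp only
    have hm : Measurable fun y => M (x, y) * k (x, y) := (hMm.mul hkm).comp measurable_prodMk_left
    rw [lintegral_const_mul _ hm, mul_comm]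
    exact mul_le_mul' (hone x) le_rfl
  have hi2 : ∫⁻ z, g z.2 * (M z * k z) ∂((volume.restrict B).prod (volume.restrict B)) ≤
      E * ∫⁻ x in B, g x := by
    rw [lintegral_prod_symm _ hm2, ← lintegral_const_mul' _ _ ENNReal.ofReal_ne_top]
    refine lintegral_mono fun y => ?_
    simp only
    have hm : Measurable fun x => M (x, y) * k (x, y) := (hMm.mul hkm).comp measurable_prodMk_right
    rw [lintegral_const_mul _ hm, mul_comm]
    exact mul_le_mul' (hone' y) le_rfl
  calc _ ≤ ∫⁻ z, ENNReal.ofReal c * (g z.1 * M z + g z.2 * M z) ∂(fracMeas n p s B) :=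
        lintegral_mono_ae hpt
    _ = ENNReal.ofReal c * (∫⁻ z, (g z.1 * (M z * k z) + g z.2 * (M z * k z))
          ∂((volume.restrict B).prod (volume.restrict B))) := by
        rw [lintegral_const_mul' _ _ ENNReal.ofReal_ne_top, lintegral_fracMeas]
        congr 1
        exact lintegral_congr fun z => by simp only [hk]; ring
    _ ≤ ENNReal.ofReal c * (E * (∫⁻ x in B, g x) + E * ∫⁻ x in B, g x) := by
        rw [lintegral_add_left' hm1]
        gcongr
    _ = _ := by
        have h1s : 0 < 1 - s := by linarith
        have := sphereConst_nonneg n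
        rw [hgV, ENNReal.ofReal_mul (by positivity), ENNReal.ofReal_mul (by norm_num), ← hE,
          ENNReal.ofReal_ofNat, ← two_mul]
        generalize (∫⁻ x in ball x₀ ρ, ENNReal.ofReal ((u x + d) ^ (p - 1 - β))) = V
        ring

end

section
open Filter

lemma rpow_sub_one_mul_le {p ε a b : ℝ} (hp : 1 < p) (hε : 0 < ε) (ha : 0 ≤ a) (hb : 0 ≤ b) :
    a ^ (p - 1) * b ≤ ε * a ^ p + ε ^ (1 - p) * b ^ p := by
  have hp1 : 0 < p - 1 := by linarith
  have hmul : ∀ {x : ℝ}, 0 ≤ x → x ^ p = x ^ (p - 1) * x := fun {x} hx => by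
    nth_rewrite 3 [← Real.rpow_one x]
    rw [← Real.rpow_add' hx (by linarith), sub_add_cancel]
  rcases le_or_gt b (ε * a) with h | h
  · calc a ^ (p - 1) * b ≤ a ^ (p - 1) * (ε * a) := by gcongr
      _ = ε * a ^ p := by rw [hmul ha]; ring
      _ ≤ _ := le_add_of_nonneg_right (by positivity)
  · have h' : a ≤ b / ε := by rw [le_div_iff₀ hε]; linarith
    calc a ^ (p - 1) * b ≤ (b / ε) ^ (p - 1) * b := by gcongr
      _ = ε ^ (1 - p) * b ^ p := by
        rw [hmul hb, Real.div_rpow hb hε.le, ← neg_sub p 1, Real.rpow_neg hε.le]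
        field_simp
      _ ≤ _ := le_add_of_nonneg_left (by positivity)

lemma gradient_rpow {n : ℕ} {p : ℝ} (hp : 1 ≤ p) {ψ : En n → ℝ} (hψ : ContDiff ℝ 1 ψ) (x : En n) :
    gradient (fun y => ψ y ^ p) x = (p * ψ x ^ (p - 1)) • gradient ψ x := by
  have h := ((hψ.differentiable one_ne_zero x).hasFDerivAt).rpow_const (p := p) (Or.inr hp)
  rw [gradient, h.fderiv, map_smulₛₗ, gradient]
  simp

/-- Pointwise lower bound for the principal part tested with a negative power. -/
lemma coercive_neg_power_le {E : Type*} [NormedAddCommGroup E] [InnerProductSpace ℝ E]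
    {p β ε C₁ C₂ L v z : ℝ} {a g e : E} (hp : 1 < p) (hβ : 0 < β) (hε : 0 < ε)
    (hεβ : 2 * ε ≤ β * C₁) (hC₂ : 0 ≤ C₂) (hL : 0 ≤ L) (hv : 0 < v) (hz : 0 ≤ z)
    (ha : ‖a‖ ≤ C₂ * ‖g‖ ^ (p - 1)) (hag : C₁ * ‖g‖ ^ p ≤ ⟪a, g⟫) (he : ‖e‖ ≤ L) :
    ε * (‖g‖ ^ p * (z ^ p * v ^ (p - 1 - β - p))) ≤
      -⟪a, v ^ (-β) • ((p * z ^ (p - 1)) • e) + (-β * z ^ p * v ^ (-β - 1)) • g⟫ +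
        ε ^ (1 - p) * (C₂ * p * L) ^ p * v ^ (p - 1 - β) := by
  have hp0 : 0 < p := by linarith
  have hex : p - 1 - β - p = -β - 1 := by ring
  rw [hex]
  set X := ‖g‖ ^ p * (z ^ p * v ^ (-β - 1)) with hX
  have hX0 : 0 ≤ X := by positivity
  have hY := rpow_sub_one_mul_le hp hε (a := ‖g‖ * z * v ^ ((-β - 1) / p))
    (b := C₂ * p * L * v ^ ((p - 1 - β) / p)) (by positivity) (by positivity)
  have e1 : (‖g‖ * z * v ^ ((-β - 1) / p)) ^ p = X := by
    rw [Real.mul_rpow (by positivity) (by positivity), Real.mul_rpow (by positivity) hz,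
      ← Real.rpow_mul hv.le, div_mul_cancel₀ _ hp0.ne', hX, mul_assoc]
  have e2 : (C₂ * p * L * v ^ ((p - 1 - β) / p)) ^ p = (C₂ * p * L) ^ p * v ^ (p - 1 - β) := by
    rw [Real.mul_rpow (by positivity) (by positivity), ← Real.rpow_mul hv.le,
      div_mul_cancel₀ _ hp0.ne']
  have e3 : (‖g‖ * z * v ^ ((-β - 1) / p)) ^ (p - 1) * (C₂ * p * L * v ^ ((p - 1 - β) / p)) =
      v ^ (-β) * (p * z ^ (p - 1)) * (C₂ * ‖g‖ ^ (p - 1) * L) := by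
    have : v ^ (-β) = v ^ ((-β - 1) / p * (p - 1)) * v ^ ((p - 1 - β) / p) := by
      rw [← Real.rpow_add hv]
      congr 1
      field_simp
      ring
    rw [Real.mul_rpow (by positivity) (by positivity), Real.mul_rpow (by positivity) hz,
      ← Real.rpow_mul hv.le, this]
    ring
  rw [e1, e2, e3] at hY
  have h1 : ⟪a, e⟫ ≤ C₂ * ‖g‖ ^ (p - 1) * L :=
    (real_inner_le_norm _ _).trans (mul_le_mul ha he (norm_nonneg _) (by positivity))
  have h2 : v ^ (-β) * (p * z ^ (p - 1)) * ⟪a, e⟫ ≤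
      v ^ (-β) * (p * z ^ (p - 1)) * (C₂ * ‖g‖ ^ (p - 1) * L) := by gcongr
  have h3 : β * z ^ p * v ^ (-β - 1) * (C₁ * ‖g‖ ^ p) ≤ β * z ^ p * v ^ (-β - 1) * ⟪a, g⟫ := by
    gcongr
  have h4 : 2 * ε * X ≤ β * C₁ * X := by gcongr
  rw [inner_add_right, inner_smul_right, inner_smul_right, inner_smul_right]
  have h5 : β * z ^ p * v ^ (-β - 1) * (C₁ * ‖g‖ ^ p) = β * C₁ * X := by rw [hX]; ring
  nlinarith

/-- Integrated lower bound for the principal part tested with a negative power. -/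
lemma IsApprox.lintegral_gradient_le {n : ℕ} {p β ε C₁ C₂ L d ρ r : ℝ} (hp : 1 < p) {x₀ : En n}
    {u ψ : En n → ℝ} {G a : En n → En n} {w : ℕ → En n → ℝ} (h : IsApprox p x₀ r u G w)
    (hβ : 0 < β) (hε : 0 < ε) (hεβ : 2 * ε ≤ β * C₁) (hC₂ : 0 ≤ C₂) (hd : 0 < d)
    (ha : AEStronglyMeasurable a (volume.restrict (ball x₀ r)))
    (hag : ∀ᵐ x ∂(volume.restrict (ball x₀ r)), ‖a x‖ ≤ C₂ * ‖G x‖ ^ (p - 1))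
    (hac : ∀ᵐ x ∂(volume.restrict (ball x₀ r)), C₁ * ‖G x‖ ^ p ≤ ⟪a x, G x⟫)
    (hψ : ContDiff ℝ 1 ψ) (hψ0 : ∀ x, 0 ≤ ψ x) (hψ1 : ∀ x, ψ x ≤ 1)
    (hL : ∀ x, ‖gradient ψ x‖ ≤ L) (hρ : ρ ≤ r) (hsupp : tsupport ψ ⊆ ball x₀ ρ) :
    ENNReal.ofReal ε * ∫⁻ x in ball x₀ r,
        ENNReal.ofReal (‖G x‖ ^ p * (ψ x ^ p * (u x + d) ^ (p - 1 - β - p))) ≤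
      ENNReal.ofReal (-∫ x in ball x₀ r, ⟪a x, (u x + d) ^ (-β) • gradient (fun y => ψ y ^ p) x +
        (-β * ψ x ^ p * (u x + d) ^ (-β - 1)) • G x⟫) +
      ENNReal.ofReal (ε ^ (1 - p) * (C₂ * p * L) ^ p) *
        ∫⁻ x in ball x₀ ρ, ENNReal.ofReal ((u x + d) ^ (p - 1 - β)) := by
  have hp0 : 0 < p := by linarith
  have hL0 : 0 ≤ L := (norm_nonneg _).trans (hL x₀)
  set B := ball x₀ r with hB
  have hρB : ball x₀ ρ ⊆ B := ball_subset_ball hρ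
  have hum := h.aemeasurable
  have hGm := h.aestronglyMeasurable
  have hu0 : ∀ᵐ x ∂(volume.restrict B), 0 ≤ u x := by
    filter_upwards [ae_restrict_mem measurableSet_ball] with x hx using h.nonneg x hx
  set c := ε ^ (1 - p) * (C₂ * p * L) ^ p with hc
  have hc0 : 0 ≤ c := by positivity
  set g : En n → ℝ := fun x => ⟪a x, (u x + d) ^ (-β) • gradient (fun y => ψ y ^ p) x +
        (-β * ψ x ^ p * (u x + d) ^ (-β - 1)) • G x⟫ with hg
  set V : En n → ℝ := (ball x₀ ρ).indicator fun x => c * (u x + d) ^ (p - 1 - β) with hV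
  have hVm : AEMeasurable V (volume.restrict B) :=
    (((hum.add_const d).pow_const _).const_mul c).indicator measurableSet_ball
  have hVint : ∫⁻ x in B, ENNReal.ofReal (V x) = ENNReal.ofReal c *
      ∫⁻ x in ball x₀ ρ, ENNReal.ofReal ((u x + d) ^ (p - 1 - β)) := by
    have e : volume.restrict (ball x₀ ρ) = (volume.restrict B).restrict (ball x₀ ρ) := by
      rw [Measure.restrict_restrict measurableSet_ball, inter_eq_left.2 hρB]
    rw [← lintegral_const_mul' _ _ ENNReal.ofReal_ne_top, e,
      ← lintegral_indicator (s := ball x₀ ρ) measurableSet_ball]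
    refine lintegral_congr fun x => ?_
    by_cases hx : x ∈ ball x₀ ρ
    · simp only [hV, indicator_of_mem hx]
      rw [ENNReal.ofReal_mul hc0]
    · simp only [hV, indicator_of_notMem hx]
      simp
  rw [← hVint]
  have hψm := hψ.continuous.measurable
  have hpt : ∀ᵐ x ∂(volume.restrict B), ε * (‖G x‖ ^ p * (ψ x ^ p * (u x + d) ^ (p - 1 - β - p))) ≤
      -g x + V x := by
    filter_upwards [hu0, hag, hac] with x hux hx1 hx2
    simp only [hg]
    rw [gradient_rpow hp.le hψ]
    by_cases hx : x ∈ ball x₀ ρ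
    · simp only [hV, indicator_of_mem hx]
      exact coercive_neg_power_le hp hβ hε hεβ hC₂ hL0 (by positivity) (hψ0 x) hx1 hx2 (hL x)
    · have hz : ψ x = 0 := by
        by_contra h'
        exact hx (hsupp (subset_tsupport _ h'))
      simp only [hV, indicator_of_notMem hx, hz, Real.zero_rpow hp0.ne',
        Real.zero_rpow (by linarith : p - 1 ≠ 0)]
      simp
  have hVnn : ∀ᵐ x ∂(volume.restrict B), 0 ≤ V x := by
    filter_upwards [hu0] with x hux
    refine indicator_apply_nonneg fun _ => ?_
    positivity
  rcases eq_or_ne (∫⁻ x in B, ENNReal.ofReal (V x)) ⊤ with htop | htop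
  · rw [htop]; simp
  have hVi : Integrable V (volume.restrict B) :=
    (lintegral_ofReal_ne_top_iff_integrable hVm.aestronglyMeasurable hVnn).1 htop
  have hGi : Integrable (fun x => ‖G x‖ ^ p) (volume.restrict B) := by
    refine (lintegral_ofReal_ne_top_iff_integrable
      (hGm.norm.aemeasurable.pow_const _).aestronglyMeasurable
      (ae_of_all _ fun x => by positivity)).1 ?_
    have e : ∀ x, ENNReal.ofReal (‖G x‖ ^ p) = ‖G x‖ₑ ^ p := fun x => by
      rw [← ofReal_norm, ENNReal.ofReal_rpow_of_nonneg (norm_nonneg _) hp0.le]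
    simp only [e]
    exact h.lintegral_grad_ne_top
  have hgradm : Measurable (gradient fun y => ψ y ^ p) := by
    have : (gradient fun y => ψ y ^ p) = fun x => (p * ψ x ^ (p - 1)) • gradient ψ x :=
      funext fun x => gradient_rpow hp.le hψ x
    rw [this]
    exact ((hψm.pow_const _).const_mul p).smul (continuous_gradient hψ).measurable
  have : IsFiniteMeasure (volume.restrict B) := ⟨by simpa using measure_ball_lt_top⟩
  have hgi : Integrable g (volume.restrict B) := by
    refine Integrable.mono' (g := fun x => C₂ * (d ^ (-β) * (p * L)) +
      (C₂ * (d ^ (-β) * (p * L)) + C₂ * (β * d ^ (-β - 1))) * ‖G x‖ ^ p)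
      ((integrable_const _).add (hGi.const_mul _)) ?_ ?_
    · refine ha.inner (AEStronglyMeasurable.add ?_ ?_)
      · exact (((hum.add_const d).pow_const _).smul hgradm.aemeasurable).aestronglyMeasurable
      · exact (((hψm.pow_const p).const_mul (-β)).aemeasurable.mul
          ((hum.add_const d).pow_const _)).aestronglyMeasurable.smul hGm
    · filter_upwards [hu0, hag] with x hux hx1
      have hv : d ≤ u x + d := by linarith
      have hv0 : 0 < u x + d := by linarith
      have b1 : (u x + d) ^ (-β) ≤ d ^ (-β) := rpow_neg_le_of_le hβ.le hd hv
      have b2 : (u x + d) ^ (-β - 1) ≤ d ^ (-β - 1) := by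
        have := rpow_neg_le_of_le (β := β + 1) (by linarith) hd hv
        rwa [neg_add] at this
      have z1 : ψ x ^ (p - 1) ≤ 1 := Real.rpow_le_one (hψ0 x) (hψ1 x) (by linarith)
      have z2 : ψ x ^ p ≤ 1 := Real.rpow_le_one (hψ0 x) (hψ1 x) (by linarith)
      have z3 : 0 ≤ ψ x := hψ0 x
      have n1 : ‖(u x + d) ^ (-β) • gradient (fun y => ψ y ^ p) x‖ ≤ d ^ (-β) * (p * L) := by
        rw [gradient_rpow hp.le hψ, norm_smul, norm_smul, Real.norm_of_nonneg (by positivity),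
          Real.norm_of_nonneg (by positivity)]
        have : p * ψ x ^ (p - 1) ≤ p := mul_le_of_le_one_right hp0.le z1
        have := hL x
        gcongr
      have n2 : ‖(-β * ψ x ^ p * (u x + d) ^ (-β - 1)) • G x‖ ≤ β * d ^ (-β - 1) * ‖G x‖ := by
        rw [norm_smul, norm_mul, norm_mul, norm_neg, Real.norm_of_nonneg hβ.le,
          Real.norm_of_nonneg (by positivity), Real.norm_of_nonneg (by positivity)]
        have : β * ψ x ^ p ≤ β := mul_le_of_le_one_right hβ.le z2
        gcongr
      have g1 : ‖G x‖ ^ (p - 1) ≤ 1 + ‖G x‖ ^ p := rpow_sub_one_le_one_add hp (norm_nonneg _)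
      have g2 : ‖G x‖ ^ (p - 1) * ‖G x‖ = ‖G x‖ ^ p := by
        nth_rewrite 2 [← Real.rpow_one ‖G x‖]
        rw [← Real.rpow_add' (norm_nonneg _) (by linarith), sub_add_cancel]
      calc ‖g x‖ ≤ ‖a x‖ * ‖(u x + d) ^ (-β) • gradient (fun y => ψ y ^ p) x +
            (-β * ψ x ^ p * (u x + d) ^ (-β - 1)) • G x‖ := norm_inner_le_norm _ _
        _ ≤ C₂ * ‖G x‖ ^ (p - 1) * (d ^ (-β) * (p * L) + β * d ^ (-β - 1) * ‖G x‖) := by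
            gcongr
            exact (norm_add_le _ _).trans (add_le_add n1 n2)
        _ = C₂ * (d ^ (-β) * (p * L)) * ‖G x‖ ^ (p - 1) + C₂ * (β * d ^ (-β - 1)) *
            (‖G x‖ ^ (p - 1) * ‖G x‖) := by ring
        _ ≤ C₂ * (d ^ (-β) * (p * L)) * (1 + ‖G x‖ ^ p) + C₂ * (β * d ^ (-β - 1)) *
            (‖G x‖ ^ (p - 1) * ‖G x‖) := by gcongr
        _ = _ := by rw [g2]; ring
  have hgi' : Integrable (fun x => -g x) (volume.restrict B) := hgi.neg
  have hsum : Integrable (fun x => -g x + V x) (volume.restrict B) := hgi'.add hVi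
  calc _ = ∫⁻ x in B, ENNReal.ofReal (ε * (‖G x‖ ^ p * (ψ x ^ p *
          (u x + d) ^ (p - 1 - β - p)))) := by
        rw [← lintegral_const_mul' _ _ ENNReal.ofReal_ne_top]
        exact lintegral_congr fun x => (ENNReal.ofReal_mul hε.le).symm
    _ ≤ ∫⁻ x in B, ENNReal.ofReal (-g x + V x) := by
        refine lintegral_mono_ae ?_
        filter_upwards [hpt] with x hx using ENNReal.ofReal_le_ofReal hx
    _ = ENNReal.ofReal (∫ x in B, (-g x + V x)) := by
        rw [ofReal_integral_eq_lintegral_ofReal hsum]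
        filter_upwards [hpt, hu0] with x hx hux
        refine le_trans ?_ hx
        have := hψ0 x
        positivity
    _ ≤ ENNReal.ofReal (-∫ x in B, g x) + ENNReal.ofReal (∫ x in B, V x) := by
        rw [integral_add hgi' hVi, integral_neg]
        exact ENNReal.ofReal_add_le
    _ = _ := by rw [ofReal_integral_eq_lintegral_ofReal hVi hVnn]

end

/-- The constant in the Caccioppoli inequality for negative powers. -/
def caccConst (n : ℕ) (p s C₁ C₂ Λ b : ℝ) : ℝ :=
  (b * C₁ / 2) ^ (1 - p) * (C₂ * p) ^ p +
    Λ * (2 * (p * (p / b) ^ (p - 1)) * (sphereConst n / (p * (1 - s)) + sphereConst n / (p * s))) +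
    2 ^ p * Λ * (sphereConst n / (p * s) + 1)

lemma caccConst_nonneg {n : ℕ} {p s C₁ C₂ Λ b : ℝ} (hp : 1 < p) (hs0 : 0 < s) (hs1 : s < 1)
    (hC₁ : 0 < C₁) (hC₂ : 0 < C₂) (hΛ : 1 ≤ Λ) (hb : 0 < b) : 0 ≤ caccConst n p s C₁ C₂ Λ b := by
  have := sphereConst_nonneg n
  have : 0 < 1 - s := by linarith
  have : 0 < Λ := by linarith
  have : 0 < p := by linarith
  unfold caccConst
  positivity

section
open Filter

/-- Caccioppoli inequality for negative powers of a supersolution. -/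
lemma IsSupersol.caccioppoli {n : ℕ} {p s C₁ C₂ Λ : ℝ} {S : Setting n p s C₁ C₂ Λ} (hn : 0 < n)
    (hp : 1 < p) (hs0 : 0 < s) (hs1 : s < 1) {q : ℝ} (hpq : p ≤ q) {u f ψ : En n → ℝ}
    {G : En n → En n} {w : ℕ → En n → ℝ}
    {x₀ : En n} {ρ ρ' r R d L E b β : ℝ} (hsol : IsSupersol S f u G)
    (hf : IntegrableOn (fun x => |f x| ^ (q / p)) (ball x₀ R))
    (hr : 0 < r) (hr1 : r ≤ 1) (hrR : r < R) (hρ : ρ < ρ') (hρ' : ρ' ≤ r) (hR : ball x₀ R ⊆ S.Ω)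
    (hu0 : ∀ x ∈ ball x₀ R, 0 ≤ u x) (hd : dBound n p s q u f x₀ r R < d)
    (h : IsApprox p x₀ r u G w) (hψ : ContDiff ℝ 1 ψ)
    (hζ : ContDiff ℝ (⊤ : ℕ∞) fun x => ψ x ^ p) (hψ0 : ∀ x, 0 ≤ ψ x) (hψ1 : ∀ x, ψ x ≤ 1)
    (hL1 : 1 ≤ L) (hL : ∀ x, ‖gradient ψ x‖ ≤ L) (hsupp : tsupport ψ ⊆ closedBall x₀ ρ)
    (hLE : L ^ p ≤ E) (hρE : (1 - ρ / r) ^ (-((n : ℝ) + p * s)) * r ^ (-p) ≤ E)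
    (hb : 0 < b) (hbβ : b ≤ β) (hβp : β < p - 1) :
    ENNReal.ofReal (b * C₁ / 2) * ∫⁻ x in ball x₀ r,
        ENNReal.ofReal (‖G x‖ ^ p * (ψ x ^ p * (u x + d) ^ (p - 1 - β - p))) ≤
      (∫⁻ x in ball x₀ r, ENNReal.ofReal (|f x| * (ψ x ^ p * (u x + d) ^ (-β)))) +
      ENNReal.ofReal (caccConst n p s C₁ C₂ Λ b * E) *
        ∫⁻ x in ball x₀ ρ', ENNReal.ofReal ((u x + d) ^ (p - 1 - β)) := by
  have hp0 : 0 < p := by linarith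
  have hp1 : 0 < p - 1 := by linarith
  have hβ : 0 < β := hb.trans_le hbβ
  have h1s : 0 < 1 - s := by linarith
  have hΛ0 : 0 < Λ := by linarith [S.hΛ]
  have hC₁ := S.hC₁
  have hC₂ := S.hC₂
  have hsc := sphereConst_nonneg n
  have hd0 : 0 < d := (dBound_nonneg u f x₀ hr (hr.trans hrR)).trans_lt hd
  have hBR : ball x₀ r ⊆ ball x₀ R := ball_subset_ball hrR.le
  have hsupp' : tsupport ψ ⊆ ball x₀ ρ' := hsupp.trans (closedBall_subset_ball hρ)
  have hsuppζ : tsupport (fun x => ψ x ^ p) ⊆ closedBall x₀ ρ := by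
    refine (closure_minimal (fun x hx => ?_) isClosed_closedBall)
    refine hsupp (subset_tsupport _ fun h0 => hx ?_)
    simp only [h0, Real.zero_rpow hp0.ne']
  have hLpos : 0 < L := by linarith
  have hE0 : 0 ≤ E := (Real.rpow_nonneg hLpos.le p).trans hLE
  set Y := ∫⁻ x in ball x₀ ρ', ENNReal.ofReal ((u x + d) ^ (p - 1 - β)) with hY
  have hAm : Measurable (Function.uncurry fun ξ x => S.A x ξ) :=
    measurable_uncurry_of_continuous_of_measurable S.hAcont S.hAmeas
  have ha : AEStronglyMeasurable (fun x => S.A x (G x)) (volume.restrict (ball x₀ r)) :=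
    (hAm.comp_aemeasurable (h.aestronglyMeasurable.aemeasurable.prodMk
      aemeasurable_id)).aestronglyMeasurable
  have haG : ∀ᵐ x ∂(volume.restrict (ball x₀ r)),
      ‖S.A x (G x)‖ ≤ C₂ * ‖G x‖ ^ (p - 1) := by
    filter_upwards [ae_restrict_of_ae S.hAgrowth, ae_restrict_mem measurableSet_ball] with x hx hxB
    exact hx (hR (hBR hxB)) _
  have haC : ∀ᵐ x ∂(volume.restrict (ball x₀ r)), C₁ * ‖G x‖ ^ p ≤ ⟪S.A x (G x), G x⟫ := by
    filter_upwards [ae_restrict_of_ae S.hAcoerc, ae_restrict_mem measurableSet_ball] with x hx hxB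
    exact hx (hR (hBR hxB)) _
  have hgrad := h.lintegral_gradient_le (a := fun x => S.A x (G x)) (ε := b * C₁ / 2) (β := β)
    (d := d) hp hβ (by positivity)
    (by have := mul_le_mul_of_nonneg_right hbβ hC₁.le; linarith) hC₂.le hd0 ha haG haC hψ hψ0 hψ1 hL
    hρ' hsupp'
  have hen := IsSupersol.energy_le_rpow hn hp hs0 hs1 hpq hsol hf hr hr1 hrR (hρ.trans_le hρ') hR hu0 hd
    h hζ (fun x => Real.rpow_nonneg (hψ0 x) p) hsuppζ hβ
  have hnl := lintegral_fracMeas_Jp_le hn hp hs0 hs1 hβ hβp hd0 hLpos hρ' h.aemeasurable h.nonneg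
    hψ hψ0 hψ1 hL hsupp'
  have hT : ∫⁻ x in ball x₀ r, ENNReal.ofReal ((u x + d) ^ (p - 1) *
      (ψ x ^ p * (u x + d) ^ (-β))) ≤ Y := by
    have e : volume.restrict (ball x₀ ρ') = (volume.restrict (ball x₀ r)).restrict (ball x₀ ρ') := by
      rw [Measure.restrict_restrict measurableSet_ball, inter_eq_left.2 (ball_subset_ball hρ')]
    rw [hY, e, ← lintegral_indicator (s := ball x₀ ρ') measurableSet_ball]
    refine setLIntegral_mono' measurableSet_ball fun x hx => ?_
    have hv : 0 < u x + d := by linarith [h.nonneg x hx]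
    by_cases hx' : x ∈ ball x₀ ρ'
    · rw [indicator_of_mem hx']
      refine ENNReal.ofReal_le_ofReal ?_
      have z2 : ψ x ^ p ≤ 1 := Real.rpow_le_one (hψ0 x) (hψ1 x) (by linarith)
      calc _ = ψ x ^ p * ((u x + d) ^ (p - 1) * (u x + d) ^ (-β)) := by ring
        _ ≤ 1 * ((u x + d) ^ (p - 1) * (u x + d) ^ (-β)) := by gcongr
        _ = _ := by rw [one_mul, ← Real.rpow_add hv, ← sub_eq_add_neg]
    · have hz : ψ x = 0 := by
        by_contra h'
        exact hx' (hsupp' (subset_tsupport _ h'))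
      rw [hz, Real.zero_rpow hp0.ne']
      simp
  have hρr : 0 < 1 - ρ / r := by
    rw [sub_pos, div_lt_one hr]; linarith
  have k1 : (b * C₁ / 2) ^ (1 - p) * (C₂ * p * L) ^ p ≤
      (b * C₁ / 2) ^ (1 - p) * (C₂ * p) ^ p * E := by
    rw [Real.mul_rpow (by positivity) hLpos.le, ← mul_assoc]
    gcongr
  have k2 : Λ * (2 * (p * (p / β) ^ (p - 1)) *
      ((sphereConst n / (p * (1 - s)) + sphereConst n / (p * s)) * L ^ (p * s))) ≤
      Λ * (2 * (p * (p / b) ^ (p - 1)) *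
        (sphereConst n / (p * (1 - s)) + sphereConst n / (p * s))) * E := by
    have : L ^ (p * s) ≤ E := (Real.rpow_le_rpow_of_exponent_le hL1
      (mul_le_of_le_one_right hp0.le hs1.le)).trans hLE
    calc _ ≤ Λ * (2 * (p * (p / b) ^ (p - 1)) *
        ((sphereConst n / (p * (1 - s)) + sphereConst n / (p * s)) * E)) := by gcongr
      _ = _ := by ring
  have k3 : 2 ^ p * Λ * (1 - ρ / r) ^ (-((n : ℝ) + p * s)) * (sphereConst n / (p * s) + 1) *
      r ^ (-p) ≤ 2 ^ p * Λ * (sphereConst n / (p * s) + 1) * E := by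
    calc _ = 2 ^ p * Λ * (sphereConst n / (p * s) + 1) *
        ((1 - ρ / r) ^ (-((n : ℝ) + p * s)) * r ^ (-p)) := by ring
      _ ≤ _ := by gcongr
  have k : ENNReal.ofReal Λ * ENNReal.ofReal (2 * (p * (p / β) ^ (p - 1)) *
      ((sphereConst n / (p * (1 - s)) + sphereConst n / (p * s)) * L ^ (p * s))) +
      ENNReal.ofReal (2 ^ p * Λ * (1 - ρ / r) ^ (-((n : ℝ) + p * s)) *
        (sphereConst n / (p * s) + 1) * r ^ (-p)) +
      ENNReal.ofReal ((b * C₁ / 2) ^ (1 - p) * (C₂ * p * L) ^ p) ≤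
      ENNReal.ofReal (caccConst n p s C₁ C₂ Λ b * E) := by
    rw [← ENNReal.ofReal_mul hΛ0.le, ← ENNReal.ofReal_add (by positivity) (by positivity),
      ← ENNReal.ofReal_add (by positivity) (by positivity)]
    refine ENNReal.ofReal_le_ofReal ?_
    rw [caccConst, add_mul, add_mul]
    linarith
  refine hgrad.trans ((add_le_add (hen.trans (add_le_add le_rfl (add_le_add
    (mul_le_mul' le_rfl hnl) (mul_le_mul' le_rfl hT)))) le_rfl).trans ?_)
  calc _ = (∫⁻ x in ball x₀ r, ENNReal.ofReal (|f x| * (ψ x ^ p * (u x + d) ^ (-β)))) +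
      (ENNReal.ofReal Λ * ENNReal.ofReal (2 * (p * (p / β) ^ (p - 1)) *
      ((sphereConst n / (p * (1 - s)) + sphereConst n / (p * s)) * L ^ (p * s))) +
      ENNReal.ofReal (2 ^ p * Λ * (1 - ρ / r) ^ (-((n : ℝ) + p * s)) *
        (sphereConst n / (p * s) + 1) * r ^ (-p)) +
      ENNReal.ofReal ((b * C₁ / 2) ^ (1 - p) * (C₂ * p * L) ^ p)) * Y := by rw [← hY]; ring
    _ ≤ _ := by gcongr

end

section
open Filter

lemma exists_sobolev_const (n : ℕ) {p : ℝ} (hp : 1 < p) (hpn : p < n) :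
    ∃ C : ℝ, 0 < C ∧ ∀ g : En n → ℝ, ContDiff ℝ 1 g → HasCompactSupport g →
      (∫⁻ x, (‖g x‖ₑ ^ p) ^ ((n : ℝ) / (n - p))) ^ (1 / ((n : ℝ) / (n - p))) ≤
        ENNReal.ofReal C * ∫⁻ x, ‖gradient g x‖ₑ ^ p := by
  have hp0 : 0 < p := by linarith
  have hn0 : (0 : ℝ) < n := by linarith
  have hnp : 0 < (n : ℝ) - p := by linarith
  set κ := (n : ℝ) / (n - p) with hκ
  have hκ0 : 0 < κ := by positivity
  set P : ℝ≥0 := p.toNNReal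
  set P' : ℝ≥0 := (p * κ).toNNReal
  have hP : (P : ℝ) = p := Real.coe_toNNReal _ hp0.le
  have hP' : (P' : ℝ) = p * κ := Real.coe_toNNReal _ (by positivity)
  have hP0 : P ≠ 0 := by intro h; rw [h] at hP; simp at hP; linarith
  have hP'0 : P' ≠ 0 := by
    intro h; rw [h] at hP'; have : 0 < p * κ := by positivity
    simp only [NNReal.coe_zero] at hP'; linarith
  have hfr : Module.finrank ℝ (En n) = n := finrank_euclideanSpace_fin
  set c := SNormLESNormFDerivOfEqConst ℝ (volume : Measure (En n)) p with hc
  refine ⟨(c : ℝ) ^ p + 1, by positivity, fun g hg hgs => ?_⟩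
  have h1 := eLpNorm_le_eLpNorm_fderiv_of_eq (volume : Measure (En n)) hg hgs (p := P) (p' := P')
    (by rw [← NNReal.coe_le_coe, hP]; exact hp.le) (by rw [hfr]; exact_mod_cast hn0)
    (by rw [hfr, NNReal.coe_inv, hP, hP', hκ]; field_simp)
  rw [eLpNorm_eq_lintegral_rpow_enorm_toReal (by exact_mod_cast hP'0) ENNReal.coe_ne_top,
    eLpNorm_eq_lintegral_rpow_enorm_toReal (by exact_mod_cast hP0) ENNReal.coe_ne_top] at h1
  simp only [ENNReal.coe_toReal, hP, hP'] at h1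
  have h2 := ENNReal.rpow_le_rpow h1 hp0.le
  rw [← ENNReal.rpow_mul, ENNReal.mul_rpow_of_nonneg _ _ hp0.le, ← ENNReal.rpow_mul,
    one_div_mul_cancel hp0.ne', ENNReal.rpow_one] at h2
  simp only [← ENNReal.rpow_mul]
  have e1 : 1 / (p * κ) * p = 1 / κ := by field_simp
  rw [e1] at h2
  refine h2.trans (mul_le_mul' ?_ (le_of_eq ?_))
  · rw [← hc, ← ENNReal.ofReal_coe_nnreal, ENNReal.ofReal_rpow_of_nonneg (NNReal.coe_nonneg c) hp0.le]
    exact ENNReal.ofReal_le_ofReal (by linarith)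
  · congr 1
    ext x
    rw [← ofReal_norm, ← ofReal_norm, norm_gradient_eq]

/-- Sobolev inequality for powers of the limit of the approximating sequence. -/
lemma IsApprox.sobolev {n : ℕ} {p : ℝ} (hp : 1 < p) (hpn : p < n) :
    ∃ C : ℝ, 0 < C ∧ ∀ (x₀ : En n) (r : ℝ) (u : En n → ℝ) (G : En n → En n) (w : ℕ → En n → ℝ)
    (_ : IsApprox p x₀ r u G w) (ψ : En n → ℝ) (_ : ContDiff ℝ 1 ψ) (_ : ∀ x, 0 ≤ ψ x)
    (_ : ∀ x, ψ x ≤ 1) (L : ℝ) (_ : ∀ x, ‖gradient ψ x‖ ≤ L) (ρ : ℝ) (_ : ρ ≤ r)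
    (_ : tsupport ψ ⊆ ball x₀ ρ) (d t : ℝ) (_ : 0 < d) (_ : 0 < t) (_ : t ≤ p),
    (∫⁻ x in ball x₀ r, ENNReal.ofReal (ψ x ^ p * (u x + d) ^ t) ^ ((n : ℝ) / (n - p))) ^
      (1 / ((n : ℝ) / (n - p))) ≤
    ENNReal.ofReal C * (ENNReal.ofReal (L ^ p) *
      (∫⁻ x in ball x₀ ρ, ENNReal.ofReal ((u x + d) ^ t)) +
      ∫⁻ x in ball x₀ r, ENNReal.ofReal (‖G x‖ ^ p * (ψ x ^ p * (u x + d) ^ (t - p)))) := by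
  obtain ⟨C, hC0, hC⟩ := exists_sobolev_const n hp hpn
  have hp0 : 0 < p := by linarith
  have hp1 : 0 < p - 1 := by linarith
  have hn0 : (0 : ℝ) < n := by linarith
  have hnp : 0 < (n : ℝ) - p := by linarith
  have hκ0 : 0 < (n : ℝ) / (n - p) := by positivity
  set κ := (n : ℝ) / (n - p) with hκ
  refine ⟨C * (2 ^ (p - 1) * 2 ^ (p - 1)), by positivity, ?_⟩
  intro x₀ r u G w h ψ hψ hψ0 hψ1 L hL ρ hρ hsupp d t hd ht htp
  have hL0 : 0 ≤ L := (norm_nonneg _).trans (hL x₀)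
  set B := ball x₀ r with hB
  have hρB : ball x₀ ρ ⊆ B := ball_subset_ball hρ
  have hcs : HasCompactSupport ψ := (isCompact_closedBall x₀ ρ).of_isClosed_subset
    (isClosed_tsupport _) (hsupp.trans ball_subset_closedBall)
  have hu0 : ∀ᵐ x ∂(volume.restrict B), 0 ≤ u x := by
    filter_upwards [ae_restrict_mem measurableSet_ball] with x hx using h.nonneg x hx
  have hum := h.aemeasurable
  have hGm := h.aestronglyMeasurable
  have hwm : ∀ k, Measurable (w k) := fun k => (h.contDiff k).continuous.measurable
  have htp0 : 0 < t / p := by positivity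
  set g : ℕ → En n → ℝ := fun k x => ψ x * (w k x + d) ^ (t / p) with hg
  have hpow : ∀ k x, ‖g k x‖ₑ ^ p = ENNReal.ofReal (ψ x ^ p * (w k x + d) ^ t) := fun k x => by
    have hw := h.nonneg_approx k x
    have h0 : 0 ≤ g k x := mul_nonneg (hψ0 x) (Real.rpow_nonneg (by positivity) _)
    rw [← ofReal_norm, Real.norm_of_nonneg h0, ENNReal.ofReal_rpow_of_nonneg h0 hp0.le, hg,
      Real.mul_rpow (hψ0 x) (Real.rpow_nonneg (by positivity) _), ← Real.rpow_mul (by positivity),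
      div_mul_cancel₀ _ hp0.ne']
  have hS : ∀ k, (∫⁻ x in B, ENNReal.ofReal (ψ x ^ p * (w k x + d) ^ t) ^ κ) ^ (1 / κ) ≤
      ENNReal.ofReal C * ∫⁻ x in B, ‖gradient (g k) x‖ₑ ^ p := fun k => by
    have h1 := hC (g k) (contDiff_mul_rpow hψ (h.contDiff_one k) hd (h.nonneg_approx k))
      (hcs.mul_right)
    simp only [hpow] at h1
    refine le_trans ?_ (h1.trans (le_of_eq ?_))
    · exact ENNReal.rpow_le_rpow (setLIntegral_le_lintegral _ _) (by positivity)
    · rw [setLIntegral_eq_of_support_subset]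
      intro x hx
      by_contra hxB
      apply hx
      simp only
      rw [gradient_eq_zero_of_notMem_tsupport, enorm_zero, ENNReal.zero_rpow_of_pos hp0]
      exact fun h' => hxB (hρB (hsupp (tsupport_mul_subset_left h')))
  set Q : ℕ → En n → ℝ≥0∞ := fun k x => ‖gradient (w k) x - G x‖ₑ ^ p with hQ
  set Y : ℕ → En n → ℝ≥0∞ := fun k x => ‖(w k x + d) ^ t - (u x + d) ^ t‖ₑ with hY
  set I : ℕ → ℝ≥0∞ := fun k => ∫⁻ x in B, ENNReal.ofReal (‖G x‖ ^ p *
    (ψ x ^ p * (w k x + d) ^ (-(p - t)))) with hI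
  set I' : ℝ≥0∞ := ∫⁻ x in B, ENNReal.ofReal (‖G x‖ ^ p *
    (ψ x ^ p * (u x + d) ^ (-(p - t)))) with hI'
  set V : ℝ≥0∞ := ∫⁻ x in ball x₀ ρ, ENNReal.ofReal ((u x + d) ^ t) with hV
  have hYm : ∀ k, AEMeasurable (Y k) (volume.restrict B) := fun k =>
    ((((hwm k).add_const d).pow_const _).aemeasurable.sub ((hum.add_const d).pow_const _)).enorm
  have hQm : ∀ k, AEMeasurable (Q k) (volume.restrict B) := fun k =>
    (((continuous_gradient (h.contDiff_one k)).aestronglyMeasurable.sub hGm).enorm).pow_const _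
  have hGp : ∀ x, ‖G x‖ₑ ^ p = ENNReal.ofReal (‖G x‖ ^ p) := fun x => by
    rw [← ofReal_norm, ENNReal.ofReal_rpow_of_nonneg (norm_nonneg _) hp0.le]
  have hIlim : Tendsto I atTop (𝓝 I') := by
    refine h.tendsto_lintegral_mul_rpow_neg (g := fun x => ‖G x‖ ^ p) (ζ := fun x => ψ x ^ p)
      (M := 1) (hψ.continuous.measurable.pow_const _)
      (fun x => Real.rpow_nonneg (hψ0 x) _) (fun x => Real.rpow_le_one (hψ0 x) (hψ1 x) hp0.le) hd
      (by linarith) (hGm.norm.aemeasurable.pow_const _)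
      (fun x _ => Real.rpow_nonneg (norm_nonneg _) _) ?_
    simp only [← hGp]
    exact h.lintegral_grad_ne_top
  have hYlim : Tendsto (fun k => ∫⁻ x in B, Y k x) atTop (𝓝 0) := by
    have h2 : (2 : ℝ≥0∞) ^ (p - 1) ≠ ⊤ := ENNReal.rpow_ne_top_of_nonneg hp1.le (by simp)
    have hone : ∀ {b : ℝ}, 0 ≤ b → b ^ t ≤ 1 + b ^ p := fun {b} hb => by
      rcases le_total b 1 with h1 | h1
      · have := Real.rpow_le_one hb h1 ht.le
        have := Real.rpow_nonneg hb p
        linarith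
      · have := Real.rpow_le_rpow_of_exponent_le h1 htp
        linarith
    have hone' : ∀ {b : ℝ}, 0 ≤ b → ENNReal.ofReal (b ^ t) ≤ 1 + ENNReal.ofReal b ^ p :=
      fun {b} hb => by
        rw [ENNReal.ofReal_rpow_of_nonneg hb hp0.le, ← ENNReal.ofReal_one,
          ← ENNReal.ofReal_add zero_le_one (Real.rpow_nonneg hb _)]
        exact ENNReal.ofReal_le_ofReal (hone hb)
    refine tendsto_lintegral_zero_of_le_add (E := fun k x => 2 ^ (p - 1) * ‖w k x - u x‖ₑ ^ p)
      (D := fun x => 2 + (1 + 2 ^ (p - 1)) * ENNReal.ofReal ((u x + d) ^ p))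
      hYm (fun k => ((((hwm k).aemeasurable.sub hum).enorm).pow_const _).const_mul _)
      ((((hum.add_const d).pow_const _).ennreal_ofReal.const_mul _).const_add _) (fun k => ?_) ?_
      ?_ ?_
    · filter_upwards [hu0] with x hux
      have hw := h.nonneg_approx k x
      have hwd : 0 ≤ w k x + d := by positivity
      have hud : 0 ≤ u x + d := by positivity
      calc Y k x ≤ ENNReal.ofReal ((w k x + d) ^ t) + ENNReal.ofReal ((u x + d) ^ t) := by
            simp only [hY]
            rw [← ENNReal.ofReal_add (Real.rpow_nonneg hwd _) (Real.rpow_nonneg hud _),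
              ← ofReal_norm, Real.norm_eq_abs]
            have a1 := Real.rpow_nonneg hwd t
            have a2 := Real.rpow_nonneg hud t
            exact ENNReal.ofReal_le_ofReal (abs_le.2 ⟨by linarith, by linarith⟩)
        _ ≤ (1 + ENNReal.ofReal (w k x + d) ^ p) + (1 + ENNReal.ofReal (u x + d) ^ p) :=
            add_le_add (hone' hwd) (hone' hud)
        _ ≤ (1 + 2 ^ (p - 1) * (‖w k x - u x‖ₑ ^ p + ENNReal.ofReal (u x + d) ^ p)) +
            (1 + ENNReal.ofReal (u x + d) ^ p) := by
            gcongr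
            refine le_trans ?_ (ENNReal.rpow_add_le_mul_rpow_add_rpow _ _ hp.le)
            refine ENNReal.rpow_le_rpow ?_ hp0.le
            rw [← ofReal_norm, ← ENNReal.ofReal_add (norm_nonneg _) hud]
            refine ENNReal.ofReal_le_ofReal ?_
            have := le_abs_self (w k x - u x)
            rw [Real.norm_eq_abs]
            linarith
        _ = _ := by
            rw [ENNReal.ofReal_rpow_of_nonneg hud hp0.le]
            ring
    · rw [lintegral_add_left measurable_const, setLIntegral_const,
        lintegral_const_mul' _ _ (by finiteness)]
      exact ENNReal.add_ne_top.2 ⟨ENNReal.mul_ne_top (by simp) measure_ball_lt_top.ne,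
        ENNReal.mul_ne_top (by finiteness) (h.lintegral_add_rpow_ne_top hp hd.le)⟩
    · have := ENNReal.Tendsto.const_mul (a := 2 ^ (p - 1)) h.tendsto (Or.inr h2)
      rw [mul_zero] at this
      simpa only [lintegral_const_mul' _ _ h2] using this
    · filter_upwards [hu0, h.ae_tendsto] with x hux hx
      have h3 := (((hx.add_const d).rpow_const (p := t)
        (Or.inl (by linarith))).sub_const ((u x + d) ^ t)).enorm
      rwa [sub_self, enorm_zero] at h3
  have hbd : ∀ k, ∫⁻ x in B, ‖gradient (g k) x‖ₑ ^ p ≤ 2 ^ (p - 1) * (ENNReal.ofReal (L ^ p) *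
      (V + ∫⁻ x in B, Y k x) + 2 ^ (p - 1) * (I k + ENNReal.ofReal (d ^ (t - p)) *
        ∫⁻ x in B, Q k x)) := by
    intro k
    set A₁ : En n → ℝ≥0∞ := (ball x₀ ρ).indicator fun x => ENNReal.ofReal ((u x + d) ^ t) with hA₁
    set A₂ : En n → ℝ≥0∞ := fun x => ENNReal.ofReal (‖G x‖ ^ p *
      (ψ x ^ p * (w k x + d) ^ (-(p - t)))) with hA₂
    have hA₁m : AEMeasurable A₁ (volume.restrict B) :=
      (((hum.add_const d).pow_const _).ennreal_ofReal).indicator measurableSet_ball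
    have hA₂m : AEMeasurable A₂ (volume.restrict B) :=
      ((hGm.norm.aemeasurable.pow_const _).mul (((hψ.continuous.measurable.pow_const _).mul
        (((hwm k).add_const d).pow_const _)).aemeasurable)).ennreal_ofReal
    have hV' : V = ∫⁻ x in B, A₁ x := by
      rw [hA₁, lintegral_indicator measurableSet_ball, Measure.restrict_restrict measurableSet_ball,
        inter_eq_left.2 hρB]
    have h2 : (2 : ℝ≥0∞) ^ (p - 1) ≠ ⊤ := ENNReal.rpow_ne_top_of_nonneg hp1.le (by simp)
    have hpt : ∀ᵐ x ∂(volume.restrict B), ‖gradient (g k) x‖ₑ ^ p ≤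
        2 ^ (p - 1) * (ENNReal.ofReal (L ^ p) * (A₁ x + Y k x) + 2 ^ (p - 1) * (A₂ x +
          ENNReal.ofReal (d ^ (t - p)) * Q k x)) := by
      filter_upwards [hu0] with x hux
      by_cases hx : x ∈ ball x₀ ρ
      swap
      · rw [gradient_eq_zero_of_notMem_tsupport fun h' =>
          hx (hsupp (tsupport_mul_subset_left h')), enorm_zero, ENNReal.zero_rpow_of_pos hp0]
        exact zero_le
      have hw := h.nonneg_approx k x
      have hwd : 0 < w k x + d := by positivity
      have hud : 0 < u x + d := by positivity
      have hψx := hψ0 x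
      have ha : ‖(w k x + d) ^ (t / p) • gradient ψ x‖ₑ ^ p ≤
          ENNReal.ofReal (L ^ p) * (A₁ x + Y k x) := by
        have e1 : ‖(w k x + d) ^ (t / p) • gradient ψ x‖ ^ p ≤ L ^ p * (w k x + d) ^ t := by
          rw [norm_smul, Real.norm_of_nonneg (by positivity), Real.mul_rpow (by positivity)
            (norm_nonneg _), ← Real.rpow_mul hwd.le, div_mul_cancel₀ _ hp0.ne', mul_comm]
          gcongr
          exact hL x
        rw [← ofReal_norm, ENNReal.ofReal_rpow_of_nonneg (norm_nonneg _) hp0.le]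
        refine (ENNReal.ofReal_le_ofReal e1).trans ?_
        rw [ENNReal.ofReal_mul (by positivity)]
        gcongr
        simp only [hA₁, hY, indicator_of_mem hx]
        rw [← ofReal_norm, ← ENNReal.ofReal_add (by positivity) (norm_nonneg _), Real.norm_eq_abs]
        refine ENNReal.ofReal_le_ofReal ?_
        have := le_abs_self ((w k x + d) ^ t - (u x + d) ^ t)
        linarith
      have hb : ‖(t / p * ψ x * (w k x + d) ^ (t / p - 1)) • gradient (w k) x‖ₑ ^ p ≤
          2 ^ (p - 1) * (A₂ x + ENNReal.ofReal (d ^ (t - p)) * Q k x) := by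
        have e1 : ‖t / p * ψ x * (w k x + d) ^ (t / p - 1)‖ₑ ^ p ≤
            ENNReal.ofReal (ψ x ^ p * (w k x + d) ^ (-(p - t))) := by
          rw [← ofReal_norm, ENNReal.ofReal_rpow_of_nonneg (norm_nonneg _) hp0.le]
          refine ENNReal.ofReal_le_ofReal ?_
          rw [Real.norm_of_nonneg (by positivity), Real.mul_rpow (by positivity) (by positivity),
            Real.mul_rpow (by positivity) (by positivity), ← Real.rpow_mul hwd.le,
            sub_mul, one_mul, div_mul_cancel₀ _ hp0.ne', neg_sub]
          have : (t / p) ^ p ≤ 1 := Real.rpow_le_one htp0.le ((div_le_one hp0).2 htp) hp0.le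
          gcongr
          exact mul_le_of_le_one_left (by positivity) this
        have e2 : ENNReal.ofReal (ψ x ^ p * (w k x + d) ^ (-(p - t))) ≤
            ENNReal.ofReal (d ^ (t - p)) := by
          refine ENNReal.ofReal_le_ofReal ?_
          rw [← neg_sub p t]
          have e3 := rpow_neg_le_of_le (β := p - t) (by linarith) hd (a := w k x + d) (by linarith)
          have e4 : ψ x ^ p ≤ 1 := Real.rpow_le_one hψx (hψ1 x) hp0.le
          exact (mul_le_of_le_one_left (by positivity) e4).trans e3
        have e5 : ‖gradient (w k) x‖ₑ ^ p ≤ 2 ^ (p - 1) * (‖G x‖ₑ ^ p + Q k x) := by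
          refine le_trans ?_ (ENNReal.rpow_add_le_mul_rpow_add_rpow _ _ hp.le)
          refine ENNReal.rpow_le_rpow ?_ hp0.le
          have := enorm_add_le (G x) (gradient (w k) x - G x)
          rwa [add_sub_cancel] at this
        have e6 : A₂ x = ENNReal.ofReal (ψ x ^ p * (w k x + d) ^ (-(p - t))) * ‖G x‖ₑ ^ p := by
          simp only [hA₂]
          rw [hGp, mul_comm, ENNReal.ofReal_mul (by positivity)]
        rw [enorm_smul, ENNReal.mul_rpow_of_nonneg _ _ hp0.le, e6]
        calc _ ≤ ENNReal.ofReal (ψ x ^ p * (w k x + d) ^ (-(p - t))) *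
              (2 ^ (p - 1) * (‖G x‖ₑ ^ p + Q k x)) := mul_le_mul' e1 e5
          _ = 2 ^ (p - 1) * (ENNReal.ofReal (ψ x ^ p * (w k x + d) ^ (-(p - t))) * ‖G x‖ₑ ^ p +
              ENNReal.ofReal (ψ x ^ p * (w k x + d) ^ (-(p - t))) * Q k x) := by ring
          _ ≤ _ := by gcongr
      simp only [hg]
      rw [gradient_mul_rpow hψ (h.contDiff_one k) hd (h.nonneg_approx k)]
      refine (ENNReal.rpow_le_rpow (enorm_add_le _ _) hp0.le).trans ?_
      refine (ENNReal.rpow_add_le_mul_rpow_add_rpow _ _ hp.le).trans ?_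
      exact mul_le_mul' le_rfl (add_le_add ha hb)
    refine (lintegral_mono_ae hpt).trans (le_of_eq ?_)
    have hm : AEMeasurable (fun x => ENNReal.ofReal (L ^ p) * (A₁ x + Y k x))
      (volume.restrict B) := (hA₁m.add (hYm k)).const_mul _
    rw [lintegral_const_mul' _ _ h2, lintegral_add_left' hm,
      lintegral_const_mul' _ _ ENNReal.ofReal_ne_top, lintegral_add_left' hA₁m,
      lintegral_const_mul' _ _ h2, lintegral_add_left' hA₂m,
      lintegral_const_mul' _ _ ENNReal.ofReal_ne_top, hV']
  have hRlim : Tendsto (fun k => 2 ^ (p - 1) * (ENNReal.ofReal (L ^ p) *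
      (V + ∫⁻ x in B, Y k x) + 2 ^ (p - 1) * (I k + ENNReal.ofReal (d ^ (t - p)) *
        ∫⁻ x in B, Q k x))) atTop (𝓝 (2 ^ (p - 1) * (ENNReal.ofReal (L ^ p) *
      (V + 0) + 2 ^ (p - 1) * (I' + ENNReal.ofReal (d ^ (t - p)) * 0)))) := by
    have h2 : (2 : ℝ≥0∞) ^ (p - 1) ≠ ⊤ := ENNReal.rpow_ne_top_of_nonneg hp1.le (by simp)
    refine ENNReal.Tendsto.const_mul (Tendsto.add (ENNReal.Tendsto.const_mul
      (tendsto_const_nhds.add hYlim) (Or.inr ENNReal.ofReal_ne_top)) (ENNReal.Tendsto.const_mul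
      (hIlim.add (ENNReal.Tendsto.const_mul h.tendsto_grad (Or.inr ENNReal.ofReal_ne_top)))
      (Or.inr h2))) (Or.inr h2)
  rw [mul_zero, add_zero, add_zero] at hRlim
  have hfinal : (∫⁻ x in B, ENNReal.ofReal (ψ x ^ p * (u x + d) ^ t) ^ κ) ^ (1 / κ) ≤
      ENNReal.ofReal C * (2 ^ (p - 1) * (ENNReal.ofReal (L ^ p) * V + 2 ^ (p - 1) * I')) := by
    rw [one_div, ENNReal.rpow_inv_le_iff hκ0]
    have hlim := ((ENNReal.continuous_rpow_const (y := κ)).tendsto _).comp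
      (ENNReal.Tendsto.const_mul (a := ENNReal.ofReal C) hRlim (Or.inr ENNReal.ofReal_ne_top))
    have hF : ∫⁻ x in B, ENNReal.ofReal (ψ x ^ p * (u x + d) ^ t) ^ κ ≤
        liminf (fun k => ∫⁻ x in B, ENNReal.ofReal (ψ x ^ p * (w k x + d) ^ t) ^ κ) atTop := by
      refine le_trans (lintegral_mono_ae ?_) (lintegral_liminf_le' fun k => ?_)
      · filter_upwards [h.ae_tendsto, hu0] with x hx hux
        have := ((ENNReal.continuous_rpow_const (y := κ)).tendsto _).comp
          ((ENNReal.continuous_ofReal.tendsto _).comp (((hx.add_const d).rpow_const (p := t)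
          (Or.inl (by linarith))).const_mul (ψ x ^ p)))
        exact this.liminf_eq.ge
      · exact (((hψ.continuous.measurable.pow_const _).mul
          (((hwm k).add_const d).pow_const _)).ennreal_ofReal.pow_const _).aemeasurable
    refine hF.trans ((liminf_le_liminf (Eventually.of_forall fun k => ?_)).trans_eq
      hlim.liminf_eq)
    simp only [Function.comp]
    rw [← ENNReal.rpow_inv_le_iff hκ0, ← one_div]
    exact (hS k).trans (by gcongr; exact hbd k)
  refine hfinal.trans ?_
  have e2 : (2 : ℝ≥0∞) ^ (p - 1) = ENNReal.ofReal (2 ^ (p - 1)) := by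
    rw [← ENNReal.ofReal_rpow_of_pos (by norm_num)]; simp
  have e3 : ENNReal.ofReal (L ^ p) * V ≤ 2 ^ (p - 1) * (ENNReal.ofReal (L ^ p) * V) := by
    refine le_mul_of_one_le_left' ?_
    exact ENNReal.one_le_rpow (by norm_num) hp1
  rw [ENNReal.ofReal_mul hC0.le, ENNReal.ofReal_mul (by positivity), ← e2]
  simp only [hI', neg_sub]
  calc _ ≤ ENNReal.ofReal C * (2 ^ (p - 1) * (2 ^ (p - 1) * (ENNReal.ofReal (L ^ p) * V) +
        2 ^ (p - 1) * ∫⁻ x in B, ENNReal.ofReal (‖G x‖ ^ p * (ψ x ^ p * (u x + d) ^ (t - p))))) := by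
        gcongr
    _ = _ := by ring

end

lemma exists_deriv_smoothTransition_le : ∃ M : ℝ, 0 < M ∧ ∀ t, |deriv smoothTransition t| ≤ M := by
  have hcont : Continuous (deriv smoothTransition) :=
    (smoothTransition.contDiff (n := 1)).continuous_deriv le_rfl
  obtain ⟨M, hM⟩ := isCompact_Icc.exists_bound_of_continuousOn (s := Icc (0 : ℝ) 1)
    hcont.continuousOn
  refine ⟨max M 1, by positivity, fun t => ?_⟩
  rcases lt_or_ge t 0 with h | h
  · have : smoothTransition =ᶠ[𝓝 t] fun _ => 0 := by
      filter_upwards [Iio_mem_nhds h] with y hy using smoothTransition.zero_of_nonpos (le_of_lt hy)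
    rw [this.deriv_eq]
    simp
  rcases lt_or_ge 1 t with h1 | h1
  · have : smoothTransition =ᶠ[𝓝 t] fun _ => 1 := by
      filter_upwards [Ioi_mem_nhds h1] with y hy using smoothTransition.one_of_one_le (le_of_lt hy)
    rw [this.deriv_eq]
    simp
  · exact (hM t ⟨h, h1⟩).trans (le_max_left _ _)

/-- Cutoff functions whose `p`-th power is smooth. -/
lemma exists_cutoff (n : ℕ) {p : ℝ} (hp : 1 < p) (hpn : p < n) :
    ∃ c : ℝ, 1 ≤ c ∧ ∀ (x₀ : En n) (ρ₁ ρ₂ : ℝ), 0 < ρ₁ → ρ₁ < ρ₂ → ∃ ψ : En n → ℝ,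
      ContDiff ℝ 1 ψ ∧ ContDiff ℝ (⊤ : ℕ∞) (fun x => ψ x ^ p) ∧ (∀ x, 0 ≤ ψ x) ∧ (∀ x, ψ x ≤ 1) ∧
      (∀ x, ‖gradient ψ x‖ ≤ c / (ρ₂ - ρ₁)) ∧ (∀ x ∈ ball x₀ ρ₁, ψ x = 1) ∧
      tsupport ψ ⊆ closedBall x₀ ρ₂ := by
  obtain ⟨M, hM0, hM⟩ := exists_deriv_smoothTransition_le
  have hp0 : 0 < p := by linarith
  have hn0 : (0 : ℝ) < n := by linarith
  have hnp : 1 ≤ (n : ℝ) / p := by rw [le_div_iff₀ hp0]; linarith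
  refine ⟨n / p * (2 * M) + 1, le_add_of_nonneg_left (by positivity), ?_⟩
  intro x₀ ρ₁ ρ₂ h1 h12
  have h2 : 0 < ρ₂ := h1.trans h12
  have h21 : 0 < ρ₂ - ρ₁ := by linarith
  set D := ρ₂ ^ 2 - ρ₁ ^ 2 with hD
  have hDf : D = (ρ₂ - ρ₁) * (ρ₂ + ρ₁) := by rw [hD]; ring
  have hD0 : 0 < D := by rw [hDf]; positivity
  set g : En n → ℝ := fun x => (ρ₂ ^ 2 - ‖x - x₀‖ ^ 2) / D with hg
  have hgc : ContDiff ℝ (⊤ : ℕ∞) g :=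
    ((contDiff_const (c := ρ₂ ^ 2)).sub ((contDiff_id.sub contDiff_const).norm_sq ℝ)).div_const D
  set η : En n → ℝ := fun x => smoothTransition (g x) with hη
  have hηc : ContDiff ℝ (⊤ : ℕ∞) η := smoothTransition.contDiff.comp hgc
  have hη0 : ∀ x, 0 ≤ η x := fun x => smoothTransition.nonneg _
  have hη1 : ∀ x, η x ≤ 1 := fun x => smoothTransition.le_one _
  have hηs : tsupport η ⊆ closedBall x₀ ρ₂ := by
    refine closure_minimal (fun x hx => ?_) isClosed_closedBall
    by_contra h'
    apply hx
    refine smoothTransition.zero_of_nonpos (div_nonpos_of_nonpos_of_nonneg ?_ hD0.le)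
    rw [mem_closedBall, dist_eq_norm, not_le] at h'
    nlinarith
  have hgrad : ∀ x, ‖gradient η x‖ ≤ 2 * M / (ρ₂ - ρ₁) := by
    intro x
    by_cases hx : x ∈ closedBall x₀ ρ₂
    swap
    · rw [gradient_eq_zero_of_notMem_tsupport fun h' => hx (hηs h'), norm_zero]
      positivity
    have hgd : HasFDerivAt g (D⁻¹ • -((2 : ℝ) • innerSL ℝ (x - x₀))) x := by
      have e1 : HasFDerivAt (fun y : En n => ‖y - x₀‖ ^ 2) ((2 : ℝ) • innerSL ℝ (x - x₀)) x := by
        have := ((hasFDerivAt_id x).sub_const x₀).norm_sq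
        rwa [ContinuousLinearMap.comp_id, ← Nat.cast_smul_eq_nsmul ℝ, Nat.cast_ofNat] at this
      have e2 := (e1.const_sub (ρ₂ ^ 2)).const_smul D⁻¹
      refine e2.congr_of_eventuallyEq (Filter.Eventually.of_forall fun y => ?_)
      simp only [hg, smul_eq_mul, div_eq_inv_mul, Pi.smul_apply]
    have hΦ : HasDerivAt smoothTransition (deriv smoothTransition (g x)) (g x) :=
      ((smoothTransition.contDiff (n := 1)).differentiable one_ne_zero _).hasDerivAt
    have := hΦ.comp_hasFDerivAt x hgd
    have hf : fderiv ℝ η x = _ := this.fderiv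
    rw [norm_gradient_eq, hf, norm_smul, norm_smul, norm_neg, norm_smul, innerSL_apply_norm,
      Real.norm_eq_abs, Real.norm_of_nonneg (by positivity), Real.norm_of_nonneg (by norm_num)]
    rw [mem_closedBall, dist_eq_norm] at hx
    calc _ ≤ M * (D⁻¹ * (2 * ρ₂)) := by gcongr; exact hM _
      _ = 2 * M / (ρ₂ - ρ₁) * (ρ₂ / (ρ₂ + ρ₁)) := by rw [hDf]; field_simp
      _ ≤ 2 * M / (ρ₂ - ρ₁) * 1 := by
        gcongr
        rw [div_le_one (by positivity)]
        linarith
      _ = _ := mul_one _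
  have hη1c : ContDiff ℝ 1 η := hηc.of_le (by exact_mod_cast le_top)
  refine ⟨fun x => η x ^ ((n : ℝ) / p), hη1c.rpow_const_of_le (by exact_mod_cast hnp), ?_,
    fun x => Real.rpow_nonneg (hη0 x) _, fun x => Real.rpow_le_one (hη0 x) (hη1 x) (by positivity),
    fun x => ?_, fun x hx => ?_, ?_⟩
  · have : (fun x => (η x ^ ((n : ℝ) / p)) ^ p) = fun x => η x ^ n := by
      ext x
      rw [← Real.rpow_mul (hη0 x), div_mul_cancel₀ _ hp0.ne', Real.rpow_natCast]
    rw [this]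
    exact hηc.pow n
  · rw [gradient_rpow hnp hη1c, norm_smul, Real.norm_of_nonneg (by have := hη0 x; positivity)]
    have e1 : η x ^ ((n : ℝ) / p - 1) ≤ 1 := Real.rpow_le_one (hη0 x) (hη1 x) (by linarith)
    have e0 := Real.rpow_nonneg (hη0 x) ((n : ℝ) / p - 1)
    calc _ ≤ (n : ℝ) / p * 1 * (2 * M / (ρ₂ - ρ₁)) := by gcongr; exact hgrad x
      _ = (n : ℝ) / p * (2 * M) / (ρ₂ - ρ₁) := by ring
      _ ≤ _ := by gcongr; linarith
  · have : 1 ≤ g x := by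
      rw [mem_ball, dist_eq_norm] at hx
      simp only [hg]
      rw [le_div_iff₀ hD0, one_mul, hD]
      have := norm_nonneg (x - x₀)
      nlinarith
    simp only [hη]
    rw [smoothTransition.one_of_one_le this, Real.one_rpow]
  · refine (closure_mono fun x hx => ?_).trans hηs
    intro h0
    apply hx
    simp only [h0]
    exact Real.zero_rpow (by positivity)

section
open Filter

lemma le_of_le_add_rpow_mul_rpow {a B C X W τ : ℝ} (ha : 0 < a) (hB : 0 ≤ B) (hC : 0 < C)
    (hX : 0 ≤ X) (hW : 0 ≤ W) (hτ1 : τ < 1)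
    (h : a * X ≤ B + C * (X ^ τ * W ^ (1 - τ))) :
    X ≤ 2 * B / a + (2 * C / a) ^ (1 / (1 - τ)) * W := by
  have h1τ : 0 < 1 - τ := by linarith
  have hBa : 0 ≤ 2 * B / a := by positivity
  rcases le_or_gt X ((2 * C / a) ^ (1 / (1 - τ)) * W) with h1 | h1
  · linarith
  have h2 : (2 * C / a) * W ^ (1 - τ) ≤ X ^ (1 - τ) := by
    have := Real.rpow_le_rpow (by positivity) h1.le h1τ.le
    rwa [Real.mul_rpow (by positivity) hW, ← Real.rpow_mul (by positivity),
      one_div_mul_cancel h1τ.ne', Real.rpow_one] at this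
  have h3 : X ^ τ * X ^ (1 - τ) = X := by
    rw [← Real.rpow_add' hX (by norm_num), add_sub_cancel, Real.rpow_one]
  have h4 : C * (X ^ τ * W ^ (1 - τ)) ≤ a / 2 * X := by
    calc _ = a / 2 * (X ^ τ * ((2 * C / a) * W ^ (1 - τ))) := by field_simp
      _ ≤ a / 2 * (X ^ τ * X ^ (1 - τ)) := by gcongr
      _ = _ := by rw [h3]
  have h5 : X ≤ 2 * B / a := by
    rw [le_div_iff₀ ha]
    linarith
  have : 0 ≤ (2 * C / a) ^ (1 / (1 - τ)) * W := by positivity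
  linarith

/-- Bound of the source term by the `L^κ` and `L^1` norms of the tested power. -/
lemma lintegral_source_le {n : ℕ} {p s q t : ℝ} (hp : 1 < p) (hpn : p < n) (hqn : (n : ℝ) < q)
    {u f ψ : En n → ℝ} {x₀ : En n} {ρ r R d : ℝ}
    (hf : IntegrableOn (fun x => |f x| ^ (q / p)) (ball x₀ R))
    (hr : 0 < r) (hrR : r < R) (hρ : ρ ≤ r) (hum : AEMeasurable u (volume.restrict (ball x₀ r)))
    (hu0 : ∀ x ∈ ball x₀ r, 0 ≤ u x) (hd : dBound n p s q u f x₀ r R < d)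
    (hψm : Measurable ψ) (hψ0 : ∀ x, 0 ≤ ψ x) (hψ1 : ∀ x, ψ x ≤ 1)
    (hsupp : tsupport ψ ⊆ ball x₀ ρ) :
    ∫⁻ x in ball x₀ r, ENNReal.ofReal (|f x| * (ψ x ^ p * (u x + d) ^ (-(p - 1 - t)))) ≤
      ENNReal.ofReal (r ^ (-(p * (1 - n / q)))) *
        (((∫⁻ x in ball x₀ r, ENNReal.ofReal (ψ x ^ p * (u x + d) ^ t) ^ ((n : ℝ) / (n - p))) ^
          (1 / ((n : ℝ) / (n - p)))) ^ ((n : ℝ) / q) *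
        (∫⁻ x in ball x₀ ρ, ENNReal.ofReal ((u x + d) ^ t)) ^ (1 - (n : ℝ) / q)) := by
  have hp0 : 0 < p := by linarith
  have hn0 : (0 : ℝ) < n := by linarith
  have hq0 : 0 < q := by linarith
  have hnp : 0 < (n : ℝ) - p := by linarith
  have hR : 0 < R := hr.trans hrR
  have hd0 : 0 < d := (dBound_nonneg u f x₀ hr hR).trans_lt hd
  have hm0 : 0 < q / p := by positivity
  set B := ball x₀ r with hB
  have hBR : B ⊆ ball x₀ R := ball_subset_ball hrR.le
  have hτ0 : 0 ≤ (n : ℝ) / q := by positivity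
  have hτ1 : (n : ℝ) / q ≤ 1 := by rw [div_le_one hq0]; exact hqn.le
  have hfB : Integrable (fun x => |f x| ^ (q / p)) (volume.restrict B) := hf.mono_set hBR
  have hfm : AEMeasurable (fun x => ENNReal.ofReal |f x|) (volume.restrict B) :=
    (aemeasurable_abs_of_integrable_rpow hm0 hfB).ennreal_ofReal
  have hhm : AEMeasurable (fun x => ENNReal.ofReal (ψ x ^ p * (u x + d) ^ t))
      (volume.restrict B) :=
    ((hψm.pow_const p).aemeasurable.mul ((hum.add_const d).pow_const _)).ennreal_ofReal
  have hH := lintegral_mul_rpow_le (m := q / p) (κ := (n : ℝ) / (n - p)) (τ := (n : ℝ) / q)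
    hfm hhm hm0 (by positivity) hτ0 hτ1 (by field_simp; ring)
  have hY : ∫⁻ x in B, ENNReal.ofReal (ψ x ^ p * (u x + d) ^ t) ≤
      ∫⁻ x in ball x₀ ρ, ENNReal.ofReal ((u x + d) ^ t) := by
    have e : volume.restrict (ball x₀ ρ) = (volume.restrict B).restrict (ball x₀ ρ) := by
      rw [Measure.restrict_restrict measurableSet_ball, inter_eq_left.2 (ball_subset_ball hρ)]
    rw [e, ← lintegral_indicator (s := ball x₀ ρ) measurableSet_ball]
    refine setLIntegral_mono' measurableSet_ball fun x hx => ?_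
    have hv : 0 < u x + d := by linarith [hu0 x hx]
    by_cases hx' : x ∈ ball x₀ ρ
    · rw [indicator_of_mem hx']
      exact ENNReal.ofReal_le_ofReal (mul_le_of_le_one_left (by positivity)
        (Real.rpow_le_one (hψ0 x) (hψ1 x) hp0.le))
    · have hz : ψ x = 0 := by
        by_contra h'
        exact hx' (hsupp (subset_tsupport _ h'))
      rw [hz, Real.zero_rpow hp0.ne']
      simp
  have hN : (∫⁻ x in B, ENNReal.ofReal |f x| ^ (q / p)) ^ (1 / (q / p)) ≤
      ENNReal.ofReal (normLp (q / p) f (ball x₀ R)) := by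
    rw [normLp, ← ENNReal.ofReal_rpow_of_nonneg (integral_nonneg fun _ => by positivity)
      (by positivity), ofReal_integral_eq_lintegral_ofReal hf (ae_of_all _ fun _ => by positivity)]
    refine ENNReal.rpow_le_rpow ?_ (by positivity)
    refine (lintegral_congr fun x => ?_).trans_le (lintegral_mono_set hBR)
    rw [ENNReal.ofReal_rpow_of_nonneg (abs_nonneg _) hm0.le]
  have hnorm : d ^ (1 - p) * normLp (q / p) f (ball x₀ R) ≤ r ^ (-(p * (1 - n / q))) := by
    have h1 := normLp_le_of_dBound hp hq0 hr hR hd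
    have h2 : r ^ (p * (1 - n / q)) ≤ r ^ (p - n) * R ^ (n * (q - p) / q) := by
      have : r ^ (p * (1 - n / q)) = r ^ (p - n) * r ^ (n * (q - p) / q) := by
        rw [← Real.rpow_add hr]
        congr 1
        field_simp
        ring
      rw [this]
      have h3 : 0 ≤ n * (q - p) / q := by
        have : 0 < q - p := by linarith
        positivity
      gcongr
    have hNn := normLp_nonneg (q / p) f (ball x₀ R)
    have h4 : r ^ (p * (1 - n / q)) * normLp (q / p) f (ball x₀ R) ≤ d ^ (p - 1) :=
      (mul_le_mul_of_nonneg_right h2 hNn).trans h1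
    rw [← neg_sub p 1, Real.rpow_neg hd0.le, Real.rpow_neg hr.le, inv_mul_le_iff₀ (by positivity),
      ← div_eq_mul_inv, le_div_iff₀ (by positivity)]
    linarith
  calc _ ≤ ∫⁻ x in B, ENNReal.ofReal (d ^ (1 - p)) * (ENNReal.ofReal |f x| *
          ENNReal.ofReal (ψ x ^ p * (u x + d) ^ t)) := by
        refine setLIntegral_mono' measurableSet_ball fun x hx => ?_
        have hv : d ≤ u x + d := by linarith [hu0 x hx]
        have hv0 : 0 < u x + d := by linarith
        have := hψ0 x
        rw [← ENNReal.ofReal_mul (abs_nonneg _), ← ENNReal.ofReal_mul (by positivity)]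
        refine ENNReal.ofReal_le_ofReal ?_
        have e : (u x + d) ^ (-(p - 1 - t)) = (u x + d) ^ (-(p - 1)) * (u x + d) ^ t := by
          rw [← Real.rpow_add hv0]
          congr 1
          ring
        have h1 : (u x + d) ^ (-(p - 1)) ≤ d ^ (1 - p) := by
          rw [← neg_sub p 1]
          exact rpow_neg_le_of_le (by linarith) hd0 hv
        rw [e]
        calc _ = (u x + d) ^ (-(p - 1)) * (|f x| * (ψ x ^ p * (u x + d) ^ t)) := by ring
          _ ≤ _ := by gcongr
    _ = ENNReal.ofReal (d ^ (1 - p)) * ∫⁻ x in B, ENNReal.ofReal |f x| *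
          ENNReal.ofReal (ψ x ^ p * (u x + d) ^ t) :=
        lintegral_const_mul' _ _ ENNReal.ofReal_ne_top
    _ ≤ ENNReal.ofReal (d ^ (1 - p)) * (ENNReal.ofReal (normLp (q / p) f (ball x₀ R)) *
          (((∫⁻ x in B, ENNReal.ofReal (ψ x ^ p * (u x + d) ^ t) ^ ((n : ℝ) / (n - p))) ^
          (1 / ((n : ℝ) / (n - p)))) ^ ((n : ℝ) / q) *
        (∫⁻ x in ball x₀ ρ, ENNReal.ofReal ((u x + d) ^ t)) ^ (1 - (n : ℝ) / q))) := by
        gcongr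
        refine hH.trans ?_
        gcongr
    _ ≤ _ := by
        rw [← mul_assoc, ← ENNReal.ofReal_mul (by positivity)]
        gcongr

end

section
open Filter

lemma IsApprox.lintegral_add_rpow_ne_top_of_le {n : ℕ} {p t : ℝ} (hp : 1 < p)
    {x₀ : En n} {r ρ : ℝ} {u : En n → ℝ} {G : En n → En n} {w : ℕ → En n → ℝ}
    (h : IsApprox p x₀ r u G w) (hρ : ρ ≤ r) {d : ℝ} (hd : 0 ≤ d) (ht0 : 0 ≤ t) (ht : t ≤ p) :
    ∫⁻ x in ball x₀ ρ, ENNReal.ofReal ((u x + d) ^ t) ≠ ⊤ := by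
  have hb : ∫⁻ x in ball x₀ r, ENNReal.ofReal ((u x + d) ^ t) ≠ ⊤ := by
    refine ne_top_of_le_ne_top (b := ∫⁻ x in ball x₀ r, (1 + ENNReal.ofReal ((u x + d) ^ p))) ?_ ?_
    · rw [lintegral_add_left measurable_const]
      refine ENNReal.add_ne_top.2 ⟨?_, h.lintegral_add_rpow_ne_top hp hd⟩
      simpa using measure_ball_lt_top.ne
    · refine setLIntegral_mono' measurableSet_ball fun x hx => ?_
      have hv : 0 ≤ u x + d := by linarith [h.nonneg x hx]
      rw [← ENNReal.ofReal_one, ← ENNReal.ofReal_add zero_le_one (by positivity)]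
      refine ENNReal.ofReal_le_ofReal ?_
      rcases le_total (u x + d) 1 with h1 | h1
      · have := Real.rpow_le_one hv h1 ht0
        have : 0 ≤ (u x + d) ^ p := by positivity
        linarith
      · have := Real.rpow_le_rpow_of_exponent_le h1 ht
        linarith
  exact ne_top_of_le_ne_top hb (lintegral_mono_set (ball_subset_ball hρ))

lemma le_of_sobolev_of_energy {X Y I F E P K a CS τ ρ : ℝ} (ha : 0 < a) (hCS : 0 < CS)
    (hK : 0 ≤ K) (hX : 0 ≤ X) (hY : 0 ≤ Y) (hρ : 0 ≤ ρ) (hτ1 : τ < 1) (hPE : P ≤ E) (hρE : ρ ≤ E)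
    (h1 : X ≤ CS * (P * Y + I)) (h2 : a * I ≤ F + K * E * Y)
    (h3 : F ≤ ρ ^ (1 - τ) * (X ^ τ * Y ^ (1 - τ))) :
    X ≤ (2 * (CS * (a + K)) / a + (2 * CS / a) ^ (1 / (1 - τ))) * (E * Y) := by
  have hE : 0 ≤ E := hρ.trans hρE
  have h4 : a * X ≤ CS * (a + K) * (E * Y) + CS * (X ^ τ * (ρ * Y) ^ (1 - τ)) := by
    rw [Real.mul_rpow hρ hY]
    calc a * X ≤ a * (CS * (P * Y + I)) := by gcongr
      _ = CS * (a * (P * Y) + a * I) := by ring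
      _ ≤ CS * (a * (E * Y) + (ρ ^ (1 - τ) * (X ^ τ * Y ^ (1 - τ)) + K * E * Y)) := by
          gcongr
          exact h2.trans (by gcongr)
      _ = _ := by ring
  have h5 := le_of_le_add_rpow_mul_rpow ha (by positivity) hCS hX (by positivity) hτ1 h4
  refine h5.trans ?_
  have h6 : ρ * Y ≤ E * Y := by gcongr
  calc _ ≤ 2 * (CS * (a + K) * (E * Y)) / a + (2 * CS / a) ^ (1 / (1 - τ)) * (E * Y) := by gcongr
    _ = _ := by ring

/-- One step of the Moser iteration below the critical exponent. -/
lemma exists_moser_step (n : ℕ) {p s q : ℝ} (hp : 1 < p) (hpn : p < n) (hs0 : 0 < s) (hs1 : s < 1)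
    (hqn : (n : ℝ) < q) {C₁ C₂ Λ b : ℝ} (hC₁ : 0 < C₁) (hC₂ : 0 < C₂) (hΛ : 1 ≤ Λ) (hb : 0 < b) :
    ∃ K : ℝ, 0 < K ∧ ∀ (S : Setting n p s C₁ C₂ Λ) (u f : En n → ℝ) (G : En n → En n)
      (x₀ : En n) (r R d : ℝ) (w : ℕ → En n → ℝ), 0 < r → r ≤ 1 → r < R → ball x₀ R ⊆ S.Ω →
      IntegrableOn (fun x => |f x| ^ (q / p)) (ball x₀ R) → IsSupersol S f u G →
      (∀ x ∈ ball x₀ R, 0 ≤ u x) → dBound n p s q u f x₀ r R < d → IsApprox p x₀ r u G w →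
      ∀ σ σ' t : ℝ, 0 < σ' → σ' < σ → σ ≤ 1 → 0 < t → t ≤ p - 1 - b →
        (∫⁻ x in ball x₀ (σ' * r), ENNReal.ofReal ((u x + d) ^ t) ^ ((n : ℝ) / (n - p))) ^
            (1 / ((n : ℝ) / (n - p))) ≤
          ENNReal.ofReal (K * ((σ - σ') ^ (-((n : ℝ) + p)) * r ^ (-p))) *
            ∫⁻ x in ball x₀ (σ * r), ENNReal.ofReal ((u x + d) ^ t) := by
  have hp0 : 0 < p := by linarith
  have hn0 : (0 : ℝ) < n := by linarith
  have hq0 : 0 < q := by linarith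
  have hnp : 0 < (n : ℝ) - p := by linarith
  have hκ0 : 0 < (n : ℝ) / (n - p) := by positivity
  have hτ1 : (n : ℝ) / q < 1 := by rw [div_lt_one hq0]; exact hqn
  obtain ⟨CS, hCS, hS⟩ := IsApprox.sobolev hp hpn
  obtain ⟨c, hc, hψ⟩ := exists_cutoff n hp hpn
  have hcc := caccConst_nonneg (n := n) hp hs0 hs1 hC₁ hC₂ hΛ hb
  have ha : 0 < b * C₁ / 2 := by positivity
  refine ⟨(2 * (CS * (b * C₁ / 2 + caccConst n p s C₁ C₂ Λ b)) / (b * C₁ / 2) +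
    (2 * CS / (b * C₁ / 2)) ^ (1 / (1 - (n : ℝ) / q))) * ((2 * c) ^ p + 2 ^ ((n : ℝ) + p)),
    by positivity, ?_⟩
  intro S u f G x₀ r R d w hr hr1 hrR hR hf hsol hu0 hd h σ σ' t hσ' hσ hσ1 ht0 ht
  set a := b * C₁ / 2 with ha'
  set K := caccConst n p s C₁ C₂ Λ b with hK'
  set κ := (n : ℝ) / (n - p) with hκ
  set D := σ - σ' with hD'
  have hD : 0 < D := by rw [hD']; linarith
  have hD1 : D ≤ 1 := by rw [hD']; linarith
  have hd0 : 0 < d := (dBound_nonneg u f x₀ hr (hr.trans hrR)).trans_lt hd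
  set ρ := (σ + σ') / 2 * r with hρ'
  have hρ1 : σ' * r < ρ := by rw [hρ']; gcongr; linarith
  have hρ2 : ρ < σ * r := by rw [hρ']; gcongr; linarith
  have hσr : σ * r ≤ r := mul_le_of_le_one_left hr.le hσ1
  obtain ⟨ψ, hψc, hψs, hψ0, hψ1, hψL, hψe, hψt⟩ := hψ x₀ (σ' * r) ρ (by positivity) hρ1
  have hL : c / (ρ - σ' * r) = 2 * c / (D * r) := by
    rw [show ρ - σ' * r = D * r / 2 by rw [hρ', hD']; ring]
    field_simp
  rw [hL] at hψL
  have hDr : D * r ≤ 1 := mul_le_one₀ hD1 hr.le hr1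
  have hL1 : 1 ≤ 2 * c / (D * r) := by
    rw [le_div_iff₀ (by positivity)]
    linarith
  set M := D ^ (-((n : ℝ) + p)) * r ^ (-p) with hM
  have hM0 : 0 < M := by positivity
  set E := ((2 * c) ^ p + 2 ^ ((n : ℝ) + p)) * M with hE
  have hLE : (2 * c / (D * r)) ^ p ≤ E := by
    have h1 : (D ^ p)⁻¹ ≤ D ^ (-((n : ℝ) + p)) := by
      rw [← Real.rpow_neg hD.le]
      exact Real.rpow_le_rpow_of_exponent_ge hD hD1 (by linarith)
    rw [Real.div_rpow (by positivity) (by positivity), Real.mul_rpow hD.le hr.le, div_eq_mul_inv,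
      mul_inv, ← Real.rpow_neg hr.le]
    calc _ ≤ (2 * c) ^ p * M := by rw [hM]; gcongr
      _ ≤ E := by rw [hE]; gcongr; exact le_add_of_nonneg_right (by positivity)
  have hρE : (1 - ρ / r) ^ (-((n : ℝ) + p * s)) * r ^ (-p) ≤ E := by
    have h0 : D / 2 ≤ 1 - ρ / r := by
      rw [hρ', mul_div_cancel_right₀ _ hr.ne', hD']
      linarith
    have h1 : (1 - ρ / r) ^ (-((n : ℝ) + p * s)) ≤ 2 ^ ((n : ℝ) + p) * D ^ (-((n : ℝ) + p)) := by
      calc _ ≤ (D / 2) ^ (-((n : ℝ) + p * s)) :=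
            rpow_neg_le_of_le (by positivity) (by positivity) h0
        _ ≤ (D / 2) ^ (-((n : ℝ) + p)) := by
            refine Real.rpow_le_rpow_of_exponent_ge (by positivity) (by linarith) ?_
            nlinarith
        _ = _ := by
            rw [Real.div_rpow hD.le (by norm_num), Real.rpow_neg (by norm_num : (0 : ℝ) ≤ 2)]
            field_simp
    calc _ ≤ 2 ^ ((n : ℝ) + p) * M := by rw [hM, ← mul_assoc]; gcongr
      _ ≤ E := by rw [hE]; gcongr; exact le_add_of_nonneg_left (by positivity)
  have hrE : r ^ (-p) ≤ E := by
    refine le_trans ?_ hρE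
    refine le_mul_of_one_le_left (by positivity) ?_
    refine Real.one_le_rpow_of_pos_of_le_one_of_nonpos ?_ ?_ ?_
    · have : ρ < r := by linarith
      have : ρ / r < 1 := by rw [div_lt_one hr]; exact this
      linarith
    · have : 0 < σ' * r := by positivity
      have : 0 ≤ ρ / r := div_nonneg (by linarith) hr.le
      linarith
    · have : 0 < p * s := by positivity
      linarith
  have hψt' : tsupport ψ ⊆ ball x₀ (σ * r) := hψt.trans (closedBall_subset_ball hρ2)
  have hsob := hS x₀ r u G w h ψ hψc hψ0 hψ1 _ hψL (σ * r) hσr hψt' d t hd0 ht0 (by linarith)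
  have hcac := IsSupersol.caccioppoli (β := p - 1 - t) (by exact_mod_cast hn0) hp hs0 hs1
    (hpn.le.trans hqn.le) hsol hf hr hr1 hrR hρ2 hσr hR hu0 hd h hψc hψs hψ0 hψ1 hL1 hψL hψt hLE
    hρE hb (by linarith) (by linarith)
  rw [sub_sub_cancel] at hcac
  have hsrc := lintegral_source_le (t := t) hp hpn hqn hf hr hrR hσr h.aemeasurable h.nonneg hd
    hψc.continuous.measurable hψ0 hψ1 hψt'
  have hYt := h.lintegral_add_rpow_ne_top_of_le hp hσr hd0.le ht0.le (by linarith : t ≤ p)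
  have hIt : ∫⁻ x in ball x₀ r, ENNReal.ofReal (‖G x‖ ^ p * (ψ x ^ p * (u x + d) ^ (t - p))) ≠
      ⊤ := by
    refine ne_top_of_le_ne_top (b := ∫⁻ x in ball x₀ r, ENNReal.ofReal (d ^ (t - p)) * ‖G x‖ₑ ^ p)
      ?_ ?_
    · rw [lintegral_const_mul' _ _ ENNReal.ofReal_ne_top]
      exact ENNReal.mul_ne_top ENNReal.ofReal_ne_top h.lintegral_grad_ne_top
    · refine setLIntegral_mono' measurableSet_ball fun x hx => ?_
      rw [← ofReal_norm, ENNReal.ofReal_rpow_of_nonneg (norm_nonneg _) hp0.le,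
        ← ENNReal.ofReal_mul (by positivity)]
      refine ENNReal.ofReal_le_ofReal ?_
      have hv : d ≤ u x + d := by linarith [h.nonneg x hx]
      have h1 : (u x + d) ^ (t - p) ≤ d ^ (t - p) := by
        rw [← neg_sub p t]
        exact rpow_neg_le_of_le (by linarith) hd0 hv
      have h2 := Real.rpow_le_one (hψ0 x) (hψ1 x) hp0.le
      have h3 := Real.rpow_nonneg (hψ0 x) p
      have h4 : 0 ≤ (u x + d) ^ (t - p) := Real.rpow_nonneg (by linarith) _
      calc _ ≤ ‖G x‖ ^ p * (1 * d ^ (t - p)) := by gcongr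
        _ = _ := by ring
  have hlhs : (∫⁻ x in ball x₀ (σ' * r), ENNReal.ofReal ((u x + d) ^ t) ^ κ) ^ (1 / κ) ≤
      (∫⁻ x in ball x₀ r, ENNReal.ofReal (ψ x ^ p * (u x + d) ^ t) ^ κ) ^ (1 / κ) := by
    refine ENNReal.rpow_le_rpow ?_ (by positivity)
    refine le_trans (setLIntegral_mono' measurableSet_ball fun x hx => ?_)
      (lintegral_mono_set (ball_subset_ball (hρ1.le.trans (hρ2.le.trans hσr))))
    rw [hψe x hx, Real.one_rpow, one_mul]
  refine hlhs.trans ?_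
  generalize (∫⁻ x in ball x₀ r, ENNReal.ofReal (ψ x ^ p * (u x + d) ^ t) ^ κ) ^ (1 / κ) = X at *
  generalize ∫⁻ x in ball x₀ r, ENNReal.ofReal (‖G x‖ ^ p * (ψ x ^ p * (u x + d) ^ (t - p))) = I
    at *
  generalize ∫⁻ x in ball x₀ (σ * r), ENNReal.ofReal ((u x + d) ^ t) = Y at *
  generalize ∫⁻ x in ball x₀ r,
    ENNReal.ofReal (|f x| * (ψ x ^ p * (u x + d) ^ (-(p - 1 - t)))) = F at *
  have hXt : X ≠ ⊤ := ne_top_of_le_ne_top (ENNReal.mul_ne_top ENNReal.ofReal_ne_top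
    (ENNReal.add_ne_top.2 ⟨ENNReal.mul_ne_top ENNReal.ofReal_ne_top hYt, hIt⟩)) hsob
  have hsrcR : ENNReal.ofReal (r ^ (-(p * (1 - n / q)))) *
      (X ^ ((n : ℝ) / q) * Y ^ (1 - (n : ℝ) / q)) ≠ ⊤ :=
    ENNReal.mul_ne_top ENNReal.ofReal_ne_top (ENNReal.mul_ne_top
      (ENNReal.rpow_ne_top_of_nonneg (by positivity) hXt)
      (ENNReal.rpow_ne_top_of_nonneg (by linarith) hYt))
  have hFt : F ≠ ⊤ := ne_top_of_le_ne_top hsrcR hsrc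
  have hE0 : 0 ≤ E := by positivity
  lift X to ℝ≥0 using hXt
  lift Y to ℝ≥0 using hYt
  lift I to ℝ≥0 using hIt
  lift F to ℝ≥0 using hFt
  have h1 : (X : ℝ) ≤ CS * ((2 * c / (D * r)) ^ p * Y + I) := by
    have := ENNReal.toReal_mono (by finiteness) hsob
    rwa [ENNReal.toReal_mul, ENNReal.toReal_add (by finiteness) (by finiteness),
      ENNReal.toReal_mul, ENNReal.toReal_ofReal hCS.le, ENNReal.toReal_ofReal (by positivity)]
      at this
  have h2 : a * I ≤ F + K * E * Y := by
    have := ENNReal.toReal_mono (by finiteness) hcac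
    rwa [ENNReal.toReal_mul, ENNReal.toReal_add (by finiteness) (by finiteness),
      ENNReal.toReal_mul, ENNReal.toReal_ofReal ha.le, ENNReal.toReal_ofReal (by positivity)]
      at this
  have h3 : (F : ℝ) ≤ (r ^ (-p)) ^ (1 - (n : ℝ) / q) *
      ((X : ℝ) ^ ((n : ℝ) / q) * (Y : ℝ) ^ (1 - (n : ℝ) / q)) := by
    have := ENNReal.toReal_mono hsrcR hsrc
    rw [ENNReal.toReal_mul, ENNReal.toReal_mul, ← ENNReal.toReal_rpow, ← ENNReal.toReal_rpow,
      ENNReal.toReal_ofReal (by positivity)] at this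
    rw [← Real.rpow_mul hr.le, neg_mul]
    exact this
  have h4 := le_of_sobolev_of_energy ha hCS hcc X.coe_nonneg Y.coe_nonneg (by positivity) hτ1 hLE hrE h1 h2 h3
  have h5 := ENNReal.ofReal_le_ofReal h4
  rw [ENNReal.ofReal_coe_nnreal] at h5
  refine h5.trans_eq ?_
  rw [← mul_assoc, ENNReal.ofReal_mul (by positivity), ENNReal.ofReal_coe_nnreal, hE, mul_assoc]

end

/-- Iteration of a reverse Hölder step from exponent `t` to `κ t`. -/
lemma exists_iterate_le {κ θ₀ C : ℝ} (hκ : 1 < κ) (hθ₀ : 0 < θ₀) (hC : 0 < C) :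
    ∃ A : ℝ, 0 < A ∧ ∀ (N : ℝ → ℝ → ℝ≥0∞) (γ lam : ℝ), 0 < lam →
      (∀ σ σ' t, γ ≤ σ' → σ' < σ → σ ≤ 1 → 0 < t → κ * t ≤ lam →
        N σ' (κ * t) ≤ ENNReal.ofReal ((C * (σ - σ') ^ (-θ₀)) ^ (1 / t)) * N σ t) →
      (∀ σ t t', γ < σ → σ ≤ 1 → 0 < t → t ≤ t' → N σ t ≤ N σ t') →
      ∀ σ σ' μ, 0 < γ → γ ≤ σ' → σ' < σ → σ ≤ 1 → 0 < μ → μ < lam →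
        N σ' lam ≤
          ENNReal.ofReal ((A * (σ - σ') ^ (-(θ₀ * κ / (κ - 1) * κ))) ^ (1 / μ)) * N σ μ := by
  have hκ0 : 0 < κ := by linarith
  have hκ1 : 0 < κ - 1 := by linarith
  set θ := θ₀ * κ / (κ - 1) with hθ
  have hθ0 : 0 < θ := by positivity
  have hθe : θ / κ + θ₀ = θ := by rw [hθ]; field_simp; ring
  have hθle : θ₀ ≤ θ := by rw [← hθe]; exact le_add_of_nonneg_left (by positivity)
  set m := max 1 (C * 2 ^ θ) with hm
  have hm1 : 1 ≤ m := le_max_left _ _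
  have hm0 : 0 < m := by linarith
  set A := m ^ (κ / (κ - 1)) with hA
  have hA0 : 0 < A := by positivity
  have hA1 : 1 ≤ A := Real.one_le_rpow hm1 (by positivity)
  have hAm : A ^ (1 / κ) * m = A := by
    rw [hA, ← Real.rpow_mul hm0.le]
    nth_rw 2 [← Real.rpow_one m]
    rw [← Real.rpow_add hm0]
    congr 1
    field_simp
    ring
  have hmA : m ≤ A := by
    rw [← hAm]
    exact le_mul_of_one_le_left hm0.le (Real.one_le_rpow hA1 (by positivity))
  have hCA : C ≤ A := by
    refine le_trans ?_ hmA
    refine le_trans ?_ (le_max_right _ _)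
    exact le_mul_of_one_le_right hC.le (Real.one_le_rpow (by norm_num) hθ0.le)
  refine ⟨A ^ κ, by positivity, ?_⟩
  intro N γ lam hlam hstep hmono
  have key : ∀ K : ℕ, ∀ σ σ', 0 < γ → γ ≤ σ' → σ' < σ → σ ≤ 1 → N σ' lam ≤
      ENNReal.ofReal ((A * (σ - σ') ^ (-θ)) ^ (1 / (lam / κ ^ (K + 1)))) *
        N σ (lam / κ ^ (K + 1)) := by
    intro K
    induction K with
    | zero =>
      intro σ σ' hγ hσ' hσ hσ1
      have hD : 0 < σ - σ' := by linarith
      have h1 := hstep σ σ' (lam / κ) hσ' hσ hσ1 (by positivity) (by field_simp; rfl)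
      rw [mul_div_cancel₀ _ hκ0.ne'] at h1
      simp only [zero_add, pow_one]
      refine h1.trans ?_
      gcongr ENNReal.ofReal ((?_ * ?_) ^ _) * _
      exact Real.rpow_le_rpow_of_exponent_ge hD (by linarith) (by linarith)
    | succ K ih =>
      intro σ σ' hγ hσ' hσ hσ1
      set D := σ - σ' with hD'
      have hD : 0 < D := by rw [hD']; linarith
      have h1 := ih ((σ + σ') / 2) σ' hγ hσ' (by linarith) (by linarith)
      set t := lam / κ ^ (K + 1 + 1) with ht
      have ht0 : 0 < t := by positivity
      have htκ : lam / κ ^ (K + 1) = κ * t := by rw [ht, pow_succ κ (K + 1)]; field_simp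
      have htl : κ * t ≤ lam := by
        rw [← htκ]
        exact div_le_self hlam.le (one_le_pow₀ hκ.le)
      rw [htκ] at h1
      have h2 := hstep σ ((σ + σ') / 2) t (by linarith) (by linarith) hσ1 ht0 htl
      rw [show (σ + σ') / 2 - σ' = D / 2 by rw [hD']; ring] at h1
      rw [show σ - (σ + σ') / 2 = D / 2 by rw [hD']; ring] at h2
      refine h1.trans ((mul_le_mul_right h2 _).trans ?_)
      rw [← mul_assoc, ← ENNReal.ofReal_mul (by positivity)]
      refine mul_le_mul_left (ENNReal.ofReal_le_ofReal ?_) _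
      rw [← one_div_mul_one_div, Real.rpow_mul (by positivity),
        ← Real.mul_rpow (by positivity) (by positivity)]
      refine Real.rpow_le_rpow (by positivity) ?_ (by positivity)
      rw [Real.mul_rpow hA0.le (by positivity), ← Real.rpow_mul (x := D / 2) (by positivity)]
      have h3 : (D / 2) ^ (-θ * (1 / κ)) * (D / 2) ^ (-θ₀) = 2 ^ θ * D ^ (-θ) := by
        rw [← Real.rpow_add (by positivity), show -θ * (1 / κ) + -θ₀ = -θ by
          rw [← hθe]; nth_rw 1 [hθe]; ring, Real.div_rpow hD.le (by norm_num),
          Real.rpow_neg (by norm_num : (0 : ℝ) ≤ 2), div_inv_eq_mul, mul_comm]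
      calc _ = A ^ (1 / κ) * (C * ((D / 2) ^ (-θ * (1 / κ)) * (D / 2) ^ (-θ₀))) := by ring
        _ = A ^ (1 / κ) * (C * 2 ^ θ) * D ^ (-θ) := by rw [h3]; ring
        _ ≤ A ^ (1 / κ) * m * D ^ (-θ) := by gcongr; exact le_max_right _ _
        _ = _ := by rw [hAm]
  intro σ σ' μ hγ hσ' hσ hσ1 hμ hμl
  have hD : 0 < σ - σ' := by linarith
  have hex : ∃ K : ℕ, lam / κ ^ (K + 1) ≤ μ := by
    obtain ⟨K, hK⟩ := pow_unbounded_of_one_lt (lam / μ) hκ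
    refine ⟨K, ?_⟩
    rw [div_le_iff₀ (by positivity)]
    rw [div_lt_iff₀ hμ] at hK
    have : κ ^ K ≤ κ ^ (K + 1) := pow_le_pow_right₀ hκ.le (by omega)
    nlinarith
  classical
  have hspec := Nat.find_spec hex
  have hmin : μ < lam / κ ^ (Nat.find hex) := by
    rcases Nat.eq_zero_or_pos (Nat.find hex) with h0 | h0
    · rw [h0]
      simpa using hμl
    · have := Nat.find_min hex (Nat.sub_lt h0 one_pos)
      rw [Nat.sub_add_cancel (show 1 ≤ _ from h0)] at this
      exact not_le.1 this
  generalize Nat.find hex = K at hspec hmin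
  have hinv : 1 / (lam / κ ^ (K + 1)) ≤ κ * (1 / μ) := by
    rw [pow_succ]
    rw [lt_div_iff₀ (by positivity)] at hmin
    rw [one_div_div, mul_one_div, div_le_div_iff₀ hlam hμ]
    nlinarith
  refine (key K σ σ' hγ hσ' hσ hσ1).trans ?_
  refine mul_le_mul' (ENNReal.ofReal_le_ofReal ?_)
    (hmono σ _ _ (by linarith) hσ1 (by positivity) hspec)
  have h1 : 1 ≤ A * (σ - σ') ^ (-θ) := one_le_mul_of_one_le_of_one_le hA1
    (Real.one_le_rpow_of_pos_of_le_one_of_nonpos hD (by linarith) (by linarith))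
  refine (Real.rpow_le_rpow_of_exponent_le h1 hinv).trans_eq ?_
  rw [Real.rpow_mul (by positivity), Real.mul_rpow hA0.le (by positivity),
    ← Real.rpow_mul hD.le, neg_mul]

/-- The averaged `L^t` quasi-norm of a nonnegative function on a ball. -/
def avgNorm {n : ℕ} (v : En n → ℝ) (x₀ : En n) (ρ t : ℝ) : ℝ≥0∞ :=
  ((volume (ball x₀ ρ))⁻¹ * ∫⁻ x in ball x₀ ρ, ENNReal.ofReal (v x ^ t)) ^ (1 / t)

lemma avgNorm_mono {n : ℕ} {v : En n → ℝ} {x₀ : En n} {ρ t t' : ℝ} (hρ : 0 < ρ)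
    (hv : AEMeasurable v (volume.restrict (ball x₀ ρ))) (hv0 : ∀ x ∈ ball x₀ ρ, 0 ≤ v x)
    (ht : 0 < t) (htt : t ≤ t') : avgNorm v x₀ ρ t ≤ avgNorm v x₀ ρ t' := by
  set B := ball x₀ ρ with hB
  have hV0 : volume B ≠ 0 := (measure_ball_pos _ _ hρ).ne'
  have hVt : volume B ≠ ⊤ := measure_ball_lt_top.ne
  have hprob : IsProbabilityMeasure ((volume B)⁻¹ • volume.restrict B) :=
    ⟨by simpa using ENNReal.inv_mul_cancel hV0 hVt⟩
  have e : ∀ t : ℝ, 0 < t →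
      avgNorm v x₀ ρ t = eLpNorm' v t ((volume B)⁻¹ • volume.restrict B) := by
    intro t ht
    rw [avgNorm, eLpNorm', lintegral_smul_measure, smul_eq_mul]
    congr 2
    refine setLIntegral_congr_fun measurableSet_ball fun x hx => ?_
    rw [← ENNReal.ofReal_rpow_of_nonneg (hv0 x hx) ht.le, Real.enorm_of_nonneg (hv0 x hx)]
  rw [e t ht, e t' (ht.trans_le htt)]
  exact eLpNorm'_le_eLpNorm'_of_exponent_le ht htt _ (hv.aestronglyMeasurable.smul_measure _)

lemma volume_ball_eq {n : ℕ} (x₀ : En n) {ρ : ℝ} (hρ : 0 < ρ) :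
    volume (ball x₀ ρ) = ENNReal.ofReal (ρ ^ (n : ℝ) * (volume (ball (0 : En n) 1)).toReal) := by
  rw [Measure.addHaar_ball_of_pos _ _ hρ, ENNReal.ofReal_mul (by positivity),
    ENNReal.ofReal_toReal measure_ball_lt_top.ne, finrank_euclideanSpace_fin, Real.rpow_natCast]

lemma avgNorm_step_le {n : ℕ} {p : ℝ} (hp : 0 < p) (hpn : p < n) {v : En n → ℝ} {x₀ : En n}
    {r K θ γ σ σ' t : ℝ} (hr : 0 < r) (hK : 0 < K) (hγ : 0 < γ) (hσ' : γ ≤ σ') (hσ : σ' < σ)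
    (hσ1 : σ ≤ 1) (ht : 0 < t) (hv0 : ∀ x ∈ ball x₀ r, 0 ≤ v x)
    (h : (∫⁻ x in ball x₀ (σ' * r), ENNReal.ofReal (v x ^ t) ^ ((n : ℝ) / (n - p))) ^
        (1 / ((n : ℝ) / (n - p))) ≤ ENNReal.ofReal (K * ((σ - σ') ^ (-θ) * r ^ (-p))) *
          ∫⁻ x in ball x₀ (σ * r), ENNReal.ofReal (v x ^ t)) :
    avgNorm v x₀ (σ' * r) ((n : ℝ) / (n - p) * t) ≤
      ENNReal.ofReal ((K * (volume (ball (0 : En n) 1)).toReal ^ (1 - (n - p) / (n : ℝ)) *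
        γ ^ (-((n : ℝ) - p)) * (σ - σ') ^ (-θ)) ^ (1 / t)) * avgNorm v x₀ (σ * r) t := by
  have hn0 : (0 : ℝ) < n := by linarith
  have hnp : 0 < (n : ℝ) - p := by linarith
  have hσ'0 : 0 < σ' := hγ.trans_le hσ'
  have hσ0 : 0 < σ := hσ'0.trans hσ
  have hD : 0 < σ - σ' := by linarith
  set κ := (n : ℝ) / (n - p) with hκ
  have hκ0 : 0 < κ := by positivity
  set ω := (volume (ball (0 : En n) 1)).toReal with hω
  have hω0 : 0 < ω := ENNReal.toReal_pos (measure_ball_pos _ _ one_pos).ne' measure_ball_lt_top.ne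
  have hκi : 1 / κ = (n - p) / (n : ℝ) := by rw [hκ, one_div_div]
  have e1 : ∫⁻ x in ball x₀ (σ' * r), ENNReal.ofReal (v x ^ (κ * t)) =
      ∫⁻ x in ball x₀ (σ' * r), ENNReal.ofReal (v x ^ t) ^ κ := by
    refine setLIntegral_congr_fun measurableSet_ball fun x hx => ?_
    have hx0 := hv0 x (ball_subset_ball (mul_le_of_le_one_left hr.le (by linarith)) hx)
    rw [mul_comm κ, Real.rpow_mul hx0, ENNReal.ofReal_rpow_of_nonneg (by positivity) hκ0.le]
  rw [avgNorm, avgNorm, e1, ← one_div_mul_one_div, ENNReal.rpow_mul,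
    ← ENNReal.ofReal_rpow_of_nonneg (by positivity) (by positivity),
    ← ENNReal.mul_rpow_of_nonneg _ _ (by positivity)]
  refine ENNReal.rpow_le_rpow ?_ (by positivity)
  rw [ENNReal.mul_rpow_of_nonneg _ _ (by positivity)]
  refine (mul_le_mul_right h _).trans ?_
  have hσr : 0 < σ * r := by positivity
  have hσr' : 0 < σ' * r := by positivity
  rw [volume_ball_eq x₀ hσr, volume_ball_eq x₀ hσr', ← hω, ← ENNReal.ofReal_inv_of_pos (by positivity),
    ← ENNReal.ofReal_inv_of_pos (by positivity), ENNReal.ofReal_rpow_of_nonneg (by positivity)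
    (by positivity), ← mul_assoc, ← ENNReal.ofReal_mul (by positivity),
    ← mul_assoc (ENNReal.ofReal _),
    ← ENNReal.ofReal_mul (by positivity)]
  refine mul_le_mul_left (ENNReal.ofReal_le_ofReal ?_) _
  have e2 : ((σ' * r) ^ (n : ℝ) * ω)⁻¹ ^ (1 / κ) =
      σ' ^ (-((n : ℝ) - p)) * r ^ (-((n : ℝ) - p)) * ω ^ (-((n - p) / (n : ℝ))) := by
    rw [hκi, Real.inv_rpow (by positivity), Real.mul_rpow (by positivity) hω0.le,
      ← Real.rpow_mul hσr'.le, mul_div_cancel₀ _ hn0.ne', Real.mul_rpow hσ'0.le hr.le,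
      Real.rpow_neg hσ'0.le, Real.rpow_neg hr.le, Real.rpow_neg hω0.le, mul_inv, mul_inv]
  have e3 : ω ^ (1 - (n - p) / (n : ℝ)) = ω ^ (-((n - p) / (n : ℝ))) * ω := by
    rw [sub_eq_neg_add, Real.rpow_add_one hω0.ne']
  have e4 : r ^ (-((n : ℝ) - p)) * r ^ (-p) = (r ^ (n : ℝ))⁻¹ := by
    rw [← Real.rpow_add hr, ← Real.rpow_neg hr.le]
    congr 1
    ring
  have h1 : σ' ^ (-((n : ℝ) - p)) ≤ γ ^ (-((n : ℝ) - p)) := rpow_neg_le_of_le hnp.le hγ hσ'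
  have h2 : 1 ≤ (σ ^ (n : ℝ))⁻¹ := by
    rw [one_le_inv₀ (by positivity)]
    exact Real.rpow_le_one hσ0.le hσ1 hn0.le
  rw [e2, e3]
  calc _ = K * (σ - σ') ^ (-θ) * ω ^ (-((n - p) / (n : ℝ))) * σ' ^ (-((n : ℝ) - p)) *
        (r ^ (-((n : ℝ) - p)) * r ^ (-p)) := by ring
    _ ≤ K * (σ - σ') ^ (-θ) * ω ^ (-((n - p) / (n : ℝ))) * γ ^ (-((n : ℝ) - p)) *
        ((r ^ (n : ℝ))⁻¹ * (σ ^ (n : ℝ))⁻¹) := by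
      rw [e4]
      gcongr
      exact le_mul_of_one_le_right (by positivity) h2
    _ = _ := by
      rw [Real.mul_rpow hσ0.le hr.le]
      field_simp

lemma ofReal_setAverage_rpow_le {n : ℕ} {v : En n → ℝ} {x₀ : En n} {ρ t : ℝ} (hρ : 0 < ρ)
    (ht : 0 < t) (hv0 : ∀ x ∈ ball x₀ ρ, 0 ≤ v x) :
    ENNReal.ofReal ((⨍ x in ball x₀ ρ, v x ^ t) ^ (1 / t)) ≤ avgNorm v x₀ ρ t := by
  have h0 : 0 ≤ ∫ x in ball x₀ ρ, v x ^ t := setIntegral_nonneg measurableSet_ball fun x hx =>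
    Real.rpow_nonneg (hv0 x hx) _
  have hV : 0 < volume.real (ball x₀ ρ) :=
    ENNReal.toReal_pos (measure_ball_pos _ _ hρ).ne' measure_ball_lt_top.ne
  rw [setAverage_eq, smul_eq_mul, ← ENNReal.ofReal_rpow_of_nonneg (by positivity) (by positivity),
    avgNorm, ENNReal.ofReal_mul (by positivity), ENNReal.ofReal_inv_of_pos hV, Measure.real,
    ENNReal.ofReal_toReal measure_ball_lt_top.ne]
  gcongr
  exact ofReal_integral_le _

lemma avgNorm_eq_ofReal {n : ℕ} {v : En n → ℝ} {x₀ : En n} {ρ t : ℝ} (hρ : 0 < ρ)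
    (ht : 0 < t) (hv0 : ∀ x ∈ ball x₀ ρ, 0 ≤ v x)
    (hi : IntegrableOn (fun x => v x ^ t) (ball x₀ ρ)) :
    avgNorm v x₀ ρ t = ENNReal.ofReal ((⨍ x in ball x₀ ρ, v x ^ t) ^ (1 / t)) := by
  have h0 : 0 ≤ ∫ x in ball x₀ ρ, v x ^ t := setIntegral_nonneg measurableSet_ball fun x hx =>
    Real.rpow_nonneg (hv0 x hx) _
  have hV : 0 < volume.real (ball x₀ ρ) :=
    ENNReal.toReal_pos (measure_ball_pos _ _ hρ).ne' measure_ball_lt_top.ne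
  rw [setAverage_eq, smul_eq_mul, ← ENNReal.ofReal_rpow_of_nonneg (by positivity) (by positivity),
    avgNorm, ENNReal.ofReal_mul (by positivity), ENNReal.ofReal_inv_of_pos hV, Measure.real,
    ENNReal.ofReal_toReal measure_ball_lt_top.ne, ofReal_integral_eq_lintegral_ofReal hi]
  filter_upwards [ae_restrict_mem measurableSet_ball] with x hx
  exact Real.rpow_nonneg (hv0 x hx) _

section
open Filter

lemma HasWeakGradOn.mono {n : ℕ} {u : En n → ℝ} {G : En n → En n} {s t : Set (En n)}
    (h : HasWeakGradOn u G t) (hst : s ⊆ t) : HasWeakGradOn u G s :=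
  fun φ hφ => h φ ⟨hφ.1, hφ.2.1, hφ.2.2.trans hst⟩

lemma MemW1pLoc.exists_isApprox {n : ℕ} {p : ℝ} (hp : 1 < p) {u : En n → ℝ} {G : En n → En n}
    {Ω : Set (En n)} (h : MemW1pLoc p u G Ω) {x₀ : En n} {r ρ R : ℝ} (hr : r < ρ) (hρ : ρ < R)
    (hR : ball x₀ R ⊆ Ω) (hu0 : ∀ x ∈ ball x₀ R, 0 ≤ u x)
    (hG : AEStronglyMeasurable G (volume.restrict (ball x₀ ρ))) :
    ∃ w, IsApprox p x₀ r u G w := by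
  have hp0 : 0 < p := by linarith
  have hrρ : ball x₀ r ⊆ ball x₀ ρ := ball_subset_ball hr.le
  have hρR : ball x₀ ρ ⊆ ball x₀ R := ball_subset_ball hρ.le
  have hu := h.memLp_ball hp0 hρ hR hu0
  have hGp : MemLp G (ENNReal.ofReal p) (volume.restrict (ball x₀ ρ)) := by
    rw [← integrable_norm_rpow_iff hG (by simpa using hp0) (by simp),
      ENNReal.toReal_ofReal hp0.le]
    exact (h.2 (closedBall x₀ ρ) (isCompact_closedBall _ _)
      ((closedBall_subset_ball hρ).trans hR)).2.mono_set ball_subset_closedBall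
  obtain ⟨w, hw, hw0, hw1, hw2, hw3⟩ := exists_smooth_approx hp.le hr hu hGp
    (h.1.mono (hρR.trans hR)) fun x hx => hu0 x (hρR hx)
  have hle : volume.restrict (ball x₀ r) ≤ volume.restrict (ball x₀ ρ) :=
    Measure.restrict_mono hrρ le_rfl
  have hfin : ∀ {F : Type} [NormedAddCommGroup F] {g : En n → F},
      MemLp g (ENNReal.ofReal p) (volume.restrict (ball x₀ ρ)) →
        ∫⁻ x in ball x₀ r, ‖g x‖ₑ ^ p ≠ ⊤ := by
    intro F _ g hg
    have := (eLpNorm_lt_top_iff_lintegral_rpow_enorm_lt_top (by simpa using hp0) (by simp)).1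
      (hg.mono_measure hle).2
    rw [ENNReal.toReal_ofReal hp0.le] at this
    exact this.ne
  exact ⟨w, hu.1.aemeasurable.mono_measure hle, hG.mono_measure hle,
    fun x hx => hu0 x (hρR (hrρ hx)), hfin hu, hfin hGp, hw, hw0, hw1, hw2, hw3⟩

lemma IsApprox.mono {n : ℕ} {p : ℝ} {x₀ : En n} {r r' : ℝ} {u : En n → ℝ} {G : En n → En n}
    {w : ℕ → En n → ℝ} (h : IsApprox p x₀ r u G w) (hr : r' ≤ r) : IsApprox p x₀ r' u G w := by
  have hb : ball x₀ r' ⊆ ball x₀ r := ball_subset_ball hr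
  have hle : volume.restrict (ball x₀ r') ≤ volume.restrict (ball x₀ r) :=
    Measure.restrict_mono hb le_rfl
  exact ⟨h.aemeasurable.mono_measure hle, h.aestronglyMeasurable.mono_measure hle,
    fun x hx => h.nonneg x (hb hx), ne_top_of_le_ne_top h.lintegral_ne_top (lintegral_mono_set hb),
    ne_top_of_le_ne_top h.lintegral_grad_ne_top (lintegral_mono_set hb), h.contDiff,
    h.nonneg_approx, tendsto_of_tendsto_of_tendsto_of_le_of_le tendsto_const_nhds h.tendsto
      (fun _ => zero_le) (fun _ => lintegral_mono_set hb),
    tendsto_of_tendsto_of_tendsto_of_le_of_le tendsto_const_nhds h.tendsto_grad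
      (fun _ => zero_le) (fun _ => lintegral_mono_set hb),
    ae_mono hle h.ae_tendsto⟩

/-- Higher integrability of Sobolev functions on smaller balls. -/
lemma IsApprox.integrableOn_add_rpow {n : ℕ} {p : ℝ} (hp : 1 < p) (hpn : p < n) {x₀ : En n}
    {r r₁ : ℝ} {u : En n → ℝ} {G : En n → En n} {w : ℕ → En n → ℝ} (h : IsApprox p x₀ r₁ u G w)
    (hr : 0 < r) (hr₁ : r < r₁) {d t : ℝ} (hd : 0 < d) (ht0 : 0 ≤ t)
    (ht : t ≤ p * ((n : ℝ) / (n - p))) :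
    IntegrableOn (fun x => (u x + d) ^ t) (ball x₀ r) := by
  have hp0 : 0 < p := by linarith
  have hn0 : (0 : ℝ) < n := by linarith
  have hnp : 0 < (n : ℝ) - p := by linarith
  have hκ0 : 0 < (n : ℝ) / (n - p) := by positivity
  have hb : ball x₀ r ⊆ ball x₀ r₁ := ball_subset_ball hr₁.le
  have hum := h.aemeasurable.mono_measure (Measure.restrict_mono hb le_rfl)
  refine ⟨((hum.add_const d).pow_const t).aestronglyMeasurable, ?_⟩
  obtain ⟨C, hC, hS⟩ := IsApprox.sobolev hp hpn
  obtain ⟨c, hc, hψ⟩ := exists_cutoff n hp hpn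
  obtain ⟨ψ, hψc, -, hψ0, hψ1, hψL, hψe, hψt⟩ := hψ x₀ r ((r + r₁) / 2) hr (by linarith)
  have hs := hS x₀ r₁ u G w h ψ hψc hψ0 hψ1 _ hψL r₁ le_rfl
    (hψt.trans (closedBall_subset_ball (by linarith))) d p hd hp0 le_rfl
  have hrhs : ENNReal.ofReal C * (ENNReal.ofReal ((c / ((r + r₁) / 2 - r)) ^ p) *
      (∫⁻ x in ball x₀ r₁, ENNReal.ofReal ((u x + d) ^ p)) +
      ∫⁻ x in ball x₀ r₁, ENNReal.ofReal (‖G x‖ ^ p * (ψ x ^ p * (u x + d) ^ (p - p)))) ≠ ⊤ := by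
    refine ENNReal.mul_ne_top ENNReal.ofReal_ne_top (ENNReal.add_ne_top.2
      ⟨ENNReal.mul_ne_top ENNReal.ofReal_ne_top (h.lintegral_add_rpow_ne_top hp hd.le), ?_⟩)
    refine ne_top_of_le_ne_top h.lintegral_grad_ne_top (lintegral_mono fun x => ?_)
    rw [sub_self, Real.rpow_zero, mul_one, ← ofReal_norm,
      ENNReal.ofReal_rpow_of_nonneg (norm_nonneg _) hp0.le]
    exact ENNReal.ofReal_le_ofReal (mul_le_of_le_one_right (by positivity)
      (Real.rpow_le_one (hψ0 x) (hψ1 x) hp0.le))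
  have hX := ne_top_of_le_ne_top hrhs hs
  rw [Ne, ENNReal.rpow_eq_top_iff_of_pos (by positivity)] at hX
  have hle : ∫⁻ x in ball x₀ r, ‖(u x + d) ^ t‖ₑ ≤ ∫⁻ x in ball x₀ r,
      (1 + ENNReal.ofReal (ψ x ^ p * (u x + d) ^ p) ^ ((n : ℝ) / (n - p))) := by
    refine setLIntegral_mono' measurableSet_ball fun x hx => ?_
    have hv : 0 < u x + d := by linarith [h.nonneg x (hb hx)]
    rw [Real.enorm_of_nonneg (by positivity), hψe x hx, Real.one_rpow, one_mul,
      ENNReal.ofReal_rpow_of_nonneg (by positivity) hκ0.le, ← Real.rpow_mul hv.le,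
      ← ENNReal.ofReal_one, ← ENNReal.ofReal_add zero_le_one (by positivity)]
    refine ENNReal.ofReal_le_ofReal ?_
    rcases le_total (u x + d) 1 with h1 | h1
    · have := Real.rpow_le_one hv.le h1 ht0
      have : 0 ≤ (u x + d) ^ (p * ((n : ℝ) / (n - p))) := by positivity
      linarith
    · have := Real.rpow_le_rpow_of_exponent_le h1 ht
      linarith
  refine hle.trans_lt ?_
  rw [lintegral_add_left measurable_const]
  refine ENNReal.add_lt_top.2 ⟨by simpa using measure_ball_lt_top, ?_⟩
  exact (lintegral_mono_set hb).trans_lt (lt_top_iff_ne_top.2 hX)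

lemma setAverage_rpow_eq_of_ae_eq_const {n : ℕ} {u : En n → ℝ} {x₀ : En n} {r ρ c d t : ℝ}
    (hρ : 0 < ρ) (hρr : ρ ≤ r) (hc : 0 ≤ c + d) (ht : 0 < t)
    (h : ∀ᵐ x ∂(volume.restrict (ball x₀ r)), u x = c) :
    (⨍ x in ball x₀ ρ, (u x + d) ^ t) ^ (1 / t) = c + d := by
  have hV0 : volume (ball x₀ ρ) ≠ 0 := (measure_ball_pos _ _ hρ).ne'
  have h' : ∀ᵐ x ∂(volume.restrict (ball x₀ ρ)), u x = c := ae_mono (Measure.restrict_mono (ball_subset_ball (x := x₀) hρr)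
    le_rfl) h
  have : ⨍ x in ball x₀ ρ, (u x + d) ^ t = ⨍ _ in ball x₀ ρ, (c + d) ^ t :=
    average_congr (h'.mono fun x hx => by simp only [hx])
  rw [this, setAverage_const hV0 measure_ball_lt_top.ne, ← Real.rpow_mul hc,
    mul_one_div_cancel ht.ne', Real.rpow_one]

end

/-- **Reverse Hölder inequality for supersolutions** (Lemma 4.2). -/
theorem reverse_holder_supersolutions
    (n : ℕ) (p s : ℝ)
    (hs0 : 0 < s) (hs1 : s < 1) (hp : 1 < p) (hpn : p < n) :
    ∃ θ : ℝ, 0 < θ ∧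
      ∀ q C₁ C₂ Λ γ lam : ℝ, (n : ℝ) < q →
        0 < γ → γ < 1 → 0 < lam → lam < (p - 1) * ((n : ℝ) / (n - p)) →
        ∃ C : ℝ, 0 < C ∧
          ∀ (S : Setting n p s C₁ C₂ Λ) (u f : En n → ℝ) (G : En n → En n)
            (x₀ : En n) (r R d : ℝ),
            0 < r → r ≤ 1 → r < R →
            ball x₀ R ⊆ S.Ω →
            IntegrableOn (fun x => |f x| ^ (q / p)) (ball x₀ R) →
            IsSupersol S f u G →
            (∀ x ∈ ball x₀ R, 0 ≤ u x) →
            dBound n p s q u f x₀ r R < d →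
            ∀ σ σ' μ : ℝ, γ ≤ σ' → σ' < σ → σ ≤ 1 → 0 < μ → μ < lam →
              (⨍ x in ball x₀ (σ' * r), (u x + d) ^ lam) ^ (1 / lam) ≤
                (C * (σ - σ') ^ (-θ)) ^ (1 / μ) *
                  (⨍ x in ball x₀ (σ * r), (u x + d) ^ μ) ^ (1 / μ) := by
  have hp0 : 0 < p := by linarith
  have hn0 : (0 : ℝ) < n := by linarith
  have hnp : 0 < (n : ℝ) - p := by linarith
  set κ := (n : ℝ) / (n - p) with hκ
  have hκ1 : 1 < κ := by rw [hκ, one_lt_div hnp]; linarith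
  have hκ0 : 0 < κ := by linarith
  have hκ1' : 0 < κ - 1 := by linarith
  set θ := (n + p) * κ / (κ - 1) * κ with hθ
  have hθ0 : 0 < θ := by positivity
  refine ⟨θ, hθ0, ?_⟩
  intro q C₁ C₂ Λ γ lam hqn hγ hγ1 hlam hlam'
  by_cases hc : 0 < C₁ ∧ 0 < C₂ ∧ 1 ≤ Λ
  swap
  · exact ⟨1, one_pos, fun S => absurd ⟨S.hC₁, S.hC₂, S.hΛ⟩ hc⟩
  obtain ⟨hC₁, hC₂, hΛ⟩ := hc
  have hb : 0 < p - 1 - lam / κ := by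
    rw [sub_pos, div_lt_iff₀ hκ0]
    exact hlam'
  obtain ⟨K, hK, hstep⟩ := exists_moser_step n hp hpn hs0 hs1 hqn hC₁ hC₂ hΛ hb
  have hω : 0 < (volume (ball (0 : En n) 1)).toReal :=
    ENNReal.toReal_pos (measure_ball_pos _ _ one_pos).ne' measure_ball_lt_top.ne
  obtain ⟨A, hA, hit⟩ := exists_iterate_le (θ₀ := n + p) (C := K *
    (volume (ball (0 : En n) 1)).toReal ^ (1 - (n - p) / (n : ℝ)) * γ ^ (-((n : ℝ) - p)))
    hκ1 (by positivity) (by positivity)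
  refine ⟨max 1 A, by positivity, ?_⟩
  intro S u f G x₀ r R d hr hr1 hrR hR hf hsol hu0 hd σ σ' μ hσ' hσ hσ1 hμ hμl
  have hd0 : 0 < d := (dBound_nonneg u f x₀ hr (hr.trans hrR)).trans_lt hd
  have hσ'0 : 0 < σ' := hγ.trans_le hσ'
  have hσ0 : 0 < σ := hσ'0.trans hσ
  have hD : 0 < σ - σ' := by linarith
  have hball : ∀ {τ : ℝ}, τ ≤ 1 → τ * r ≤ r := fun h => mul_le_of_le_one_left hr.le h
  have hv0 : ∀ x ∈ ball x₀ r, 0 ≤ u x + d := fun x hx => by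
    have := hu0 x (ball_subset_ball hrR.le hx)
    positivity
  have hW : MemW1pLoc p u G S.Ω := hsol.1
  have hGR : HasWeakGradOn u G (ball x₀ R) := hW.1.mono hR
  rcases hGR.aestronglyMeasurable_or_zero (ρ := r + 2 * (R - r) / 3) (by linarith) (by linarith)
    fun φ hφ => hW.integrable_smul_gradient hp hR hu0 hφ with hGm | hG0
  · obtain ⟨w, hw₁⟩ := hW.exists_isApprox hp (r := r + (R - r) / 3) (by linarith) (by linarith)
      hR hu0 hGm
    have hw := hw₁.mono (r' := r) (by linarith)
    have hint : IntegrableOn (fun x => (u x + d) ^ μ) (ball x₀ (σ * r)) := by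
      refine (hw₁.integrableOn_add_rpow hp hpn hr (by linarith) hd0 hμ.le ?_).mono_set
        (ball_subset_ball (hball hσ1))
      refine (hμl.trans hlam').le.trans ?_
      gcongr
      linarith
    have h1 := hit (fun σ t => avgNorm (fun x => u x + d) x₀ (σ * r) t) γ lam hlam
      (fun σ σ' t hσ' hσ hσ1 ht hκt => avgNorm_step_le hp0 hpn hr hK hγ hσ' hσ hσ1 ht hv0
        (hstep S u f G x₀ r R d w hr hr1 hrR hR hf hsol hu0 hd hw σ σ' t (by linarith) hσ hσ1 ht
          (by rw [sub_sub_cancel, le_div_iff₀ hκ0]; linarith)))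
      (fun σ t t' hσ hσ1 ht htt => avgNorm_mono (by have := hγ.trans hσ; positivity)
        ((hw.aemeasurable.add_const d).mono_measure
          (Measure.restrict_mono (ball_subset_ball (hball hσ1)) le_rfl))
        (fun x hx => hv0 x (ball_subset_ball (hball hσ1) hx)) ht htt)
      σ σ' μ hγ hσ' hσ hσ1 hμ hμl
    have h2 := (ofReal_setAverage_rpow_le (by positivity : 0 < σ' * r) hlam fun x hx =>
      hv0 x (ball_subset_ball (hball (hσ.le.trans hσ1)) hx)).trans h1
    have hv0' : ∀ x ∈ ball x₀ (σ * r), 0 ≤ u x + d :=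
      fun x hx => hv0 x (ball_subset_ball (hball hσ1) hx)
    rw [avgNorm_eq_ofReal (by positivity) hμ hv0' hint,
      ← ENNReal.ofReal_mul (by positivity)] at h2
    have hav : 0 ≤ ⨍ x in ball x₀ (σ * r), (u x + d) ^ μ := by
      rw [setAverage_eq]
      exact smul_nonneg (by positivity) (setIntegral_nonneg measurableSet_ball fun x hx =>
        Real.rpow_nonneg (hv0' x hx) _)
    refine ((ENNReal.ofReal_le_ofReal_iff (by positivity)).1 h2).trans ?_
    gcongr
    exact le_max_right _ _
  · obtain ⟨c, hc0, hc⟩ := ae_eq_const_of_hasWeakGradOn_zero (by exact_mod_cast hn0) hp.le hr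
      (by linarith : r < r + (R - r) / 2) (hW.memLp_ball hp0 (by linarith) hR hu0)
      (hG0.mono (ball_subset_ball (by linarith)))
      fun x hx => hu0 x (ball_subset_ball (by linarith) hx)
    rw [setAverage_rpow_eq_of_ae_eq_const (by positivity) (hball (hσ.le.trans hσ1)) (by positivity)
      hlam hc, setAverage_rpow_eq_of_ae_eq_const (by positivity) (hball hσ1) (by positivity) hμ hc]
    refine le_mul_of_one_le_left (by positivity) (Real.one_le_rpow ?_ (by positivity))
    exact one_le_mul_of_one_le_of_one_le (le_max_left _ _)
      (Real.one_le_rpow_of_pos_of_le_one_of_nonpos hD (by linarith) (by linarith))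

end
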